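/- Let G be a triangulated planar graph that is connected with graph-theoretic diameter d (the maximum over pairs of vertices of their graph distance). Then fix(G) ≥ √d. -/

import Mathlib

/-- A straight-line drawing `δ` of a simple graph `G` is *plane* if it is injective,
no vertex image lies on the segment of an edge except as one of its endpoints, and
any two distinct edges intersect only in images of common endpoints. -/
def IsPlaneDrawing {V : Type*} (G : SimpleGraph V) (δ : V → ℝ × ℝ) : Prop :=
  Function.Injective δ ∧
  (∀ u v w : V, G.Adj u v → δ w ∈ segment ℝ (δ u) (δ v) → w = u ∨ w = v) ∧
  (∀ u v a b : V, G.Adj u v → G.Adj a b → ({u, v} : Set V) ≠ ({a, b} : Set V) →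
    ∀ p : ℝ × ℝ, p ∈ segment ℝ (δ u) (δ v) → p ∈ segment ℝ (δ a) (δ b) →
      ∃ w : V, (w = u ∨ w = v) ∧ (w = a ∨ w = b) ∧ p = δ w)
namespace FixTri

/-- point on the line through `x`, `y`. -/
def lp (x y : ℝ × ℝ) (t : ℝ) : ℝ × ℝ := ((1 - t) * x.1 + t * y.1, (1 - t) * x.2 + t * y.2)

lemma mem_seg {x y p : ℝ × ℝ} :
    p ∈ segment ℝ x y ↔ ∃ t, 0 ≤ t ∧ t ≤ 1 ∧ p = lp x y t := by
  constructor
  · rintro ⟨a, b, ha, hb, hab, rfl⟩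
    refine ⟨b, hb, by linarith, ?_⟩
    have : a = 1 - b := by linarith
    subst this
    ext <;> simp [lp]
  · rintro ⟨t, h0, h1, rfl⟩
    refine ⟨1 - t, t, by linarith, h0, by ring, ?_⟩
    ext <;> simp [lp]

lemma mem_oseg {x y p : ℝ × ℝ} :
    p ∈ openSegment ℝ x y ↔ ∃ t, 0 < t ∧ t < 1 ∧ p = lp x y t := by
  constructor
  · rintro ⟨a, b, ha, hb, hab, rfl⟩
    refine ⟨b, hb, by linarith, ?_⟩
    have : a = 1 - b := by linarith
    subst this
    ext <;> simp [lp]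
  · rintro ⟨t, h0, h1, rfl⟩
    refine ⟨1 - t, t, by linarith, h0, by ring, ?_⟩
    ext <;> simp [lp]

/-- orientation determinant. -/
def cr (p q r : ℝ × ℝ) : ℝ := (q.1 - p.1) * (r.2 - p.2) - (q.2 - p.2) * (r.1 - p.1)

/-- affine functions on the plane. -/
def Aff (f : ℝ × ℝ → ℝ) : Prop := ∀ x y t, f (lp x y t) = (1 - t) * f x + t * f y

lemma aff_cr (p q : ℝ × ℝ) : Aff (cr p q) := by
  intro x y t; simp only [cr, lp]; ring

lemma cr_rot (p q r : ℝ × ℝ) : cr p q r = cr q r p := by simp only [cr]; ring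
lemma cr_swap (p q r : ℝ × ℝ) : cr p q r = - cr p r q := by simp only [cr]; ring

/-- affine coordinates with origin `v` and unit points `q`, `s`. -/
structure Crd (v q s : ℝ × ℝ) (α β : ℝ × ℝ → ℝ) : Prop where
  aα : Aff α
  aβ : Aff β
  vα : α v = 0
  vβ : β v = 0
  qα : α q = 1
  qβ : β q = 0
  sα : α s = 0
  sβ : β s = 1
  ext : ∀ x y, α x = α y → β x = β y → x = y
  exp : ∀ f, Aff f → ∀ x, f x = f v + α x * (f q - f v) + β x * (f s - f v)

lemma exists_crd {v q s : ℝ × ℝ} (h : cr v q s ≠ 0) :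
    Crd v q s (fun x => cr v x s / cr v q s) (fun x => cr v q x / cr v q s) := by
  have hrec : ∀ x : ℝ × ℝ, x.1 = v.1 + cr v x s / cr v q s * (q.1 - v.1) + cr v q x / cr v q s * (s.1 - v.1) ∧
    x.2 = v.2 + cr v x s / cr v q s * (q.2 - v.2) + cr v q x / cr v q s * (s.2 - v.2) := by
    intro x
    constructor <;> field_simp <;> simp only [cr] <;> ring
  refine ⟨?_, ?_, ?_, ?_, ?_, ?_, ?_, ?_, ?_, ?_⟩
  · intro x y t; simp only [cr, lp]; ring
  · intro x y t; simp only [cr, lp]; ring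
  · simp [cr]
  · simp [cr]
  · simp [h]
  · simp only [cr]; ring_nf
  · simp only [cr]; ring_nf
  · simp [h]
  · intro x y h1 h2
    have a := hrec x
    have b := hrec y
    rw [h1, h2] at a
    ext
    · rw [a.1, ← b.1]
    · rw [a.2, ← b.2]
  · intro f hf x
    generalize hα : cr v x s / cr v q s = α
    generalize hβ : cr v q x / cr v q s = β
    have a := hrec x
    rw [hα, hβ] at a
    by_cases hβ0 : β = 0
    · have : x = lp v q α := by ext <;> simp [lp, a.1, a.2, hβ0] <;> ring
      rw [this, hf, hβ0]; ring
    · -- x = lp (lp v q α) ... use translated point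
      have e1 : x = lp (lp v q (2 * α)) (lp v s (2 * β)) (1/2) := by
        ext <;> simp only [lp, a.1, a.2] <;> ring
      rw [e1, hf, hf, hf]; ring

variable {V : Type*}

/-- maximal plane drawing -/
def MaxPlane (G : SimpleGraph V) (δ : V → ℝ × ℝ) : Prop :=
  IsPlaneDrawing G δ ∧ ∀ G' : SimpleGraph V, G ≤ G' → IsPlaneDrawing G' δ → G' ≤ G

lemma endpoint_cases {x y p : ℝ × ℝ} (h : p ∈ segment ℝ x y) : p = x ∨ p = y ∨ p ∈ openSegment ℝ x y := by
  obtain ⟨t, h0, h1, rfl⟩ := mem_seg.1 h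
  rcases h0.eq_or_lt with rfl | h0
  · left; ext <;> simp [lp]
  rcases h1.eq_or_lt with rfl | h1
  · right; left; ext <;> simp [lp]
  · right; right; exact mem_oseg.2 ⟨t, h0, h1, rfl⟩

lemma add_edge {G : SimpleGraph V} {δ : V → ℝ × ℝ} (hM : MaxPlane G δ) {v z : V} (hvz : v ≠ z)
    (h1 : ∀ w, δ w ∉ openSegment ℝ (δ v) (δ z))
    (h2 : ∀ s t, G.Adj s t → ∀ p ∈ openSegment ℝ (δ v) (δ z), p ∉ segment ℝ (δ s) (δ t)) :
    G.Adj v z := by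
  obtain ⟨⟨hinj, hP2, hP3⟩, hmax⟩ := hM
  have key : ∀ a b, G.Adj a b → ∀ p ∈ segment ℝ (δ v) (δ z), p ∈ segment ℝ (δ a) (δ b) →
      ∃ w, (w = v ∨ w = z) ∧ (w = a ∨ w = b) ∧ p = δ w := by
    intro a b hab p hp hp'
    rcases endpoint_cases hp with rfl | rfl | h
    · exact ⟨v, Or.inl rfl, hP2 _ _ _ hab hp', rfl⟩
    · exact ⟨z, Or.inr rfl, hP2 _ _ _ hab hp', rfl⟩
    · exact absurd hp' (h2 _ _ hab _ h)
  have kv : ∀ w, δ w ∈ segment ℝ (δ v) (δ z) → w = v ∨ w = z := by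
    intro w hw
    rcases endpoint_cases hw with h | h | h
    · exact Or.inl (hinj h)
    · exact Or.inr (hinj h)
    · exact absurd h (h1 w)
  have := hmax (G ⊔ SimpleGraph.edge v z) le_sup_left ?_
  · apply this
    simp [SimpleGraph.edge_adj, hvz]
  · refine ⟨hinj, ?_, ?_⟩
    · intro a b w hab hw
      rw [SimpleGraph.sup_adj, SimpleGraph.edge_adj] at hab
      rcases hab with hab | ⟨⟨rfl, rfl⟩ | ⟨rfl, rfl⟩, -⟩
      · exact hP2 _ _ _ hab hw
      · exact kv w hw
      · rw [segment_symm] at hw; exact (kv w hw).symm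
    · intro a b c d hab hcd hne p hp hp'
      rw [SimpleGraph.sup_adj, SimpleGraph.edge_adj] at hab hcd
      rcases hab with hab | ⟨⟨rfl, rfl⟩ | ⟨rfl, rfl⟩, -⟩ <;>
        rcases hcd with hcd | ⟨⟨rfl, rfl⟩ | ⟨rfl, rfl⟩, -⟩
      · exact hP3 _ _ _ _ hab hcd hne p hp hp'
      · obtain ⟨w, h1, h2, h3⟩ := key _ _ hab p hp' hp
        exact ⟨w, h2, h1, h3⟩
      · rw [segment_symm] at hp'
        obtain ⟨w, h1, h2, h3⟩ := key _ _ hab p hp' hp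
        exact ⟨w, h2, h1.symm, h3⟩
      · exact key _ _ hcd p hp hp'
      · exact absurd rfl hne
      · exact absurd (Set.pair_comm _ _) hne
      · rw [segment_symm] at hp
        obtain ⟨w, h1, h2, h3⟩ := key _ _ hcd p hp hp'
        exact ⟨w, h1.symm, h2, h3⟩
      · exact absurd (Set.pair_comm _ _) hne
      · exact absurd rfl hne

/-- edges meeting in a point which is not an endpoint of the first are equal -/
lemma cross_eq {G : SimpleGraph V} {δ : V → ℝ × ℝ} (hP : IsPlaneDrawing G δ) {s t a b : V}
    (hst : G.Adj s t) (hab : G.Adj a b) {p : ℝ × ℝ} (hp : p ∈ segment ℝ (δ s) (δ t))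
    (hp' : p ∈ segment ℝ (δ a) (δ b)) (h1 : p ≠ δ s) (h2 : p ≠ δ t) :
    (a = s ∧ b = t) ∨ (a = t ∧ b = s) := by
  by_contra hne
  have hne' : ({s, t} : Set V) ≠ {a, b} := by
    intro h
    have e := Set.pair_eq_pair_iff.1 h
    tauto
  obtain ⟨w, hw, -, rfl⟩ := hP.2.2 s t a b hst hab hne' p hp hp'
  rcases hw with rfl | rfl <;> simp_all

lemma lp_zero (x y : ℝ × ℝ) : lp x y 0 = x := by ext <;> simp [lp]
lemma lp_one (x y : ℝ × ℝ) : lp x y 1 = y := by ext <;> simp [lp]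

/-- two neighbours on the same ray coincide -/
lemma ray_unique {G : SimpleGraph V} {δ : V → ℝ × ℝ} (hP : IsPlaneDrawing G δ) {v u w : V}
    (hu : G.Adj v u) (hw : G.Adj v w) {c : ℝ} (hc : 0 < c)
    (h1 : (δ w).1 - (δ v).1 = c * ((δ u).1 - (δ v).1))
    (h2 : (δ w).2 - (δ v).2 = c * ((δ u).2 - (δ v).2)) : u = w := by
  rcases le_total c 1 with h | h
  · have : δ w ∈ segment ℝ (δ v) (δ u) := mem_seg.2 ⟨c, hc.le, h, by
      ext <;> simp only [lp] <;> linarith⟩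
    rcases hP.2.1 _ _ _ hu this with rfl | rfl
    · exact absurd rfl hw.ne
    · rfl
  · have : δ u ∈ segment ℝ (δ v) (δ w) := mem_seg.2 ⟨c⁻¹, (inv_pos.2 hc).le, inv_le_one_of_one_le₀ h, by
      have e1 : (δ u).1 - (δ v).1 = c⁻¹ * ((δ w).1 - (δ v).1) := by rw [h1]; field_simp
      have e2 : (δ u).2 - (δ v).2 = c⁻¹ * ((δ w).2 - (δ v).2) := by rw [h2]; field_simp
      ext <;> simp only [lp] <;> linarith⟩
    rcases hP.2.1 _ _ _ hw this with rfl | rfl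
    · exact absurd rfl hu.ne
    · rfl

end FixTri
namespace FixTri
variable {V : Type*}

def Fam (G : SimpleGraph V) (v s t : V) : Prop := s ≠ v ∧ t ≠ v ∧ (s = t ∨ G.Adj s t)

lemma Fam.symm {G : SimpleGraph V} {v s t : V} (h : Fam G v s t) : Fam G v t s :=
  ⟨h.2.1, h.1, h.2.2.imp Eq.symm SimpleGraph.Adj.symm⟩

lemma v_notin_fam {G : SimpleGraph V} {δ : V → ℝ × ℝ} (hP : IsPlaneDrawing G δ) {v s t : V}
    (h : Fam G v s t) : δ v ∉ segment ℝ (δ s) (δ t) := by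
  intro hm
  rcases h.2.2 with rfl | ha
  · rw [segment_same] at hm
    exact h.1 (hP.1 hm).symm
  · rcases hP.2.1 _ _ _ ha hm with e | e
    · exact h.1 e.symm
    · exact h.2.1 e.symm

lemma blocker {G : SimpleGraph V} {δ : V → ℝ × ℝ} (hM : MaxPlane G δ) {v p : V} (hvp : v ≠ p)
    {f : ℝ × ℝ → ℝ} (hf : Aff f) (hv : f (δ v) = 0) (hp : 0 < f (δ p))
    (hno : ∀ u, G.Adj v u → f (δ u) ≤ 0) :
    ∃ c s t, 0 < c ∧ c < 1 ∧ Fam G v s t ∧ lp (δ v) (δ p) c ∈ segment ℝ (δ s) (δ t) := by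
  by_contra hcon
  push Not at hcon
  have hray : ∀ u, G.Adj v u → ∀ c, 0 < c → lp (δ v) (δ p) c ∉ segment ℝ (δ v) (δ u) := by
    intro u hu c hc hm
    obtain ⟨t, h0, h1, e⟩ := mem_seg.1 hm
    have := congrArg f e
    rw [hf, hf, hv] at this
    have h3 := hno u hu
    have : 0 < c * f (δ p) := mul_pos hc hp
    have : t * f (δ u) ≤ 0 := mul_nonpos_of_nonneg_of_nonpos h0 h3
    linarith
  have : G.Adj v p := by
    apply add_edge hM hvp
    · intro w hw
      obtain ⟨c, h0, h1, e⟩ := mem_oseg.1 hw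
      by_cases hwv : w = v
      · subst hwv
        have := congrArg f e
        rw [hf, hv] at this
        have : 0 < c * f (δ p) := mul_pos h0 hp
        linarith
      · refine hcon c w w h0 h1 ⟨hwv, hwv, Or.inl rfl⟩ ?_
        rw [segment_same, e]; rfl
    · intro s t hst x hx hx'
      obtain ⟨c, h0, h1, rfl⟩ := mem_oseg.1 hx
      by_cases hs : s = v
      · subst hs; exact hray t hst c h0 hx'
      by_cases ht : t = v
      · subst ht; rw [segment_symm] at hx'; exact hray s hst.symm c h0 hx'
      · exact hcon c s t h0 h1 ⟨hs, ht, Or.inr hst⟩ hx'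
  linarith [hno p this]

lemma first_hit [Finite V] {G : SimpleGraph V} {δ : V → ℝ × ℝ} (hP : IsPlaneDrawing G δ) {v z : V}
    (hvz : v ≠ z) : ∃ c, 0 < c ∧ c ≤ 1 ∧
      (∃ s t, Fam G v s t ∧ lp (δ v) (δ z) c ∈ segment ℝ (δ s) (δ t)) ∧
      ∀ c', 0 ≤ c' → c' < c → ∀ s t, Fam G v s t → lp (δ v) (δ z) c' ∉ segment ℝ (δ s) (δ t) := by
  let S : Set ℝ := Set.Icc 0 1 ∩ (lp (δ v) (δ z)) ⁻¹'
    (⋃ x ∈ {x : V × V | Fam G v x.1 x.2}, segment ℝ (δ x.1) (δ x.2))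
  have hc : Continuous (lp (δ v) (δ z)) := by unfold lp; fun_prop
  have hcl : IsClosed (⋃ x ∈ {x : V × V | Fam G v x.1 x.2}, segment ℝ (δ x.1) (δ x.2)) := by
    apply Set.Finite.isClosed_biUnion (Set.toFinite _)
    intro x _
    have : segment ℝ (δ x.1) (δ x.2) = convexHull ℝ {δ x.1, δ x.2} := (convexHull_pair _ _).symm
    rw [this]
    exact ((Set.toFinite _).isCompact_convexHull ℝ).isClosed
  have hS : IsCompact S := isCompact_Icc.inter_right (hcl.preimage hc)
  have hne : S.Nonempty := by
    refine ⟨1, ⟨by norm_num, by norm_num⟩, ?_⟩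
    simp only [Set.mem_preimage, Set.mem_iUnion]
    exact ⟨(z, z), ⟨hvz.symm, hvz.symm, Or.inl rfl⟩, by rw [lp_one, segment_same]; rfl⟩
  obtain ⟨c, hcS, hmin⟩ := hS.exists_isLeast hne
  obtain ⟨⟨h0, h1⟩, hm⟩ := hcS
  simp only [Set.mem_preimage, Set.mem_iUnion] at hm
  obtain ⟨⟨s, t⟩, hF, hm⟩ := hm
  have hpos : 0 < c := by
    rcases h0.eq_or_lt with rfl | h
    · rw [lp_zero] at hm; exact absurd hm (v_notin_fam hP hF)
    · exact h
  refine ⟨c, hpos, h1, ⟨s, t, hF, hm⟩, ?_⟩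
  intro c' h0' h1' s t hst hm
  have := hmin (a := c') ⟨⟨h0', by linarith⟩, by
    simp only [Set.mem_preimage, Set.mem_iUnion]; exact ⟨(s, t), hst, hm⟩⟩
  linarith

lemma aff_hit {g : ℝ × ℝ → ℝ} (hg : Aff g) {r x : ℝ × ℝ} {c : ℝ} (h1 : g r < c) (h2 : c ≤ g x) :
    ∃ τ, 0 < τ ∧ τ ≤ 1 ∧ g (lp r x τ) = c := by
  refine ⟨(c - g r) / (g x - g r), div_pos (by linarith) (by linarith), (div_le_one (by linarith)).2 (by linarith), ?_⟩
  rw [hg]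
  have : g x - g r ≠ 0 := by linarith
  field_simp; ring

lemma lp_mem {x y : ℝ × ℝ} {t : ℝ} (h0 : 0 ≤ t) (h1 : t ≤ 1) : lp x y t ∈ segment ℝ x y :=
  mem_seg.2 ⟨t, h0, h1, rfl⟩

lemma lp_lp (v z : ℝ × ℝ) (a c : ℝ) : lp v (lp v z c) a = lp v z (a * c) := by
  ext <;> simp only [lp] <;> ring

lemma collinear_lp {v q s : ℝ × ℝ} (h : cr v q s = 0) (hvq : v ≠ q) : ∃ a, s = lp v q a := by
  by_cases h1 : q.1 - v.1 = 0
  · have h2 : q.2 - v.2 ≠ 0 := by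
      intro h2; apply hvq; ext <;> linarith
    refine ⟨(s.2 - v.2) / (q.2 - v.2), ?_⟩
    have h3 : s.1 - v.1 = 0 := by
      simp only [cr, h1] at h
      have : (q.2 - v.2) * (s.1 - v.1) = 0 := by linarith
      rcases mul_eq_zero.1 this with h | h
      · exact absurd h h2
      · exact h
    ext
    · simp only [lp]; linear_combination h3 - (s.2 - v.2) / (q.2 - v.2) * h1
    · simp only [lp]; field_simp; ring
  · refine ⟨(s.1 - v.1) / (q.1 - v.1), ?_⟩
    simp only [cr] at h
    ext
    · simp only [lp]; field_simp; ring
    · simp only [lp]; field_simp; linear_combination h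

set_option maxHeartbeats 1000000 in
/-- core of the left lemma -/
lemma left_core [Finite V] {G : SimpleGraph V} {δ : V → ℝ × ℝ} (hM : MaxPlane G δ) {v s t : V}
    {q : ℝ × ℝ} {f : ℝ × ℝ → ℝ} (hf : Aff f) (hv : f (δ v) = 0) (hq : 0 < f q)
    (hst : Fam G v s t) (hqm : q ∈ segment ℝ (δ s) (δ t)) (hqv : ∀ p, q ≠ δ p) (hs : 0 < f (δ s))
    (hFH : ∀ c, 0 ≤ c → c < 1 → ∀ s t, Fam G v s t → lp (δ v) q c ∉ segment ℝ (δ s) (δ t)) :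
    ∃ u, G.Adj v u ∧ 0 < f (δ u) := by
  by_contra hno
  push Not at hno
  have hP := hM.1
  have hadj : G.Adj s t := by
    rcases hst.2.2 with rfl | h
    · rw [segment_same] at hqm; exact absurd hqm (hqv s)
    · exact h
  obtain ⟨μ, hμ0, hμ1, hqe⟩ := mem_seg.1 hqm
  have hμ0' : 0 < μ := by
    rcases hμ0.eq_or_lt with rfl | h
    · rw [lp_zero] at hqe; exact absurd hqe (hqv s)
    · exact h
  have hμ1' : μ < 1 := by
    rcases hμ1.eq_or_lt with rfl | h
    · rw [lp_one] at hqe; exact absurd hqe (hqv t)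
    · exact h
  -- noncollinear
  have hnc : cr (δ v) q (δ s) ≠ 0 := by
    intro h0
    have hvq : δ v ≠ q := (hqv v).symm
    have h1 : cr (δ v) q (δ t) = 0 := by
      have h2 := aff_cr (δ v) q (δ s) (δ t) μ
      rw [← hqe, h0] at h2
      have h3 : cr (δ v) q q = 0 := by simp only [cr]; ring
      rw [h3] at h2
      have : μ * cr (δ v) q (δ t) = 0 := by linarith
      exact (mul_eq_zero.1 this).resolve_left hμ0'.ne'
    obtain ⟨a, ha⟩ := collinear_lp h0 hvq
    obtain ⟨b, hb⟩ := collinear_lp h1 hvq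
    have hab : (1 - μ) * a + μ * b = 1 := by
      have := congrArg f hqe
      rw [hf, ha, hb, hf, hf, hv] at this
      have e : ((1 - μ) * a + μ * b - 1) * f q = 0 := by linear_combination -this
      have := (mul_eq_zero.1 e).resolve_right hq.ne'
      linarith
    have ha0 : a ≠ 1 := by
      rintro rfl; rw [lp_one] at ha; exact hqv s ha.symm
    have F1 : ∀ w : V, w ≠ v → ∀ c, δ w = lp (δ v) q c → c < 1 → c < 0 := by
      intro w hw c hc h1
      by_contra h0
      push Not at h0
      apply hFH c h0 h1 w w ⟨hw, hw, Or.inl rfl⟩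
      rw [segment_same, hc]; rfl
    have F2 : ∀ a b : ℝ, a < 0 → 0 < b → lp (lp (δ v) q a) (lp (δ v) q b) (-a / (b - a)) = δ v := by
      intro a b ha hb
      have : b - a ≠ 0 := by linarith
      ext <;> simp only [lp] <;> field_simp <;> ring
    apply v_notin_fam hP hst
    rcases lt_or_gt_of_ne ha0 with h | h
    · have ha' := F1 s hst.1 a ha h
      have hb' : 0 < b := by
        by_contra hb'; push Not at hb'
        nlinarith
      rw [← F2 a b ha' hb', ha, hb]
      exact lp_mem (div_nonneg (by linarith) (by linarith)) ((div_le_one (by linarith)).2 (by linarith))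
    · have hb1 : b < 1 := by
        by_contra hb'; push Not at hb'
        nlinarith
      have hb' := F1 t hst.2.1 b hb hb1
      rw [segment_symm, ← F2 b a hb' (by linarith), ha, hb]
      exact lp_mem (div_nonneg (by linarith) (by linarith)) ((div_le_one (by linarith)).2 (by linarith))
  obtain ⟨α, β, C⟩ : ∃ α β, Crd (δ v) q (δ s) α β := ⟨_, _, exists_crd hnc⟩
  have hfx : ∀ x, f x = α x * f q + β x * f (δ s) := by
    intro x; rw [C.exp f hf x, hv]; ring
  have βt : (1 - μ) + μ * β (δ t) = 0 := by
    have := congrArg β hqe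
    rw [C.aβ, C.qβ, C.sβ] at this; linarith
  have αt : μ * α (δ t) = 1 := by
    have := congrArg α hqe
    rw [C.aα, C.qα, C.sα] at this; linarith
  -- points with β = 0
  have hβ0 : ∀ x s' t', Fam G v s' t' → x ∈ segment ℝ (δ s') (δ t') → β x = 0 → 0 ≤ α x → α x < 1 → False := by
    intro x s' t' hF hx h0 h1 h2
    apply hFH (α x) h1 h2 s' t' hF
    have : lp (δ v) q (α x) = x := by
      apply C.ext
      · rw [C.aα, C.vα, C.qα]; ring
      · rw [C.aβ, C.vβ, C.qβ, h0]; ring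
    rwa [this]
  -- bad points
  have hbad : ∀ x s' t', G.Adj s' t' → x ∈ segment ℝ (δ s') (δ t') → α x + β x = 1 → 0 ≤ β x → 0 < α x →
      ∀ r ∈ segment ℝ (δ s') (δ t'), α r + β r < 1 → False := by
    intro x s' t' ha hx h1 h2 h3 r hr h4
    have hxst : x ∈ segment ℝ (δ s) (δ t) := by
      refine mem_seg.2 ⟨α x * μ, by positivity, by nlinarith, ?_⟩
      apply C.ext
      · rw [C.aα, C.sα]; linear_combination (-α x) * αt
      · rw [C.aβ, C.sβ]; linear_combination (-α x) * βt + h1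
    have e1 : x ≠ δ s := by rintro rfl; rw [C.sα] at h3; exact lt_irrefl _ h3
    have e2 : x ≠ δ t := by
      rintro rfl; nlinarith
    have hrst : r ∈ segment ℝ (δ s) (δ t) := by
      rcases cross_eq hP hadj ha hxst hx e1 e2 with ⟨rfl, rfl⟩ | ⟨rfl, rfl⟩
      · exact hr
      · rwa [segment_symm]
    obtain ⟨τ, -, -, rfl⟩ := mem_seg.1 hrst
    have hsum : α (δ t) + β (δ t) = 1 := by
      have : μ * (α (δ t) + β (δ t) - 1) = 0 := by linear_combination αt + βt
      have := (mul_eq_zero.1 this).resolve_left hμ0'.ne'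
      linarith
    rw [C.aα, C.aβ, C.sα, C.sβ] at h4
    have : (1 - τ) * 0 + τ * α (δ t) + ((1 - τ) * 1 + τ * β (δ t)) = 1 := by
      linear_combination τ * hsum
    linarith
  -- the extremal vertex
  let S : Set V := {p | p ≠ v ∧ 0 ≤ α (δ p) ∧ 0 ≤ β (δ p) ∧ α (δ p) + β (δ p) ≤ 1}
  have hSβ : ∀ p ∈ S, 0 < β (δ p) := by
    rintro p ⟨h1, h2, h3, h4⟩
    rcases h3.eq_or_lt with h | h
    · exfalso
      rcases (show α (δ p) ≤ 1 by linarith).eq_or_lt with h5 | h5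
      · exact hqv p (C.ext _ _ (by rw [C.qα, h5]) (by rw [C.qβ, h]))
      · exact hβ0 (δ p) p p ⟨h1, h1, Or.inl rfl⟩ (by rw [segment_same]; rfl) h.symm h2 h5
    · exact h
  obtain ⟨p, hpS, hmax⟩ := Set.exists_max_image S
    (fun p => toLex ((α (δ p) / β (δ p), - β (δ p)) : ℝ × ℝ)) (Set.toFinite _)
    ⟨s, hst.1, by rw [C.sα], by rw [C.sβ]; norm_num, by rw [C.sα, C.sβ]; norm_num⟩
  have hmax1 : ∀ w ∈ S, α (δ w) * β (δ p) ≤ β (δ w) * α (δ p) := by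
    intro w hw
    have h1 := hmax w hw
    rw [Prod.Lex.toLex_le_toLex] at h1
    have h2 : α (δ w) / β (δ w) ≤ α (δ p) / β (δ p) := by
      rcases h1 with h | h
      · exact h.le
      · exact h.1.le
    rw [div_le_div_iff₀ (hSβ w hw) (hSβ p hpS)] at h2
    linarith
  have hmax2 : ∀ w ∈ S, α (δ w) * β (δ p) = β (δ w) * α (δ p) → β (δ p) ≤ β (δ w) := by
    intro w hw h2
    have h1 := hmax w hw
    rw [Prod.Lex.toLex_le_toLex] at h1
    have h2 : α (δ w) / β (δ w) = α (δ p) / β (δ p) := by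
      rw [div_eq_div_iff (hSβ w hw).ne' (hSβ p hpS).ne']; linarith
    rcases h1 with h | h
    · exact absurd h2 h.ne
    · have := h.2
      simp only at this
      linarith
  have hpβ := hSβ p hpS
  obtain ⟨hpv, hpα, -, hp1⟩ := hpS
  obtain ⟨c, s', t', hc0, hc1, hF, hr⟩ := blocker hM hpv.symm hf hv
    (by rw [hfx]; have := mul_nonneg hpα hq.le; have := mul_pos hpβ hs; linarith) hno
  generalize hrr : lp (δ v) (δ p) c = r at hr
  have rα : α r = c * α (δ p) := by rw [← hrr, C.aα, C.vα]; ring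
  have rβ : β r = c * β (δ p) := by rw [← hrr, C.aβ, C.vβ]; ring
  have rα0 : 0 ≤ α r := by rw [rα]; positivity
  have rβ0 : 0 < β r := by rw [rβ]; positivity
  have r1 : α r + β r < 1 := by
    rw [rα, rβ]; nlinarith
  -- vertex on the line
  have hline : ∀ w, w ≠ v → α (δ w) * β (δ p) = β (δ w) * α (δ p) → β (δ w) < β (δ p) → β (δ w) ≤ 0 := by
    intro w hw h1 h2
    by_contra h3
    push Not at h3
    have hα : 0 ≤ α (δ w) := by
      have : 0 ≤ α (δ w) * β (δ p) := by rw [h1]; positivity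
      exact nonneg_of_mul_nonneg_left this hpβ
    have hαle : α (δ w) ≤ α (δ p) := by
      have : α (δ w) * β (δ p) ≤ α (δ p) * β (δ p) := by rw [h1, mul_comm (α (δ p))]; gcongr
      exact le_of_mul_le_mul_right this hpβ
    linarith [hmax2 w ⟨hw, hα, h3.le, by linarith⟩ h1]
  obtain ⟨ν, hν0, hν1, hre⟩ := mem_seg.1 hr
  have eα : α r = (1 - ν) * α (δ s') + ν * α (δ t') := by rw [hre, C.aα]
  have eβ : β r = (1 - ν) * β (δ s') + ν * β (δ t') := by rw [hre, C.aβ]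
  have hadj' : G.Adj s' t' := by
    rcases hF.2.2 with rfl | h
    · exfalso
      have e1 : α r = α (δ s') := by rw [eα]; ring
      have e2 : β r = β (δ s') := by rw [eβ]; ring
      have := hline s' hF.1 (by rw [← e1, ← e2, rα, rβ]; ring) (by rw [← e2, rβ]; nlinarith)
      linarith
    · exact h
  -- main exit argument
  have main : ∀ w, w ≠ v → δ w ∈ segment ℝ (δ s') (δ t') → β (δ w) * α (δ p) < α (δ w) * β (δ p) → False := by
    intro w hw hwm hk
    have hsub : ∀ τ, 0 ≤ τ → τ ≤ 1 → lp r (δ w) τ ∈ segment ℝ (δ s') (δ t') := fun τ h0 h1 =>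
      (convex_segment _ _).segment_subset hr hwm (lp_mem h0 h1)
    have hkx : ∀ τ, 0 < τ → τ ≤ 1 → β (lp r (δ w) τ) * α (δ p) < α (lp r (δ w) τ) * β (δ p) := by
      intro τ h0 h1
      rw [C.aα, C.aβ, rα, rβ]
      have := mul_lt_mul_of_pos_left hk h0
      nlinarith
    have hαpos : ∀ x, 0 ≤ β x → β x * α (δ p) < α x * β (δ p) → 0 < α x := by
      intro x h0 h1
      have : 0 < α x * β (δ p) := lt_of_le_of_lt (by positivity) h1
      exact pos_of_mul_pos_left this hpβ.le
    have asum : Aff (fun x => α x + β x) := by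
      intro x y t; simp only [C.aα x y t, C.aβ x y t]; ring
    rcases le_or_gt 0 (β (δ w)) with h | h
    · have hαw := hαpos _ h hk
      have hnS : 1 < α (δ w) + β (δ w) := by
        by_contra hc; push Not at hc
        have := hmax1 w ⟨hw, hαw.le, h, hc⟩
        linarith
      obtain ⟨τ, h0, h1, h2⟩ := aff_hit asum r1 hnS.le
      have hb : 0 ≤ β (lp r (δ w) τ) := by
        rw [C.aβ]; have : 0 ≤ 1 - τ := by linarith
        positivity
      exact hbad _ s' t' hadj' (hsub τ h0.le h1) h2 hb (hαpos _ hb (hkx τ h0 h1)) r hr r1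
    · have anb : Aff (fun x => - β x) := by
        intro x y t; simp only [C.aβ x y t]; ring
      obtain ⟨τ, h0, h1, h2⟩ := aff_hit (r := r) (x := δ w) (c := 0) anb (by linarith) (by linarith)
      have hβx : β (lp r (δ w) τ) = 0 := by linarith
      have hαx := hαpos _ hβx.ge (hkx τ h0 h1)
      rcases lt_or_ge (α (lp r (δ w) τ)) 1 with h3 | h3
      · exact hβ0 _ s' t' hF (hsub τ h0.le h1) hβx hαx.le h3
      · obtain ⟨τ', h0', h1', h2'⟩ := aff_hit (r := r) (x := lp r (δ w) τ) asum r1 (by linarith)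
        have e : lp r (lp r (δ w) τ) τ' = lp r (δ w) (τ' * τ) := lp_lp _ _ _ _
        have hb : 0 ≤ β (lp r (lp r (δ w) τ) τ') := by
          rw [C.aβ, hβx]; have : 0 ≤ 1 - τ' := by linarith
          positivity
        rw [e] at h2' hb
        have hle : τ' * τ ≤ 1 := by nlinarith
        have hp' : 0 < τ' * τ := by positivity
        exact hbad _ s' t' hadj' (hsub _ hp'.le hle) h2' hb (hαpos _ hb (hkx _ hp' hle)) r hr r1
  have k1 : α (δ s') * β (δ p) ≤ β (δ s') * α (δ p) := by
    by_contra h; push Not at h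
    exact main s' hF.1 (left_mem_segment _ _ _) h
  have k2 : α (δ t') * β (δ p) ≤ β (δ t') * α (δ p) := by
    by_contra h; push Not at h
    exact main t' hF.2.1 (right_mem_segment _ _ _) h
  have krel : (1 - ν) * (α (δ s') * β (δ p) - β (δ s') * α (δ p)) +
      ν * (α (δ t') * β (δ p) - β (δ t') * α (δ p)) = 0 := by
    have : α r * β (δ p) - β r * α (δ p) = 0 := by rw [rα, rβ]; ring
    rw [eα, eβ] at this; linarith
  have hν0' : 0 < ν := by
    rcases hν0.eq_or_lt with h | h
    · exfalso
      rw [← h] at eα eβ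
      have := hline s' hF.1 (by
        have : α (δ s') = α r := by rw [eα]; ring
        have e2 : β (δ s') = β r := by rw [eβ]; ring
        rw [this, e2, rα, rβ]; ring) (by
        have e2 : β (δ s') = β r := by rw [eβ]; ring
        rw [e2, rβ]; nlinarith)
      linarith
    · exact h
  have hν1' : 0 < 1 - ν := by
    rcases (show 0 ≤ 1 - ν by linarith).eq_or_lt with h | h
    · exfalso
      have hν : ν = 1 := by linarith
      rw [hν] at eα eβ
      have := hline t' hF.2.1 (by
        have : α (δ t') = α r := by rw [eα]; ring
        have e2 : β (δ t') = β r := by rw [eβ]; ring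
        rw [this, e2, rα, rβ]; ring) (by
        have e2 : β (δ t') = β r := by rw [eβ]; ring
        rw [e2, rβ]; nlinarith)
      linarith
    · exact h
  have kk1 := mul_nonneg hν1'.le (sub_nonneg.2 k1)
  have kk2 := mul_nonneg hν0'.le (sub_nonneg.2 k2)
  have k1' : α (δ s') * β (δ p) = β (δ s') * α (δ p) := by
    have : (1 - ν) * (β (δ s') * α (δ p) - α (δ s') * β (δ p)) = 0 := by linarith
    linarith [(mul_eq_zero.1 this).resolve_left hν1'.ne']
  have k2' : α (δ t') * β (δ p) = β (δ t') * α (δ p) := by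
    have : ν * (β (δ t') * α (δ p) - α (δ t') * β (δ p)) = 0 := by linarith
    linarith [(mul_eq_zero.1 this).resolve_left hν0'.ne']
  have rlt : β r < β (δ p) := by rw [rβ]; nlinarith
  -- v lies between
  have fin : ∀ a b : V, Fam G v a b → α (δ a) * β (δ p) = β (δ a) * α (δ p) →
      α (δ b) * β (δ p) = β (δ b) * α (δ p) → β (δ a) ≤ 0 → 0 < β (δ b) → False := by
    intro a b hab h1 h2 h3 h4
    apply v_notin_fam hP hab
    have hne : β (δ b) - β (δ a) ≠ 0 := by linarith
    refine mem_seg.2 ⟨-β (δ a) / (β (δ b) - β (δ a)), div_nonneg (by linarith) (by linarith),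
      (div_le_one (by linarith)).2 (by linarith), ?_⟩
    apply C.ext
    · rw [C.aα, C.vα]
      field_simp
      have : (β (δ b) * α (δ a) - β (δ a) * α (δ b)) * β (δ p) = 0 := by
        linear_combination β (δ b) * h1 - β (δ a) * h2
      have := (mul_eq_zero.1 this).resolve_right hpβ.ne'
      linarith
    · rw [C.aβ, C.vβ]
      field_simp
      ring
  rcases lt_or_ge (β (δ s')) (β (δ p)) with h | h
  · have h1 := hline s' hF.1 k1' h
    refine fin s' t' hF k1' k2' h1 ?_
    by_contra h2; push Not at h2
    have a1 := mul_nonneg hν1'.le (sub_nonneg.2 h1)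
    have a2 := mul_nonneg hν0'.le (sub_nonneg.2 h2)
    linarith
  · have ht : β (δ t') < β (δ p) := by
      by_contra h2; push Not at h2
      have a1 := mul_nonneg hν1'.le (sub_nonneg.2 h)
      have a2 := mul_nonneg hν0'.le (sub_nonneg.2 h2)
      linarith
    have h1 := hline t' hF.2.1 k2' ht
    exact fin t' s' hF.symm k2' k1' h1 (by linarith)

lemma left_nbr [Finite V] {G : SimpleGraph V} {δ : V → ℝ × ℝ} (hM : MaxPlane G δ) {v z : V}
    {f : ℝ × ℝ → ℝ} (hf : Aff f) (hv : f (δ v) = 0) (hz : 0 < f (δ z)) :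
    ∃ u, G.Adj v u ∧ 0 < f (δ u) := by
  have hP := hM.1
  have hvz : v ≠ z := by rintro rfl; linarith
  obtain ⟨c, hc0, hc1, ⟨s, t, hF, hm⟩, hmin⟩ := first_hit (G := G) hP hvz
  generalize hq : lp (δ v) (δ z) c = q at hm
  have hfq : 0 < f q := by
    rw [← hq, hf, hv]; have := mul_pos hc0 hz; linarith
  have hFH : ∀ c, 0 ≤ c → c < 1 → ∀ s t, Fam G v s t → lp (δ v) q c ∉ segment ℝ (δ s) (δ t) := by
    intro a h0 h1 s t hF
    rw [← hq, lp_lp]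
    exact hmin _ (by positivity) (by nlinarith) s t hF
  by_cases hqv : ∃ p, q = δ p
  · obtain ⟨p, rfl⟩ := hqv
    by_contra hno
    push Not at hno
    obtain ⟨c, s', t', hc0, hc1, hF, hr⟩ := blocker hM (by rintro rfl; linarith) hf hv hfq hno
    exact hFH c hc0.le hc1 s' t' hF hr
  · push Not at hqv
    obtain ⟨τ, h0, h1, e⟩ := mem_seg.1 hm
    by_cases hs : 0 < f (δ s)
    · exact left_core hM hf hv hfq hF hm hqv hs hFH
    · have ht : 0 < f (δ t) := by
        by_contra ht
        push Not at hs ht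
        rw [e, hf] at hfq
        have := mul_nonneg (show 0 ≤ 1 - τ by linarith) (show 0 ≤ - f (δ s) by linarith)
        have := mul_nonneg h0 (show 0 ≤ - f (δ t) by linarith)
        linarith
      exact left_core hM hf hv hfq hF.symm (by rwa [segment_symm]) hqv ht hFH

end FixTri
namespace FixTri
variable {V : Type*}

lemma exit_tri {α β : ℝ × ℝ → ℝ} (hα : Aff α) (hβ : Aff β) {r s : ℝ × ℝ} (ra : 0 < α r) (rb : 0 < β r)
    (hs : ¬ (0 ≤ α s ∧ 0 ≤ β s)) : ∃ τ, 0 ≤ τ ∧ τ ≤ 1 ∧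
      ((α (lp r s τ) = 0 ∧ 0 ≤ β (lp r s τ)) ∨ (β (lp r s τ) = 0 ∧ 0 ≤ α (lp r s τ))) := by
  have na : Aff (fun x => - α x) := by intro x y t; simp only [hα x y t]; ring
  have nb : Aff (fun x => - β x) := by intro x y t; simp only [hβ x y t]; ring
  rcases lt_or_ge (β s) 0 with h | h
  · obtain ⟨τ, h0, h1, h2⟩ := aff_hit (r := r) (x := s) (c := 0) nb (by linarith) (by linarith)
    have hb : β (lp r s τ) = 0 := by linarith
    rcases le_or_gt 0 (α (lp r s τ)) with h3 | h3
    · exact ⟨τ, h0.le, h1, Or.inr ⟨hb, h3⟩⟩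
    · obtain ⟨τ', h0', h1', h2'⟩ := aff_hit (r := r) (x := lp r s τ) (c := 0) na (by linarith) (by linarith)
      have e : β (lp r (lp r s τ) τ') = (1 - τ') * β r := by rw [hβ, hb]; ring
      have : 0 ≤ (1 - τ') * β r := mul_nonneg (by linarith) rb.le
      rw [lp_lp] at h2' e
      exact ⟨τ' * τ, by positivity, by nlinarith, Or.inl ⟨by linarith, by linarith⟩⟩
  · have ha : α s < 0 := by by_contra h'; push Not at h'; exact hs ⟨h', h⟩
    obtain ⟨τ, h0, h1, h2⟩ := aff_hit (r := r) (x := s) (c := 0) na (by linarith) (by linarith)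
    refine ⟨τ, h0.le, h1, Or.inl ⟨by linarith, ?_⟩⟩
    rw [hβ]
    have : 0 ≤ 1 - τ := by linarith
    positivity

lemma crd_side {v u : V} {G : SimpleGraph V} {δ : V → ℝ × ℝ} (hP : IsPlaneDrawing G δ) (hu : G.Adj v u)
    {α β : ℝ × ℝ → ℝ} (hα : Aff α) (hβ : Aff β) (vα : α (δ v) = 0) (vβ : β (δ v) = 0) (uα : α (δ u) = 1)
    (uβ : β (δ u) = 0) (ext : ∀ x y, α x = α y → β x = β y → x = y) {s t : V} (hs : s ≠ v) (ht : t ≠ v)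
    (hst : G.Adj s t) {z : ℝ × ℝ} (hz : z ∈ segment ℝ (δ s) (δ t)) (h1 : β z = 0) (h2 : 0 ≤ α z)
    (h3 : α z ≤ 1) (h4 : z ≠ δ u) : False := by
  have hz' : z ∈ segment ℝ (δ v) (δ u) := mem_seg.2 ⟨α z, h2, h3, by
    apply ext
    · rw [hα, vα, uα]; ring
    · rw [hβ, vβ, uβ, h1]; ring⟩
  have h5 : z ≠ δ v := by
    rintro rfl; exact v_notin_fam hP ⟨hs, ht, Or.inr hst⟩ hz
  rcases cross_eq hP hu hst hz' hz h5 h4 with ⟨a, b⟩ | ⟨a, b⟩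
  · exact hs a
  · exact ht b

def Face (G : SimpleGraph V) (δ : V → ℝ × ℝ) (v u w : V) : Prop :=
  G.Adj v u ∧ G.Adj u w ∧ G.Adj w v ∧ 0 < cr (δ v) (δ u) (δ w) ∧
    ∀ p, 0 ≤ cr (δ v) (δ u) (δ p) → 0 ≤ cr (δ u) (δ w) (δ p) → 0 ≤ cr (δ w) (δ v) (δ p) →
      p = v ∨ p = u ∨ p = w

lemma Face.rot {G : SimpleGraph V} {δ : V → ℝ × ℝ} {v u w : V} (h : Face G δ v u w) : Face G δ u w v := by
  obtain ⟨h1, h2, h3, h4, h5⟩ := h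
  refine ⟨h2, h3, h1, by rwa [← cr_rot], fun p a b c => ?_⟩
  rcases h5 p c a b with h | h | h <;> simp [h]

set_option maxHeartbeats 1000000 in
lemma next_face [Finite V] {G : SimpleGraph V} {δ : V → ℝ × ℝ} (hM : MaxPlane G δ) {v u w : V}
    (hu : G.Adj v u) (hw : G.Adj v w) (hcr : 0 < cr (δ v) (δ u) (δ w))
    (hno : ∀ x, G.Adj v x → 0 < cr (δ v) (δ u) (δ x) → 0 < cr (δ v) (δ x) (δ w) → False) :
    Face G δ v u w := by
  have hP := hM.1
  have hC := exists_crd hcr.ne'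
  have hαi : ∀ x, (0 < cr (δ v) x (δ w) / cr (δ v) (δ u) (δ w) ↔ 0 < cr (δ v) x (δ w)) := fun x =>
    div_pos_iff_of_pos_right hcr
  have hβi : ∀ x, (0 < cr (δ v) (δ u) x / cr (δ v) (δ u) (δ w) ↔ 0 < cr (δ v) (δ u) x) := fun x =>
    div_pos_iff_of_pos_right hcr
  have hαi' : ∀ x, (0 ≤ cr (δ v) x (δ w) / cr (δ v) (δ u) (δ w) ↔ 0 ≤ cr (δ v) x (δ w)) := fun x =>
    ⟨fun h => by by_contra h'; push Not at h'; linarith [div_neg_of_neg_of_pos h' hcr], fun h => div_nonneg h hcr.le⟩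
  have hβi' : ∀ x, (0 ≤ cr (δ v) (δ u) x / cr (δ v) (δ u) (δ w) ↔ 0 ≤ cr (δ v) (δ u) x) := fun x =>
    ⟨fun h => by by_contra h'; push Not at h'; linarith [div_neg_of_neg_of_pos h' hcr], fun h => div_nonneg h hcr.le⟩
  have hsum : ∀ x, (cr (δ v) x (δ w) / cr (δ v) (δ u) (δ w) + cr (δ v) (δ u) x / cr (δ v) (δ u) (δ w) ≤ 1 ↔
      0 ≤ cr (δ u) (δ w) x) := by
    intro x
    rw [← add_div, div_le_one hcr]
    have : cr (δ u) (δ w) x = cr (δ v) (δ u) (δ w) - (cr (δ v) x (δ w) + cr (δ v) (δ u) x) := by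
      simp only [cr]; ring
    rw [this]; constructor <;> intro h <;> linarith
  generalize hα : (fun x => cr (δ v) x (δ w) / cr (δ v) (δ u) (δ w)) = α at hC
  generalize hβ : (fun x => cr (δ v) (δ u) x / cr (δ v) (δ u) (δ w)) = β at hC
  have hα' : ∀ x, cr (δ v) x (δ w) / cr (δ v) (δ u) (δ w) = α x := fun x => congrFun hα x
  have hβ' : ∀ x, cr (δ v) (δ u) x / cr (δ v) (δ u) (δ w) = β x := fun x => congrFun hβ x
  simp only [hα', hβ'] at hαi hβi hαi' hβi' hsum
  have hno' : ∀ x, G.Adj v x → 0 < α (δ x) → 0 < β (δ x) → False := fun x h1 h2 h3 =>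
    hno x h1 ((hβi _).1 h3) ((hαi _).1 h2)
  clear hα hβ
  have C := hC
  have side1 := fun {s t : V} hs ht hst {z} => crd_side hP hu C.aα C.aβ C.vα C.vβ C.qα C.qβ C.ext (s := s) (t := t) hs ht hst (z := z)
  have side2 := fun {s t : V} hs ht hst {z} => crd_side hP hw C.aβ C.aα C.vβ C.vα C.sβ C.sα (fun x y h1 h2 => C.ext x y h2 h1) (s := s) (t := t) hs ht hst (z := z)
  -- an edge from v meeting the open cone
  have hvedge : ∀ t r, G.Adj v t → r ∈ segment ℝ (δ v) (δ t) → 0 < α r → 0 < β r → False := by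
    intro t r ht hr h1 h2
    obtain ⟨c, hc0, hc1, rfl⟩ := mem_seg.1 hr
    rw [C.aα, C.vα] at h1
    rw [C.aβ, C.vβ] at h2
    refine hno' t ht ?_ ?_
    · exact pos_of_mul_pos_right (show 0 < c * α (δ t) by linarith) hc0
    · exact pos_of_mul_pos_right (show 0 < c * β (δ t) by linarith) hc0
  -- exiting
  have hexit : ∀ s t r, s ≠ v → t ≠ v → G.Adj s t → r ∈ segment ℝ (δ s) (δ t) → 0 < α r → 0 < β r →
      α r + β r ≤ 1 → (α r + β r < 1 ∨ (s ≠ u ∧ s ≠ w ∧ t ≠ u ∧ t ≠ w)) →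
      α (δ s) + β (δ s) ≤ α r + β r → 0 ≤ α (δ s) ∧ 0 ≤ β (δ s) := by
    intro s t r hs ht hst hr ra rb r1 hor hle
    by_contra hcon
    obtain ⟨τ, h0, h1, h2⟩ := exit_tri C.aα C.aβ ra rb hcon
    have hx : lp r (δ s) τ ∈ segment ℝ (δ s) (δ t) :=
      (convex_segment _ _).segment_subset hr (left_mem_segment _ _ _) (lp_mem h0 h1)
    have hxs : α (lp r (δ s) τ) + β (lp r (δ s) τ) ≤ α r + β r := by
      rw [C.aα, C.aβ]; have := mul_le_mul_of_nonneg_left hle h0; nlinarith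
    have hz : ∀ y, (y = u ∨ y = w) → lp r (δ s) τ ≠ δ y := by
      rintro y hy e
      rcases hor with h | ⟨a1, a2, a3, a4⟩
      · rw [e] at hxs
        rcases hy with rfl | rfl
        · rw [C.qα, C.qβ] at hxs; linarith
        · rw [C.sα, C.sβ] at hxs; linarith
      · rw [e] at hx
        rcases hP.2.1 _ _ _ hst hx with h | h <;> rcases hy with rfl | rfl <;> simp_all
    rcases h2 with ⟨h2, h3⟩ | ⟨h2, h3⟩
    · exact side2 hs ht hst hx h2 h3 (by linarith) (hz w (Or.inr rfl))
    · exact side1 hs ht hst hx h2 h3 (by linarith) (hz u (Or.inl rfl))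
  let S : Set V := {p | p ≠ v ∧ p ≠ u ∧ p ≠ w ∧ 0 ≤ α (δ p) ∧ 0 ≤ β (δ p) ∧ α (δ p) + β (δ p) ≤ 1}
  have hSpos : ∀ p ∈ S, 0 < α (δ p) ∧ 0 < β (δ p) := by
    rintro p ⟨h1, h2, h3, h4, h5, h6⟩
    constructor
    · rcases h4.eq_or_lt with h | h
      · exfalso
        have : δ p ∈ segment ℝ (δ v) (δ w) := mem_seg.2 ⟨β (δ p), h5, by linarith, by
          apply C.ext
          · rw [C.aα, C.vα, C.sα, ← h]; ring
          · rw [C.aβ, C.vβ, C.sβ]; ring⟩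
        rcases hP.2.1 _ _ _ hw this with h | h <;> tauto
      · exact h
    · rcases h5.eq_or_lt with h | h
      · exfalso
        have : δ p ∈ segment ℝ (δ v) (δ u) := mem_seg.2 ⟨α (δ p), h4, by linarith, by
          apply C.ext
          · rw [C.aα, C.vα, C.qα]; ring
          · rw [C.aβ, C.vβ, C.qβ, ← h]; ring⟩
        rcases hP.2.1 _ _ _ hu this with h | h <;> tauto
      · exact h
  have hempty : ∀ p, p ∉ S := by
    intro p0 hp0
    obtain ⟨p, hpS, hmin⟩ := Set.exists_min_image S (fun p => α (δ p) + β (δ p)) (Set.toFinite _) ⟨p0, hp0⟩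
    obtain ⟨pa, pb⟩ := hSpos p hpS
    obtain ⟨hpv, hpu, hpw, -, -, hp1⟩ := hpS
    refine hno' p ?_ pa pb
    apply add_edge hM hpv.symm
    · intro x hx
      obtain ⟨c, hc0, hc1, e⟩ := mem_oseg.1 hx
      have xa : α (δ x) = c * α (δ p) := by rw [e, C.aα, C.vα]; ring
      have xb : β (δ x) = c * β (δ p) := by rw [e, C.aβ, C.vβ]; ring
      have xa0 : 0 < α (δ x) := by rw [xa]; positivity
      have xb0 : 0 < β (δ x) := by rw [xb]; positivity
      have hlt : α (δ x) + β (δ x) < α (δ p) + β (δ p) := by rw [xa, xb]; nlinarith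
      have := hmin x ⟨by rintro rfl; rw [C.vα] at xa0; exact lt_irrefl _ xa0,
        by rintro rfl; rw [C.qβ] at xb0; exact lt_irrefl _ xb0,
        by rintro rfl; rw [C.sα] at xa0; exact lt_irrefl _ xa0, xa0.le, xb0.le, by linarith⟩
      linarith
    · intro s t hst r hr hr'
      obtain ⟨c, hc0, hc1, e⟩ := mem_oseg.1 hr
      have xa : α r = c * α (δ p) := by rw [e, C.aα, C.vα]; ring
      have xb : β r = c * β (δ p) := by rw [e, C.aβ, C.vβ]; ring
      have xa0 : 0 < α r := by rw [xa]; positivity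
      have xb0 : 0 < β r := by rw [xb]; positivity
      have hlt : α r + β r < α (δ p) + β (δ p) := by rw [xa, xb]; nlinarith
      by_cases hs : s = v
      · subst hs; exact hvedge t r hst hr' xa0 xb0
      by_cases ht : t = v
      · subst ht; exact hvedge s r hst.symm (by rwa [segment_symm]) xa0 xb0
      have fin : ∀ s t, s ≠ v → t ≠ v → G.Adj s t → r ∈ segment ℝ (δ s) (δ t) →
          α (δ s) + β (δ s) ≤ α r + β r → False := by
        intro s t hs ht hst hr' hle
        obtain ⟨a, b⟩ := hexit s t r hs ht hst hr' xa0 xb0 (by linarith) (Or.inl (by linarith)) hle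
        have := hmin s ⟨hs, by rintro rfl; rw [C.qα, C.qβ] at hle; linarith,
          by rintro rfl; rw [C.sα, C.sβ] at hle; linarith, a, b, by linarith⟩
        linarith
      obtain ⟨ν, hν0, hν1, e⟩ := mem_seg.1 hr'
      have ea : α r = _ := (congrArg α e).trans (C.aα _ _ _)
      have eb : β r = _ := (congrArg β e).trans (C.aβ _ _ _)
      by_cases hle : α (δ s) + β (δ s) ≤ α r + β r
      · exact fin s t hs ht hst hr' hle
      · refine fin t s ht hs hst.symm (by rwa [segment_symm]) ?_
        by_contra h2
        push Not at hle h2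
        rcases hν0.eq_or_lt with h | h
        · rw [← h] at ea eb; linarith
        · have := mul_lt_mul_of_pos_left h2 h
          have := mul_le_mul_of_nonneg_left hle.le (show 0 ≤ 1 - ν by linarith)
          linarith
  have hcolu : ∀ u w : V, G.Adj v u → G.Adj v w → (∀ p c, 0 ≤ c → c ≤ 1 → δ p = lp (δ u) (δ w) c → p = u ∨ p = w) → u ≠ w →
      ¬ G.Adj u w → ∀ t r c c', G.Adj u t → r = lp (δ u) (δ w) c → 0 < c → c < 1 → r = lp (δ u) (δ t) c' → 0 ≤ c' → c' ≤ 1 → False := by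
    intro u w hu hw hemp huw hnadj t r c c' hut hr hc0 hc1 hr' hc0' hc1'
    have hc'p : 0 < c' := by
      rcases hc0'.eq_or_lt with h | h
      · exfalso
        rw [← h, lp_zero] at hr'
        rw [hr'] at hr
        have h1 := congrArg Prod.fst hr
        have h2 := congrArg Prod.snd hr
        simp only [lp] at h1 h2
        apply huw
        apply hP.1
        ext
        · have : c * ((δ u).1 - (δ w).1) = 0 := by linarith
          linarith [(mul_eq_zero.1 this).resolve_left hc0.ne']
        · have : c * ((δ u).2 - (δ w).2) = 0 := by linarith
          linarith [(mul_eq_zero.1 this).resolve_left hc0.ne']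
      · exact h
    rw [hr] at hr'
    have h1 := congrArg Prod.fst hr'
    have h2 := congrArg Prod.snd hr'
    simp only [lp] at h1 h2
    rcases le_or_gt c c' with h | h
    · have : δ t = lp (δ u) (δ w) (c / c') := by
        ext <;> simp only [lp] <;> field_simp <;> linarith
      rcases hemp t _ (by positivity) ((div_le_one hc'p).2 h) this with rfl | rfl
      · exact hut.ne rfl
      · exact hnadj hut
    · have : δ w ∈ segment ℝ (δ u) (δ t) := mem_seg.2 ⟨c' / c, by positivity, (div_le_one hc0).2 h.le, by
        ext <;> simp only [lp] <;> field_simp <;> linarith⟩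
      rcases hP.2.1 _ _ _ hut this with e | e
      · exact huw e.symm
      · exact hnadj (e ▸ hut)
  have huw : u ≠ w := by rintro rfl; have : cr (δ v) (δ u) (δ u) = 0 := by { simp only [cr]; ring }
                         linarith
  have hemp : ∀ p c, 0 ≤ c → c ≤ 1 → δ p = lp (δ u) (δ w) c → p = u ∨ p = w := by
    intro p c h0 h1 e
    by_contra hcon
    push Not at hcon
    have ea : α (δ p) = 1 - c := by rw [e, C.aα, C.qα, C.sα]; ring
    have eb : β (δ p) = c := by rw [e, C.aβ, C.qβ, C.sβ]; ring
    refine hempty p ⟨?_, hcon.1, hcon.2, by linarith, by linarith, by linarith⟩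
    rintro rfl
    rw [C.vα] at ea
    rw [C.vβ] at eb
    linarith
  have hadj : G.Adj u w := by
    by_contra hnadj
    apply hnadj
    apply add_edge hM huw
    · intro x hx
      obtain ⟨c, hc0, hc1, e⟩ := mem_oseg.1 hx
      rcases hemp x c hc0.le hc1.le e with rfl | rfl
      · have := congrArg β e
        rw [C.aβ, C.qβ, C.sβ] at this; linarith
      · have := congrArg α e
        rw [C.aα, C.qα, C.sα] at this; linarith
    · intro s t hst r hr hr'
      obtain ⟨c, hc0, hc1, e⟩ := mem_oseg.1 hr
      have ea : α r = 1 - c := by rw [e, C.aα, C.qα, C.sα]; ring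
      have eb : β r = c := by rw [e, C.aβ, C.qβ, C.sβ]; ring
      by_cases hs : s = v
      · subst hs; exact hvedge t r hst hr' (by linarith) (by linarith)
      by_cases ht : t = v
      · subst ht; exact hvedge s r hst.symm (by rwa [segment_symm]) (by linarith) (by linarith)
      have nou : ∀ s t, G.Adj s t → r ∈ segment ℝ (δ s) (δ t) → s ≠ u := by
        rintro s t hst hr' rfl
        obtain ⟨c', h0, h1, e'⟩ := mem_seg.1 hr'
        exact hcolu s w hu hw hemp huw hnadj t r c c' hst e hc0 hc1 e' h0 h1
      have now : ∀ s t, G.Adj s t → r ∈ segment ℝ (δ s) (δ t) → s ≠ w := by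
        rintro s t hst hr' rfl
        obtain ⟨c', h0, h1, e'⟩ := mem_seg.1 hr'
        refine hcolu s u hw hu (fun p c h0 h1 e => (hemp p (1 - c) (by linarith) (by linarith) ?_).symm) huw.symm
          (fun h => hnadj h.symm) t r (1 - c) c' hst ?_ (by linarith) (by linarith) e' h0 h1
        · rw [e]; ext <;> simp only [lp] <;> ring
        · rw [e]; ext <;> simp only [lp] <;> ring
      have hr'' : r ∈ segment ℝ (δ t) (δ s) := by rwa [segment_symm]
      have n1 := nou s t hst hr'
      have n2 := nou t s hst.symm hr''
      have n3 := now s t hst hr'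
      have n4 := now t s hst.symm hr''
      have fin : ∀ s t, s ≠ v → t ≠ v → G.Adj s t → r ∈ segment ℝ (δ s) (δ t) → s ≠ u → s ≠ w → t ≠ u → t ≠ w →
          α (δ s) + β (δ s) ≤ α r + β r → False := by
        intro s t hs ht hst hr' n1 n2 n3 n4 hle
        obtain ⟨a, b⟩ := hexit s t r hs ht hst hr' (by linarith) (by linarith) (by linarith) (Or.inr ⟨n1, n2, n3, n4⟩) hle
        exact hempty s ⟨hs, n1, n2, a, b, by linarith⟩
      obtain ⟨ν, hν0, hν1, e⟩ := mem_seg.1 hr'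
      have ea' : α r = _ := (congrArg α e).trans (C.aα _ _ _)
      have eb' : β r = _ := (congrArg β e).trans (C.aβ _ _ _)
      by_cases hle : α (δ s) + β (δ s) ≤ α r + β r
      · exact fin s t hs ht hst hr' n1 n3 n2 n4 hle
      · refine fin t s ht hs hst.symm hr'' n2 n4 n1 n3 ?_
        by_contra h2
        push Not at hle h2
        rcases hν0.eq_or_lt with h | h
        · rw [← h] at ea' eb'; linarith
        · have := mul_lt_mul_of_pos_left h2 h
          have := mul_le_mul_of_nonneg_left hle.le (show 0 ≤ 1 - ν by linarith)
          linarith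
  refine ⟨hu, hadj, hw.symm, hcr, fun p h1 h2 h3 => ?_⟩
  by_contra hcon
  push Not at hcon
  refine hempty p ⟨hcon.1, hcon.2.1, hcon.2.2, (hαi' _).2 ?_, (hβi' _).2 h1, (hsum _).2 h2⟩
  rwa [cr_rot, cr_rot]

lemma Face.cone {G : SimpleGraph V} {δ : V → ℝ × ℝ} (hP : IsPlaneDrawing G δ) {v u w x : V}
    (h : Face G δ v u w) (hx : G.Adj v x) (h1 : 0 < cr (δ v) (δ u) (δ x)) (h2 : 0 < cr (δ v) (δ x) (δ w)) : False := by
  obtain ⟨hu, huw, hw, hcr, hemp⟩ := h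
  by_cases h3 : 0 ≤ cr (δ u) (δ w) (δ x)
  · rcases hemp x h1.le h3 (by rw [cr_rot]; exact h2.le) with rfl | rfl | rfl
    · exact hx.ne rfl
    · simp [cr, mul_comm] at h1
    · simp [cr, mul_comm] at h2
  · push Not at h3
    have id : cr (δ u) (δ w) (δ x) = cr (δ v) (δ u) (δ w) - (cr (δ v) (δ x) (δ w) + cr (δ v) (δ u) (δ x)) := by
      simp only [cr]; ring
    have C := exists_crd hcr.ne'
    generalize hα : (fun x => cr (δ v) x (δ w) / cr (δ v) (δ u) (δ w)) = α at C
    generalize hβ : (fun x => cr (δ v) (δ u) x / cr (δ v) (δ u) (δ w)) = β at C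
    have xa : 0 < α (δ x) := by rw [← hα]; exact div_pos h2 hcr
    have xb : 0 < β (δ x) := by rw [← hβ]; exact div_pos h1 hcr
    have xs : 1 < α (δ x) + β (δ x) := by
      rw [← hα, ← hβ]; simp only; rw [← add_div, one_lt_div hcr]; linarith
    have hs : 0 < α (δ x) + β (δ x) := by linarith
    have ra : α (lp (δ v) (δ x) (1 / (α (δ x) + β (δ x)))) = α (δ x) / (α (δ x) + β (δ x)) := by
      rw [C.aα, C.vα]; ring
    have rb : β (lp (δ v) (δ x) (1 / (α (δ x) + β (δ x)))) = β (δ x) / (α (δ x) + β (δ x)) := by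
      rw [C.aβ, C.vβ]; ring
    have ra0 : 0 < α (δ x) / (α (δ x) + β (δ x)) := by positivity
    have rb0 : 0 < β (δ x) / (α (δ x) + β (δ x)) := by positivity
    have m1 : lp (δ v) (δ x) (1 / (α (δ x) + β (δ x))) ∈ segment ℝ (δ v) (δ x) :=
      lp_mem (by positivity) ((div_le_one hs).2 xs.le)
    have m2 : lp (δ v) (δ x) (1 / (α (δ x) + β (δ x))) ∈ segment ℝ (δ u) (δ w) := by
      refine mem_seg.2 ⟨β (δ x) / (α (δ x) + β (δ x)), rb0.le, (div_le_one hs).2 (by linarith), ?_⟩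
      apply C.ext
      · rw [ra, C.aα, C.qα, C.sα]; field_simp; ring
      · rw [rb, C.aβ, C.qβ, C.sβ]; ring
    rcases cross_eq hP huw hx m2 m1 (by intro e; rw [e, C.qβ] at rb; linarith)
      (by intro e; rw [e, C.sα] at ra; linarith) with ⟨e1, -⟩ | ⟨e1, -⟩
    · exact hu.ne e1
    · exact hw.ne e1.symm

lemma same_ray {G : SimpleGraph V} {δ : V → ℝ × ℝ} (hP : IsPlaneDrawing G δ) {v w w' : V}
    (hw : G.Adj v w) (hw' : G.Adj v w') (h : cr (δ v) (δ w) (δ w') = 0) {f : ℝ × ℝ → ℝ} (hf : Aff f)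
    (hv : f (δ v) = 0) (h1 : 0 < f (δ w)) (h2 : 0 < f (δ w')) : w = w' := by
  obtain ⟨a, ha⟩ := collinear_lp h (fun e => hw.ne (hP.1 e))
  have e := congrArg f ha
  rw [hf, hv] at e
  have ha0 : 0 < a := pos_of_mul_pos_left (show 0 < a * f (δ w) by linarith) h1.le
  apply ray_unique hP hw hw' ha0
  · rw [ha]; simp only [lp]; ring
  · rw [ha]; simp only [lp]; ring

lemma Face.unique {G : SimpleGraph V} {δ : V → ℝ × ℝ} (hP : IsPlaneDrawing G δ) {v u w w' : V}
    (h : Face G δ v u w) (h' : Face G δ v u w') : w = w' := by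
  have hv0 : cr (δ v) (δ u) (δ v) = 0 := by simp only [cr]; ring
  rcases lt_trichotomy (cr (δ v) (δ w) (δ w')) 0 with h1 | h1 | h1
  · rw [cr_swap] at h1
    exact (h.cone hP h'.2.2.1.symm h'.2.2.2.1 (by linarith)).elim
  · exact same_ray hP h.2.2.1.symm h'.2.2.1.symm h1 (aff_cr (δ v) (δ u)) hv0 h.2.2.2.1 h'.2.2.2.1
  · exact (h'.cone hP h.2.2.1.symm h.2.2.2.1 h1).elim

lemma exists_face [Finite V] {G : SimpleGraph V} {δ : V → ℝ × ℝ} (hM : MaxPlane G δ) {v u z : V}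
    (hu : G.Adj v u) (hz : 0 < cr (δ v) (δ u) (δ z)) : ∃ w, Face G δ v u w := by
  obtain ⟨w0, hw0, hw0'⟩ := left_nbr hM (aff_cr (δ v) (δ u)) (by simp only [cr]; ring) hz
  let e := fun x : V => ((δ x).1 - (δ v).1) * ((δ u).1 - (δ v).1) + ((δ x).2 - (δ v).2) * ((δ u).2 - (δ v).2)
  obtain ⟨w, ⟨hw, hw'⟩, hmax⟩ := Set.exists_max_image {w | G.Adj v w ∧ 0 < cr (δ v) (δ u) (δ w)}
    (fun x => e x / cr (δ v) (δ u) (δ x)) (Set.toFinite _) ⟨w0, hw0, hw0'⟩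
  refine ⟨w, next_face hM hu hw hw' ?_⟩
  intro x hx h1 h2
  have h3 := hmax x ⟨hx, h1⟩
  rw [div_le_div_iff₀ h1 hw'] at h3
  have id : e x * cr (δ v) (δ u) (δ w) - e w * cr (δ v) (δ u) (δ x) =
      (((δ u).1 - (δ v).1)^2 + ((δ u).2 - (δ v).2)^2) * cr (δ v) (δ x) (δ w) := by
    simp only [e, cr]; ring
  have hpos : 0 < ((δ u).1 - (δ v).1)^2 + ((δ u).2 - (δ v).2)^2 := by
    by_contra h
    push Not at h
    have h4 : ((δ u).1 - (δ v).1) = 0 := by nlinarith [sq_nonneg ((δ u).1 - (δ v).1), sq_nonneg ((δ u).2 - (δ v).2)]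
    have h5 : ((δ u).2 - (δ v).2) = 0 := by nlinarith [sq_nonneg ((δ u).1 - (δ v).1), sq_nonneg ((δ u).2 - (δ v).2)]
    simp [cr, h4, h5] at hw'
  have := mul_pos hpos h2
  linarith

end FixTri
namespace FixTri
variable {V : Type*}

def ht (a b : ℝ) (x : ℝ × ℝ) : ℝ := a * x.1 + b * x.2

lemma aff_ht (a b c : ℝ) : Aff (fun x => ht a b x - c) := by
  intro x y t; simp only [ht, lp]; ring

lemma pluck {a b : ℝ} {v e1 e2 u w : ℝ × ℝ} (he : ht a b e1 < ht a b e2) (hu : ht a b v < ht a b u)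
    (hw : ht a b w < ht a b v) (h : 0 < cr v u w)
    (h1 : (e2.1 - e1.1) * (u.2 - v.2) - (e2.2 - e1.2) * (u.1 - v.1) ≤ 0)
    (h2 : (e2.1 - e1.1) * (w.2 - v.2) - (e2.2 - e1.2) * (w.1 - v.1) ≤ 0) : False := by
  have id : (ht a b e2 - ht a b e1) * cr v u w +
     (ht a b u - ht a b v) * (-((e2.1 - e1.1) * (w.2 - v.2) - (e2.2 - e1.2) * (w.1 - v.1))) +
     (ht a b w - ht a b v) * ((e2.1 - e1.1) * (u.2 - v.2) - (e2.2 - e1.2) * (u.1 - v.1)) = 0 := by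
    simp only [ht, cr]; ring
  have a1 := mul_pos (sub_pos.2 he) h
  have a2 := mul_nonneg (sub_nonneg.2 hu.le) (show 0 ≤ -((e2.1 - e1.1) * (w.2 - v.2) - (e2.2 - e1.2) * (w.1 - v.1)) by linarith)
  have a3 := mul_nonneg_of_nonpos_of_nonpos (sub_nonpos.2 hw.le) h1
  linarith

lemma type_unique {G : SimpleGraph V} {δ : V → ℝ × ℝ} (hP : IsPlaneDrawing G δ) {a b : ℝ} {v u w u' w' : V}
    (h : Face G δ v u w) (h' : Face G δ v u' w') (h1 : ht a b (δ u) < ht a b (δ v)) (h2 : ht a b (δ v) < ht a b (δ w))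
    (h1' : ht a b (δ u') < ht a b (δ v)) (h2' : ht a b (δ v) < ht a b (δ w')) : u = u' := by
  have key : ∀ u w u' w', Face G δ v u w → Face G δ v u' w' → ht a b (δ u) < ht a b (δ v) →
     ht a b (δ v) < ht a b (δ w) → ht a b (δ u') < ht a b (δ v) → 0 < cr (δ v) (δ u) (δ u') → False := by
    intro u w u' w' h h' h1 h2 h1' hc
    refine h.cone hP h'.1 hc ?_
    by_contra hn
    push Not at hn
    have id : (ht a b (δ w) - ht a b (δ v)) * cr (δ v) (δ u) (δ u') =
      (ht a b (δ u) - ht a b (δ v)) * (- cr (δ v) (δ u') (δ w)) + (ht a b (δ u') - ht a b (δ v)) * cr (δ v) (δ u) (δ w) := by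
      simp only [ht, cr]; ring
    have a1 := mul_pos (sub_pos.2 h2) hc
    have a2 := mul_nonneg (sub_nonneg.2 h1.le) (neg_nonneg.2 hn)
    have a3 := mul_pos (sub_pos.2 h1') h.2.2.2.1
    linarith
  rcases lt_trichotomy (cr (δ v) (δ u) (δ u')) 0 with hc | hc | hc
  · rw [cr_swap] at hc
    exact (key u' w' u w h' h h1' h2' h1 (by linarith)).elim
  · refine same_ray hP h.1 h'.1 hc (aff_ht (-a) (-b) (ht (-a) (-b) (δ v))) (by ring) ?_ ?_ <;> simp only [ht] at * <;> linarith
  · exact (key u w u' w' h h' h1 h2 h1' hc).elim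

/-- hull darts -/
def Hd (G : SimpleGraph V) (δ : V → ℝ × ℝ) (v u : V) : Prop :=
  G.Adj v u ∧ ∀ x, cr (δ v) (δ u) (δ x) ≤ 0

def NC (δ : V → ℝ × ℝ) : Prop := ∃ a b c, cr (δ a) (δ b) (δ c) ≠ 0

lemma NC.line {δ : V → ℝ × ℝ} (h : NC δ) {p q : ℝ × ℝ} (hpq : p ≠ q) : ∃ z, cr p q (δ z) ≠ 0 := by
  by_contra hcon
  push Not at hcon
  obtain ⟨a, b, c, h⟩ := h
  obtain ⟨x, hx⟩ := collinear_lp (hcon a) hpq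
  obtain ⟨y, hy⟩ := collinear_lp (hcon b) hpq
  obtain ⟨z, hz⟩ := collinear_lp (hcon c) hpq
  apply h
  rw [hx, hy, hz]; simp only [cr, lp]; ring

lemma dart_col {G : SimpleGraph V} {δ : V → ℝ × ℝ} (hP : IsPlaneDrawing G δ) (hN : NC δ) {v u u' : V}
    (hu : G.Adj v u) (hu' : G.Adj v u') (h0 : cr (δ v) (δ u) (δ u') = 0)
    (hs : ∀ x, cr (δ v) (δ u) (δ x) ≤ 0) (hs' : ∀ x, cr (δ v) (δ u') (δ x) ≤ 0) : u = u' := by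
  obtain ⟨a, ha⟩ := collinear_lp h0 (fun e => hu.ne (hP.1 e))
  rcases lt_trichotomy a 0 with h | h | h
  · exfalso
    obtain ⟨z, hz⟩ := hN.line (fun e => hu.ne (hP.1 e) : δ v ≠ δ u)
    have h1 := hs z
    have h2 := hs' z
    have : cr (δ v) (δ u') (δ z) = a * cr (δ v) (δ u) (δ z) := by rw [ha]; simp only [cr, lp]; ring
    rw [this] at h2
    have := mul_pos_of_neg_of_neg h (lt_of_le_of_ne h1 hz)
    linarith
  · rw [h, lp_zero] at ha; exact (hu'.ne (hP.1 ha).symm).elim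
  · apply ray_unique hP hu hu' h <;> rw [ha] <;> simp only [lp] <;> ring

lemma Hd.out_unique {G : SimpleGraph V} {δ : V → ℝ × ℝ} (hP : IsPlaneDrawing G δ) (hN : NC δ) {v u u' : V}
    (h : Hd G δ v u) (h' : Hd G δ v u') : u = u' := by
  refine dart_col hP hN h.1 h'.1 ?_ h.2 h'.2
  have := h.2 u'
  have h2 := h'.2 u
  rw [cr_swap] at h2
  linarith

lemma Hd.in_unique {G : SimpleGraph V} {δ : V → ℝ × ℝ} (hP : IsPlaneDrawing G δ) (hN : NC δ) {v u u' : V}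
    (h : Hd G δ u v) (h' : Hd G δ u' v) : u = u' := by
  have e : ∀ u x, cr (δ u) (δ v) (δ x) = - cr (δ v) (δ u) (δ x) := by intro u x; simp only [cr]; ring
  have h1 : ∀ x, 0 ≤ cr (δ v) (δ u) (δ x) := fun x => by have := h.2 x; rw [e] at this; linarith
  have h1' : ∀ x, 0 ≤ cr (δ v) (δ u') (δ x) := fun x => by have := h'.2 x; rw [e] at this; linarith
  have h0 : cr (δ v) (δ u) (δ u') = 0 := by
    have := h1 u'
    have h2 := h1' u
    rw [cr_swap] at h2
    linarith
  have hu := h.1.symm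
  have hu' := h'.1.symm
  obtain ⟨a, ha⟩ := collinear_lp h0 (fun e => hu.ne (hP.1 e))
  rcases lt_trichotomy a 0 with hh | hh | hh
  · exfalso
    obtain ⟨z, hz⟩ := hN.line (fun e => hu.ne (hP.1 e) : δ v ≠ δ u)
    have h1 := h1 z
    have h2 := h1' z
    have : cr (δ v) (δ u') (δ z) = a * cr (δ v) (δ u) (δ z) := by rw [ha]; simp only [cr, lp]; ring
    rw [this] at h2
    have := mul_neg_of_neg_of_pos hh (lt_of_le_of_ne h1 (Ne.symm hz))
    linarith
  · rw [hh, lp_zero] at ha; exact (hu'.ne (hP.1 ha).symm).elim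
  · apply ray_unique hP hu hu' hh <;> rw [ha] <;> simp only [lp] <;> ring

open Classical in
lemma dart_card [Fintype V] (G : SimpleGraph V) :
    (Finset.univ.filter (fun p : V × V => G.Adj p.1 p.2)).card = 2 * G.edgeSet.ncard := by
  have h := G.sum_degrees_eq_twice_card_edges
  rw [Set.ncard_eq_toFinset_card', ← SimpleGraph.edgeFinset, ← h]
  rw [Finset.card_filter, ← Finset.univ_product_univ, Finset.sum_product]
  apply Finset.sum_congr rfl
  intro v _
  rw [← Finset.card_filter, ← SimpleGraph.card_neighborFinset_eq_degree]
  congr 1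
  ext u; simp

lemma exists_generic [Finite V] {δ : V → ℝ × ℝ} (hδ : Function.Injective δ) : ∃ t : ℝ, Function.Injective (fun v => ht t 1 (δ v)) := by
  have hfin : (Set.range (fun p : V × V => ((δ p.2).2 - (δ p.1).2) / ((δ p.1).1 - (δ p.2).1))).Finite :=
    Set.finite_range _
  obtain ⟨t, ht'⟩ := hfin.infinite_compl.nonempty
  refine ⟨t, fun u v h => ?_⟩
  simp only [ht] at h
  by_cases h1 : (δ u).1 - (δ v).1 = 0
  · apply hδ; ext
    · linarith
    · have : (δ u).1 = (δ v).1 := by linarith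
      rw [this] at h; linarith
  · exfalso
    apply ht'
    refine ⟨(u, v), ?_⟩
    simp only
    rw [div_eq_iff h1]; linarith

open Classical in
lemma nc_of_edges [Fintype V] {G : SimpleGraph V} {δ : V → ℝ × ℝ} (hP : IsPlaneDrawing G δ)
    (hn : 3 ≤ Fintype.card V) (hE : 3 * Fintype.card V - 6 ≤ G.edgeSet.ncard) : NC δ := by
  by_contra hN
  unfold NC at hN
  push Not at hN
  obtain ⟨t, hinj⟩ := exists_generic hP.1
  have hd := dart_card G
  have hne : Nonempty V := Fintype.card_pos_iff.1 (by omega)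
  have aux : ∀ a b : ℝ, Function.Injective (fun v => ht a b (δ v)) →
      (Finset.univ.filter (fun p : V × V => G.Adj p.1 p.2 ∧ ht a b (δ p.1) < ht a b (δ p.2))).card + 1 ≤ Fintype.card V := by
    intro a b hinj
    obtain ⟨top, htop⟩ := Finite.exists_max (fun v => ht a b (δ v))
    rw [← Finset.card_univ, ← Finset.card_erase_add_one (Finset.mem_univ top)]
    apply Nat.add_le_add_right
    apply Finset.card_le_card_of_injOn Prod.fst
    · rintro ⟨v, u⟩ hp
      simp only [Finset.coe_filter, Finset.mem_univ, true_and, Set.mem_ofPred_eq] at hp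
      simp only [Finset.coe_erase, Finset.coe_univ, Set.mem_sdiff, Set.mem_univ, true_and, Set.mem_singleton_iff]
      rintro rfl
      exact absurd hp.2 (not_lt.2 (htop u))
    · rintro ⟨v, u⟩ hp ⟨v', u'⟩ hp' e
      simp only at e
      subst e
      simp only [Finset.coe_filter, Finset.mem_univ, true_and, Set.mem_ofPred_eq] at hp hp'
      rw [same_ray hP hp.1 hp'.1 (hN _ _ _) (aff_ht a b (ht a b (δ v))) (by ring) (by linarith [hp.2]) (by linarith [hp'.2])]
  have h1 := aux t 1 hinj
  have h2 := aux (-t) (-1) (by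
    intro x y h; apply hinj; simp only [ht] at *; linarith)
  have : (Finset.univ.filter (fun p : V × V => G.Adj p.1 p.2)).card ≤
    (Finset.univ.filter (fun p : V × V => G.Adj p.1 p.2 ∧ ht t 1 (δ p.1) < ht t 1 (δ p.2))).card +
    (Finset.univ.filter (fun p : V × V => G.Adj p.1 p.2 ∧ ht (-t) (-1) (δ p.1) < ht (-t) (-1) (δ p.2))).card := by
    refine le_trans (Finset.card_le_card ?_) (Finset.card_union_le _ _)
    rintro ⟨v, u⟩ hp
    simp only [Finset.mem_filter, Finset.mem_univ, true_and, Finset.mem_union] at hp ⊢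
    have : ht t 1 (δ v) ≠ ht t 1 (δ u) := fun e => hp.ne (hinj e)
    rcases lt_or_gt_of_ne this with h | h
    · exact Or.inl ⟨hp, h⟩
    · right; refine ⟨hp, ?_⟩
      simp only [ht] at *; linarith
  omega

open Classical in
lemma count_core [Fintype V] {G : SimpleGraph V} {δ : V → ℝ × ℝ} (hM : MaxPlane G δ)
    (hn : 3 ≤ Fintype.card V) (hE : 3 * Fintype.card V - 6 ≤ G.edgeSet.ncard) :
    G.edgeSet.ncard = 3 * Fintype.card V - 6 ∧
      (Finset.univ.filter (fun p : V × V => Hd G δ p.1 p.2)).card = 3 := by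
  have hP := hM.1
  have hN := nc_of_edges hP hn hE
  obtain ⟨t, hinj⟩ := exists_generic hP.1
  have hd := dart_card G
  have hne : Nonempty V := Fintype.card_pos_iff.1 (by omega)
  have hinj' : ∀ {x y : V}, x ≠ y → ht t 1 (δ x) < ht t 1 (δ y) ∨ ht t 1 (δ y) < ht t 1 (δ x) :=
    fun h => lt_or_gt_of_ne (fun e => h (hinj e))
  have hneg : ∀ x : ℝ × ℝ, ht (-t) (-1) x = - ht t 1 x := by intro x; simp only [ht]; ring
  obtain ⟨top, htop⟩ := Finite.exists_max (fun v => ht t 1 (δ v))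
  obtain ⟨bot, hbot⟩ := Finite.exists_min (fun v => ht t 1 (δ v))
  obtain ⟨Y, hY⟩ : ∃ Y : V → ℝ, ∀ v, ht t 1 (δ v) = Y v := ⟨_, fun _ => rfl⟩
  simp only [hY] at htop hbot hinj'
  have htb : bot ≠ top := by
    rintro rfl
    have : Fintype.card V ≤ 1 := Fintype.card_le_one_iff.2 (fun a b => by
      by_contra h
      have := htop a; have := htop b; have := hbot a; have := hbot b
      rcases hinj' h with h | h <;> linarith)
    omega
  have hYtb : Y bot < Y top := by
    rcases hinj' htb with h | h
    · exact h
    · linarith [hbot top]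
  let T := Finset.univ.filter (fun p : V × V × V => Face G δ p.1 p.2.1 p.2.2)
  let Hs := Finset.univ.filter (fun p : V × V => Hd G δ p.1 p.2)
  let Tr := T.filter (fun p => Y p.2.1 < Y p.1 ∧ Y p.1 < Y p.2.2)
  let Tl := T.filter (fun p => Y p.2.2 < Y p.1 ∧ Y p.1 < Y p.2.1)
  let Rv := Finset.univ.filter (fun v => ∃ u w, Face G δ v u w ∧ Y u < Y v ∧ Y v < Y w)
  let Lv := Finset.univ.filter (fun v => ∃ u w, Face G δ v u w ∧ Y w < Y v ∧ Y v < Y u)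
  have c1 : 2 * G.edgeSet.ncard ≤ T.card + Hs.card := by
    rw [← hd]
    have : (Finset.univ.filter (fun p : V × V => G.Adj p.1 p.2)) ⊆ T.image (fun p => (p.1, p.2.1)) ∪ Hs := by
      rintro ⟨v, u⟩ hp
      simp only [Finset.mem_filter, Finset.mem_univ, true_and, Finset.mem_union, Finset.mem_image, T, Hs] at hp ⊢
      by_cases h : Hd G δ v u
      · exact Or.inr h
      · left
        unfold Hd at h
        push Not at h
        obtain ⟨z, hz⟩ := h hp
        obtain ⟨w, hw⟩ := exists_face hM hp hz
        exact ⟨(v, u, w), hw, rfl⟩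
    calc _ ≤ _ := Finset.card_le_card this
      _ ≤ _ := Finset.card_union_le _ _
      _ ≤ _ := Nat.add_le_add_right Finset.card_image_le _
  have c2 : T.card ≤ 3 * (Tr ∪ Tl).card := by
    have : T ⊆ (Tr ∪ Tl) ∪ (Tr ∪ Tl).image (fun p => (p.2.1, p.2.2, p.1)) ∪ (Tr ∪ Tl).image (fun p => (p.2.2, p.1, p.2.1)) := by
      rintro ⟨v, u, w⟩ hp
      simp only [Finset.mem_filter, Finset.mem_univ, true_and, Finset.mem_union, Finset.mem_image, T, Tr, Tl] at hp ⊢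
      have r1 := hp.rot
      have r2 := r1.rot
      have e1 := hinj' hp.1.ne
      have e2 := hinj' r1.1.ne
      have e3 := hinj' r2.1.ne
      by_cases hv : (Y u < Y v ∧ Y v < Y w) ∨ (Y w < Y v ∧ Y v < Y u)
      · left; left
        rcases hv with h | h
        · exact Or.inl ⟨hp, h⟩
        · exact Or.inr ⟨hp, h⟩
      · by_cases hu : (Y w < Y u ∧ Y u < Y v) ∨ (Y v < Y u ∧ Y u < Y w)
        · right
          refine ⟨(u, w, v), ?_, rfl⟩
          rcases hu with h | h
          · exact Or.inl ⟨r1, h⟩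
          · exact Or.inr ⟨r1, h⟩
        · left; right
          refine ⟨(w, v, u), ?_, rfl⟩
          have : (Y v < Y w ∧ Y w < Y u) ∨ (Y u < Y w ∧ Y w < Y v) := by
            clear hY hinj' htop hbot hYtb
            grind
          rcases this with h | h
          · exact Or.inl ⟨r2, h⟩
          · exact Or.inr ⟨r2, h⟩
    have h1 := Finset.card_le_card this
    have h2 := Finset.card_union_le ((Tr ∪ Tl) ∪ (Tr ∪ Tl).image (fun p => (p.2.1, p.2.2, p.1))) ((Tr ∪ Tl).image (fun p => (p.2.2, p.1, p.2.1)))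
    have h3 := Finset.card_union_le (Tr ∪ Tl) ((Tr ∪ Tl).image (fun p => (p.2.1, p.2.2, p.1)))
    have h4 : ((Tr ∪ Tl).image (fun p => (p.2.1, p.2.2, p.1))).card ≤ _ := Finset.card_image_le
    have h5 : ((Tr ∪ Tl).image (fun p => (p.2.2, p.1, p.2.1))).card ≤ _ := Finset.card_image_le
    omega
  have c3 : (Tr ∪ Tl).card ≤ Rv.card + Lv.card := by
    refine le_trans (Finset.card_union_le _ _) (Nat.add_le_add ?_ ?_)
    · apply Finset.card_le_card_of_injOn Prod.fst
      · rintro ⟨v, u, w⟩ hp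
        simp only [Finset.coe_filter, Finset.mem_filter, Finset.mem_univ, true_and, Set.mem_ofPred_eq, T, Tr, Rv] at hp ⊢
        exact ⟨u, w, hp⟩
      · rintro ⟨v, u, w⟩ hp ⟨v', u', w'⟩ hp' e
        simp only [Finset.coe_filter, Finset.mem_filter, Finset.mem_univ, true_and, Set.mem_ofPred_eq, T, Tr] at hp hp' e
        subst e
        have e : u = u' := type_unique hP (a := t) (b := 1) hp.1 hp'.1 (by simpa only [hY] using hp.2.1) (by simpa only [hY] using hp.2.2) (by simpa only [hY] using hp'.2.1) (by simpa only [hY] using hp'.2.2)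
        subst e
        rw [hp.1.unique hP hp'.1]
    · apply Finset.card_le_card_of_injOn Prod.fst
      · rintro ⟨v, u, w⟩ hp
        simp only [Finset.coe_filter, Finset.mem_filter, Finset.mem_univ, true_and, Set.mem_ofPred_eq, T, Tl, Lv] at hp ⊢
        exact ⟨u, w, hp⟩
      · rintro ⟨v, u, w⟩ hp ⟨v', u', w'⟩ hp' e
        simp only [Finset.coe_filter, Finset.mem_filter, Finset.mem_univ, true_and, Set.mem_ofPred_eq, T, Tl] at hp hp' e
        subst e
        have e : u = u' := type_unique hP (a := -t) (b := -1) hp.1 hp'.1 (by simp only [hneg, hY]; linarith [hp.2.2]) (by simp only [hneg, hY]; linarith [hp.2.1]) (by simp only [hneg, hY]; linarith [hp'.2.2]) (by simp only [hneg, hY]; linarith [hp'.2.1])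
        subst e
        rw [hp.1.unique hP hp'.1]
  -- hull darts
  have c4 : (Hs.filter (fun p => Y p.1 < Y p.2)).card + Lv.card + 1 ≤ Fintype.card V := by
    have i1 : ((Hs.filter (fun p => Y p.1 < Y p.2)).image Prod.fst).card = (Hs.filter (fun p => Y p.1 < Y p.2)).card := by
      apply Finset.card_image_of_injOn
      rintro ⟨v, u⟩ hp ⟨v', u'⟩ hp' e
      simp only [Finset.coe_filter, Finset.mem_filter, Finset.mem_univ, true_and, Set.mem_ofPred_eq, Hs] at hp hp' e
      subst e
      rw [hp.1.out_unique hP hN hp'.1]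
    rw [← i1, ← Finset.card_union_of_disjoint]
    · rw [← Finset.card_univ, ← Finset.card_erase_add_one (Finset.mem_univ top)]
      apply Nat.add_le_add_right
      apply Finset.card_le_card
      intro v hv
      simp only [Finset.mem_filter, Finset.mem_univ, true_and, Finset.mem_union, Finset.mem_image, Hs, Lv] at hv
      simp only [Finset.mem_erase, Finset.mem_univ, and_true]
      rintro rfl
      rcases hv with ⟨⟨v', u⟩, hp, rfl⟩ | ⟨u, w, hp⟩
      · have := htop u; simp only at *; linarith [hp.2]
      · have := htop u; linarith [hp.2.2]
    · rw [Finset.disjoint_left]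
      intro v hv hv'
      simp only [Finset.mem_filter, Finset.mem_univ, true_and, Finset.mem_image, Hs, Lv] at hv hv'
      obtain ⟨⟨v, u0⟩, hp, rfl⟩ := hv
      obtain ⟨u, w, hF, h1, h2⟩ := hv'
      simp only at hp h1 h2 hF
      exact pluck (a := t) (b := 1) (v := δ v) (e1 := δ v) (e2 := δ u0) (u := δ u) (w := δ w) (by simp only [hY]; exact hp.2) (by simp only [hY]; exact h2)
        (by simp only [hY]; exact h1) hF.2.2.2.1 (hp.1.2 u) (hp.1.2 w)
  have c5 : (Hs.filter (fun p => Y p.2 < Y p.1)).card + Rv.card + 1 ≤ Fintype.card V := by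
    have i1 : ((Hs.filter (fun p => Y p.2 < Y p.1)).image Prod.fst).card = (Hs.filter (fun p => Y p.2 < Y p.1)).card := by
      apply Finset.card_image_of_injOn
      rintro ⟨v, u⟩ hp ⟨v', u'⟩ hp' e
      simp only [Finset.coe_filter, Finset.mem_filter, Finset.mem_univ, true_and, Set.mem_ofPred_eq, Hs] at hp hp' e
      subst e
      rw [hp.1.out_unique hP hN hp'.1]
    rw [← i1, ← Finset.card_union_of_disjoint]
    · rw [← Finset.card_univ, ← Finset.card_erase_add_one (Finset.mem_univ bot)]
      apply Nat.add_le_add_right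
      apply Finset.card_le_card
      intro v hv
      simp only [Finset.mem_filter, Finset.mem_univ, true_and, Finset.mem_union, Finset.mem_image, Hs, Rv] at hv
      simp only [Finset.mem_erase, Finset.mem_univ, and_true]
      rintro rfl
      rcases hv with ⟨⟨v', u⟩, hp, rfl⟩ | ⟨u, w, hp⟩
      · have := hbot u; simp only at *; linarith [hp.2]
      · have := hbot u; linarith [hp.2.1]
    · rw [Finset.disjoint_left]
      intro v hv hv'
      simp only [Finset.mem_filter, Finset.mem_univ, true_and, Finset.mem_image, Hs, Rv] at hv hv'
      obtain ⟨⟨v, u0⟩, hp, rfl⟩ := hv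
      obtain ⟨u, w, hF, h1, h2⟩ := hv'
      simp only at hp h1 h2 hF
      exact pluck (a := -t) (b := -1) (v := δ v) (e1 := δ v) (e2 := δ u0) (u := δ u) (w := δ w) (by simp only [hneg, hY]; linarith [hp.2]) (by simp only [hneg, hY]; linarith)
        (by simp only [hneg, hY]; linarith) hF.2.2.2.1 (hp.1.2 u) (hp.1.2 w)
  have c6 : Hs.card ≤ (Hs.filter (fun p => Y p.1 < Y p.2)).card + (Hs.filter (fun p => Y p.2 < Y p.1)).card := by
    refine le_trans (Finset.card_le_card ?_) (Finset.card_union_le _ _)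
    rintro ⟨v, u⟩ hp
    simp only [Finset.mem_union, Finset.mem_filter, hp, true_and]
    simp only [Finset.mem_filter, Finset.mem_univ, true_and, Hs] at hp
    exact hinj' hp.1.ne
  have hcard : ∀ S : Finset V, (∀ x ∈ S, x ≠ top ∧ x ≠ bot) → S.card + 2 ≤ Fintype.card V := by
    intro S hS
    have : S ⊆ (Finset.univ.erase top).erase bot := by
      intro x hx; simp [hS x hx]
    have := Finset.card_le_card this
    rw [Finset.card_erase_of_mem (by simp [htb]), Finset.card_erase_of_mem (by simp), Finset.card_univ] at this
    omega
  have hcard' : ∀ (S : Finset V) (v : V), v ≠ top → v ≠ bot → v ∉ S → (∀ x ∈ S, x ≠ top ∧ x ≠ bot) → S.card + 3 ≤ Fintype.card V := by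
    intro S v h1 h2 h3 hS
    have := hcard (insert v S) (by
      intro x hx
      rcases Finset.mem_insert.1 hx with rfl | hx
      · exact ⟨h1, h2⟩
      · exact hS x hx)
    rw [Finset.card_insert_of_notMem h3] at this
    omega
  have hRt : ∀ x ∈ Rv, x ≠ top ∧ x ≠ bot := by
    intro x hx
    simp only [Finset.mem_filter, Finset.mem_univ, true_and, Rv] at hx
    obtain ⟨u, w, -, h1, h2⟩ := hx
    constructor
    · rintro rfl; linarith [htop w]
    · rintro rfl; linarith [hbot u]
  have hLt : ∀ x ∈ Lv, x ≠ top ∧ x ≠ bot := by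
    intro x hx
    simp only [Finset.mem_filter, Finset.mem_univ, true_and, Lv] at hx
    obtain ⟨u, w, -, h1, h2⟩ := hx
    constructor
    · rintro rfl; linarith [htop u]
    · rintro rfl; linarith [hbot w]
  have c7 := hcard _ hRt
  have c8 := hcard _ hLt
  have c9 : Rv.card + Lv.card + 5 ≤ 2 * Fintype.card V := by
    obtain ⟨z, hz⟩ := hN.line (fun e => htb (hP.1 e) : δ bot ≠ δ top)
    rcases lt_or_gt_of_ne hz with hz | hz
    · obtain ⟨v, hv⟩ := Finite.exists_min (fun v => cr (δ bot) (δ top) (δ v))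
      have hv0 := lt_of_le_of_lt (hv z) hz
      have := hcard' Rv v (by rintro rfl; simp [cr, mul_comm] at hv0) (by rintro rfl; simp [cr, mul_comm] at hv0) (by
        intro hx
        simp only [Finset.mem_filter, Finset.mem_univ, true_and, Rv] at hx
        obtain ⟨u, w, hF, h1, h2⟩ := hx
        have k1 := hv u
        have k2 := hv w
        simp only [cr] at k1 k2
        exact pluck (a := -t) (b := -1) (v := δ v) (e1 := δ top) (e2 := δ bot) (u := δ u) (w := δ w) (by simp only [hneg, hY]; linarith) (by simp only [hneg, hY]; linarith)
          (by simp only [hneg, hY]; linarith) hF.2.2.2.1 (by linarith) (by linarith)) hRt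
      omega
    · obtain ⟨v, hv⟩ := Finite.exists_max (fun v => cr (δ bot) (δ top) (δ v))
      have hv0 := lt_of_lt_of_le hz (hv z)
      have := hcard' Lv v (by rintro rfl; simp [cr, mul_comm] at hv0) (by rintro rfl; simp [cr, mul_comm] at hv0) (by
        intro hx
        simp only [Finset.mem_filter, Finset.mem_univ, true_and, Lv] at hx
        obtain ⟨u, w, hF, h1, h2⟩ := hx
        have k1 := hv u
        have k2 := hv w
        simp only [cr] at k1 k2
        exact pluck (a := t) (b := 1) (v := δ v) (e1 := δ bot) (e2 := δ top) (u := δ u) (w := δ w) (by simp only [hY]; linarith) (by simp only [hY]; linarith)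
          (by simp only [hY]; linarith) hF.2.2.2.1 (by linarith) (by linarith)) hLt
      omega
  change _ ∧ Hs.card = 3
  omega

open Classical in
theorem count_main [Fintype V] {G : SimpleGraph V} {δ : V → ℝ × ℝ} (hP : IsPlaneDrawing G δ)
    (hn : 3 ≤ Fintype.card V) (hE : G.edgeSet.ncard = 3 * Fintype.card V - 6) :
    MaxPlane G δ ∧ NC δ ∧ (Finset.univ.filter (fun p : V × V => Hd G δ p.1 p.2)).card = 3 := by
  have hN := nc_of_edges hP hn hE.ge
  obtain ⟨G', hle, hmax⟩ := Set.Finite.exists_le_maximal (Set.toFinite {G' : SimpleGraph V | IsPlaneDrawing G' δ}) (a := G) hP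
  have hM : MaxPlane G' δ := ⟨hmax.1, fun G'' h1 h2 => hmax.2 h2 h1⟩
  have hsub : G.edgeSet ⊆ G'.edgeSet := SimpleGraph.edgeSet_mono hle
  have hcl := Set.ncard_le_ncard hsub (Set.toFinite _)
  obtain ⟨e1, e2⟩ := count_core hM hn (by omega)
  have : G = G' := by
    apply SimpleGraph.edgeSet_injective
    exact Set.eq_of_subset_of_ncard_le hsub (by omega) (Set.toFinite _)
  subst this
  exact ⟨hM, hN, e2⟩

end FixTri
namespace FixTri
variable {V : Type*}

lemma winding {v y : ℝ × ℝ} (hvy : v ≠ y) {X : Finset V} {δ : V → ℝ × ℝ} (hne : X.Nonempty) (σ : V → V)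
    (hσ : ∀ x ∈ X, σ x ∈ X) (hcr : ∀ x ∈ X, 0 < cr v (δ x) (δ (σ x)))
    (h1 : ∀ x ∈ X, 0 < cr v (δ x) y → 0 < cr v y (δ (σ x)) → False)
    (h2 : ∀ x ∈ X, cr v y (δ x) = 0 → 0 < ((δ x).1 - v.1) * (y.1 - v.1) + ((δ x).2 - v.2) * (y.2 - v.2) → False) :
    False := by
  obtain ⟨c, hc⟩ : ∃ c : V → ℝ, ∀ x, cr v y (δ x) = c x := ⟨_, fun _ => rfl⟩
  obtain ⟨e, he⟩ : ∃ e : V → ℝ, ∀ x, ((δ x).1 - v.1) * (y.1 - v.1) + ((δ x).2 - v.2) * (y.2 - v.2) = e x := ⟨_, fun _ => rfl⟩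
  have hpos : 0 < (y.1 - v.1)^2 + (y.2 - v.2)^2 := by
    by_contra h
    push Not at h
    apply hvy
    ext <;> nlinarith [sq_nonneg (y.1 - v.1), sq_nonneg (y.2 - v.2)]
  have hk : ∀ x ∈ X, c x * e (σ x) < e x * c (σ x) := by
    intro x hx
    have := mul_pos hpos (hcr x hx)
    have id : ((y.1 - v.1)^2 + (y.2 - v.2)^2) * cr v (δ x) (δ (σ x)) = e x * c (σ x) - c x * e (σ x) := by
      rw [← he, ← he, ← hc, ← hc]; simp only [cr]; ring
    linarith
  have h1' : ∀ x ∈ X, c x < 0 → 0 < c (σ x) → False := by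
    intro x hx a b
    refine h1 x hx ?_ (by rw [hc]; exact b)
    rw [cr_swap, hc]; linarith
  have h2' : ∀ x ∈ X, c x = 0 → 0 < e x → False := by
    intro x hx a b
    exact h2 x hx (by rw [hc]; exact a) (by rw [he]; exact b)
  have hneg : ∀ x ∈ X, 0 ≤ c x := by
    by_contra hcon
    push Not at hcon
    obtain ⟨x0, hx0, hx0'⟩ := hcon
    obtain ⟨x, hx, hmax⟩ := Finset.exists_max_image (X.filter (fun x => c x < 0)) (fun x => - e x / c x) ⟨x0, by simp [hx0, hx0']⟩
    rw [Finset.mem_filter] at hx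
    have hk' := hk x hx.1
    rcases lt_trichotomy (c (σ x)) 0 with h | h | h
    · have := hmax (σ x) (by simp [h, hσ x hx.1])
      simp only [neg_div, ← div_neg] at this
      rw [div_le_div_iff₀ (by linarith) (by linarith [hx.2])] at this
      linarith
    · refine h2' _ (hσ x hx.1) h ?_
      rw [h] at hk'
      nlinarith [hx.2]
    · exact h1' x hx.1 hx.2 h
  have hzero : ∀ x ∈ X, 0 < c x := by
    intro x hx
    rcases (hneg x hx).eq_or_lt with h | h
    · exfalso
      have := hk x hx
      have h3 := hneg _ (hσ x hx)
      rw [← h] at this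
      have h4 : 0 < e x := by
        by_contra h5; push Not at h5
        nlinarith
      exact h2' x hx h.symm h4
    · exact h
  obtain ⟨x, hx, hmax⟩ := Finset.exists_max_image X (fun x => - e x / c x) hne
  have := hmax (σ x) (hσ x hx)
  rw [div_le_div_iff₀ (hzero _ (hσ x hx)) (hzero x hx)] at this
  linarith [hk x hx]

open Classical in
lemma hull_inout [Fintype V] {G : SimpleGraph V} {δ : V → ℝ × ℝ} (hM : MaxPlane G δ) (v : V) :
    (∃ u, Hd G δ v u) ↔ (∃ u, Hd G δ u v) := by
  have hP := hM.1
  have ef : ∀ v u, G.Adj v u → ¬ Hd G δ v u → ∃ w, Face G δ v u w := by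
    intro v u h1 h2
    unfold Hd at h2
    push Not at h2
    obtain ⟨z, hz⟩ := h2 h1
    exact exists_face hM h1 hz
  have nf : ∀ {v u w}, Face G δ v u w → ¬ Hd G δ v u := fun {_ _ w} hF hH => by
    linarith [hF.2.2.2.1, hH.2 w]
  let O := Finset.univ.filter (fun u => G.Adj v u ∧ ¬ Hd G δ v u)
  let I := Finset.univ.filter (fun u => G.Adj v u ∧ ¬ Hd G δ u v)
  let N := Finset.univ.filter (fun u => G.Adj v u)
  have c1 : O.card ≤ I.card := by
    apply Finset.card_le_card_of_forall_subsingleton (fun u w => Face G δ v u w)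
    · intro u hu
      simp only [O, I, Finset.mem_filter, Finset.mem_univ, true_and] at hu ⊢
      obtain ⟨w, hw⟩ := ef v u hu.1 hu.2
      exact ⟨w, ⟨hw.2.2.1.symm, nf hw.rot.rot⟩, hw⟩
    · intro w _ u hu u' hu'
      exact hu.2.rot.rot.unique hP hu'.2.rot.rot
  have c2 : I.card ≤ O.card := by
    apply Finset.card_le_card_of_forall_subsingleton (fun w u => Face G δ v u w)
    · intro w hw
      simp only [O, I, Finset.mem_filter, Finset.mem_univ, true_and] at hw ⊢
      obtain ⟨u, hu⟩ := ef w v hw.1.symm hw.2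
      exact ⟨u, ⟨hu.rot.1, nf hu.rot⟩, hu.rot⟩
    · intro u _ w hw w' hw'
      exact hw.2.unique hP hw'.2
  have hO : O ⊆ N := by intro x; simp only [O, N, Finset.mem_filter, Finset.mem_univ, true_and]; tauto
  have hI : I ⊆ N := by intro x; simp only [I, N, Finset.mem_filter, Finset.mem_univ, true_and]; tauto
  constructor
  · rintro ⟨u, hu⟩
    by_contra hcon
    push Not at hcon
    have : I = N := by ext x; simp [I, N, hcon]
    have hlt : O.card < N.card := Finset.card_lt_card ⟨hO, fun h => by
      have := h (show u ∈ N by simp [N, hu.1])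
      simp [O, hu] at this⟩
    rw [this] at c2; omega
  · rintro ⟨u, hu⟩
    by_contra hcon
    push Not at hcon
    have : O = N := by ext x; simp [O, N, hcon]
    have hlt : I.card < N.card := Finset.card_lt_card ⟨hI, fun h => by
      have := h (show u ∈ N by simp [N, hu.1.symm])
      simp [I, hu] at this⟩
    rw [this] at c1; omega

open Classical in
lemma hull3 [Fintype V] {G : SimpleGraph V} {δ : V → ℝ × ℝ} (hM : MaxPlane G δ) (hN : NC δ)
    (h3 : (Finset.univ.filter (fun p : V × V => Hd G δ p.1 p.2)).card = 3) {v u : V} (h : Hd G δ v u) :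
    ∃ w, Hd G δ u w ∧ Hd G δ w v := by
  have hP := hM.1
  have no2 : ∀ {v u}, Hd G δ v u → Hd G δ u v → False := by
    intro v u h h'
    obtain ⟨z, hz⟩ := hN.line (fun e => h.1.ne (hP.1 e) : δ v ≠ δ u)
    have h1 := h.2 z
    have h2 := h'.2 z
    have : cr (δ u) (δ v) (δ z) = - cr (δ v) (δ u) (δ z) := by simp only [cr]; ring
    apply hz; linarith
  obtain ⟨w, hw⟩ := (hull_inout hM u).2 ⟨v, h⟩
  obtain ⟨e, he⟩ := (hull_inout hM w).2 ⟨u, hw⟩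
  obtain ⟨x, hx⟩ := (hull_inout hM v).1 ⟨u, h⟩
  have hvw : v ≠ w := by rintro rfl; exact no2 h hw
  have hsub : ({(v, u), (u, w), (w, e)} : Finset (V × V)) ⊆ Finset.univ.filter (fun p : V × V => Hd G δ p.1 p.2) := by
    intro p hp
    simp only [Finset.mem_insert, Finset.mem_singleton] at hp
    rcases hp with rfl | rfl | rfl <;> simp [h, hw, he]
  have hc : ({(v, u), (u, w), (w, e)} : Finset (V × V)).card = 3 := by
    rw [Finset.card_eq_three]
    refine ⟨_, _, _, ?_, ?_, ?_, rfl⟩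
    · simp [h.1.ne]
    · simp [hvw]
    · simp [hw.1.ne]
  have heq := Finset.eq_of_subset_of_card_le hsub (by rw [h3, hc])
  have hxm : (x, v) ∈ ({(v, u), (u, w), (w, e)} : Finset (V × V)) := by rw [heq]; simp [hx]
  simp only [Finset.mem_insert, Finset.mem_singleton, Prod.mk.injEq] at hxm
  rcases hxm with ⟨-, h'⟩ | ⟨-, h'⟩ | ⟨-, h'⟩
  · exact absurd h' h.1.ne
  · exact absurd h' hvw
  · exact ⟨w, hw, h' ▸ he⟩

def Fc (G : SimpleGraph V) (δ : V → ℝ × ℝ) (v u w : V) : Prop :=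
  Face G δ v u w ∨ (Hd G δ v u ∧ Hd G δ u w ∧ Hd G δ w v)

lemma Fc.rot {G : SimpleGraph V} {δ : V → ℝ × ℝ} {v u w : V} (h : Fc G δ v u w) : Fc G δ u w v := by
  rcases h with h | h
  · exact Or.inl h.rot
  · exact Or.inr ⟨h.2.1, h.2.2, h.1⟩

lemma Fc.unique {G : SimpleGraph V} {δ : V → ℝ × ℝ} (hP : IsPlaneDrawing G δ) (hN : NC δ) {v u w w' : V}
    (h : Fc G δ v u w) (h' : Fc G δ v u w') : w = w' := by
  have nf : ∀ {w}, Face G δ v u w → ¬ Hd G δ v u := fun {w} hF hH => by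
    linarith [hF.2.2.2.1, hH.2 w]
  rcases h with h | h <;> rcases h' with h' | h'
  · exact h.unique hP h'
  · exact absurd h'.1 (nf h)
  · exact absurd h.1 (nf h')
  · exact h.2.1.out_unique hP hN h'.2.1

lemma Fc.adj {G : SimpleGraph V} {δ : V → ℝ × ℝ} {v u w : V} (h : Fc G δ v u w) : G.Adj v u := by
  rcases h with h | h
  · exact h.1
  · exact h.1.1

/-- combinatorial triangulation -/
structure Tri (G : SimpleGraph V) (A : V → V → V) : Prop where
  adj1 : ∀ {v u}, G.Adj v u → G.Adj u (A v u)
  adj2 : ∀ {v u}, G.Adj v u → G.Adj v (A v u)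
  rot : ∀ {v u}, G.Adj v u → A u (A v u) = v
  cyc : ∀ {v u u'}, G.Adj v u → G.Adj v u' → ∃ k, (A v)^[k] u = u'

open Classical in
theorem tri_main [Fintype V] {G : SimpleGraph V} {δ : V → ℝ × ℝ} (hP : IsPlaneDrawing G δ)
    (hn : 3 ≤ Fintype.card V) (hE : G.edgeSet.ncard = 3 * Fintype.card V - 6) : ∃ A, Tri G A := by
  obtain ⟨hM, hN, h3⟩ := count_main hP hn hE
  have ex : ∀ v u, ∃ w, G.Adj v u → Fc G δ v u w := by
    intro v u
    by_cases hu : G.Adj v u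
    · by_cases h : Hd G δ v u
      · obtain ⟨w, h1, h2⟩ := hull3 hM hN h3 h
        exact ⟨w, fun _ => Or.inr ⟨h, h1, h2⟩⟩
      · unfold Hd at h
        push Not at h
        obtain ⟨z, hz⟩ := h hu
        obtain ⟨w, hw⟩ := exists_face hM hu hz
        exact ⟨w, fun _ => Or.inl hw⟩
    · exact ⟨v, fun h => absurd h hu⟩
  choose A hA using ex
  have adj2 : ∀ {v u}, G.Adj v u → G.Adj v (A v u) := fun h => (hA _ _ h).rot.rot.adj.symm
  refine ⟨A, fun h => (hA _ _ h).rot.adj, adj2, fun h => ?_, ?_⟩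
  · exact (hA _ _ (hA _ _ h).rot.adj).unique hP hN (hA _ _ h).rot
  intro v u u' hu hu'
  by_contra hcon
  push Not at hcon
  have inj : ∀ x y, G.Adj v x → G.Adj v y → A v x = A v y → x = y := by
    intro x y hx hy e
    have h1 := (hA v x hx).rot.rot
    have h2 := (hA v y hy).rot.rot
    rw [← e] at h2
    exact h1.unique hP hN h2
  let C : Finset V := Finset.univ.filter (fun x => ∃ k, (A v)^[k] u = x)
  let C' : Finset V := Finset.univ.filter (fun x => G.Adj v x ∧ x ∉ C)
  have hCN : ∀ x ∈ C, G.Adj v x := by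
    intro x hx
    simp only [C, Finset.mem_filter, Finset.mem_univ, true_and] at hx
    obtain ⟨k, rfl⟩ := hx
    induction k with
    | zero => exact hu
    | succ k ih => rw [Function.iterate_succ_apply']; exact adj2 ih
  have hC : ∀ x ∈ C, A v x ∈ C := by
    intro x hx
    simp only [C, Finset.mem_filter, Finset.mem_univ, true_and] at hx ⊢
    obtain ⟨k, rfl⟩ := hx
    exact ⟨k + 1, by rw [Function.iterate_succ_apply']⟩
  have hsurj : ∀ y ∈ C, ∃ x ∈ C, A v x = y := by
    have := Finset.surj_on_of_inj_on_of_card_le (s := C) (t := C) (fun x _ => A v x) hC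
      (fun x y hx hy e => inj x y (hCN x hx) (hCN y hy) e) le_rfl
    intro y hy
    obtain ⟨x, hx, e⟩ := this y hy
    exact ⟨x, hx, e.symm⟩
  have hC'N : ∀ x ∈ C', G.Adj v x ∧ x ∉ C := by
    intro x hx
    simpa only [C', Finset.mem_filter, Finset.mem_univ, true_and] using hx
  have hC' : ∀ x ∈ C', A v x ∈ C' := by
    intro x hx
    obtain ⟨h1, h2⟩ := hC'N x hx
    simp only [C', Finset.mem_filter, Finset.mem_univ, true_and]
    refine ⟨adj2 h1, fun h => ?_⟩
    obtain ⟨y, hy, e⟩ := hsurj _ h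
    exact h2 (inj _ _ (hCN y hy) h1 e ▸ hy)
  have key : ∀ X : Finset V, X.Nonempty → (∀ x ∈ X, G.Adj v x) → (∀ x ∈ X, A v x ∈ X) → (∀ x ∈ X, ¬ Hd G δ v x) →
      ∀ y, G.Adj v y → y ∉ X → False := by
    intro X hne hX hσ hH y hy hyX
    have hF : ∀ x ∈ X, Face G δ v x (A v x) := by
      intro x hx
      rcases hA v x (hX x hx) with h | h
      · exact h
      · exact absurd h.1 (hH x hx)
    refine winding (fun e => hy.ne (hP.1 e) : δ v ≠ δ y) hne (A v) hσ (fun x hx => (hF x hx).2.2.2.1) ?_ ?_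
    · intro x hx h1 h2
      exact (hF x hx).cone hP hy h1 h2
    · intro x hx h1 h2
      obtain ⟨a, ha⟩ := collinear_lp h1 (fun e => hy.ne (hP.1 e))
      rw [ha] at h2
      simp only [lp] at h2
      have h2' : 0 < a * (((δ y).1 - (δ v).1)^2 + ((δ y).2 - (δ v).2)^2) := by linarith
      have := ray_unique hP hy (hX x hx) (pos_of_mul_pos_left h2' (by positivity)) (by rw [ha]; simp only [lp]; ring) (by rw [ha]; simp only [lp]; ring)
      exact hyX (this ▸ hx)
  have huC : u ∈ C := by simp only [C, Finset.mem_filter, Finset.mem_univ, true_and]; exact ⟨0, rfl⟩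
  have hu'C : u' ∉ C := by simp only [C, Finset.mem_filter, Finset.mem_univ, true_and]; push Not; exact hcon
  have hu'C' : u' ∈ C' := by simp only [C', Finset.mem_filter, Finset.mem_univ, true_and]; exact ⟨hu', hu'C⟩
  by_cases hh : ∃ x ∈ C, Hd G δ v x
  · obtain ⟨x, hx, hxH⟩ := hh
    refine key C' ⟨u', hu'C'⟩ (fun x hx => (hC'N x hx).1) hC' ?_ u hu (fun h => (hC'N u h).2 huC)
    intro z hz hzH
    have := hxH.out_unique hP hN hzH
    exact (hC'N z hz).2 (this ▸ hx)
  · push Not at hh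
    exact key C ⟨u, huC⟩ hCN hC hh u' hu' hu'C

end FixTri
namespace FixTri
variable {V : Type*}

section exact
variable {G : SimpleGraph V} {A : V → V → V}

lemma Tri.rot2 (hT : Tri G A) {x y : V} (h : G.Adj x y) : A (A x y) x = y := by
  have := hT.rot (hT.adj1 h)
  rwa [hT.rot h] at this

open Classical in
noncomputable def fa (A : V → V → V) (x y : V) : Finset (V × V) := {(x, y), (y, A x y), (A x y, x)}

lemma fa_self (x y : V) : (x, y) ∈ fa A x y := by simp [fa]

lemma fa_rot (hT : Tri G A) {x y : V} (h : G.Adj x y) : fa A y (A x y) = fa A x y := by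
  unfold fa
  rw [hT.rot h]
  ext p; simp only [Finset.mem_insert, Finset.mem_singleton]; tauto

lemma fa_eq (hT : Tri G A) {x y : V} (h : G.Adj x y) {p : V × V} (hp : p ∈ fa A x y) : fa A p.1 p.2 = fa A x y := by
  simp only [fa, Finset.mem_insert, Finset.mem_singleton] at hp
  rcases hp with rfl | rfl | rfl
  · rfl
  · exact fa_rot hT h
  · have := fa_rot hT (hT.adj1 h)
    rw [hT.rot h] at this
    rw [this, fa_rot hT h]

lemma fa_adj (hT : Tri G A) {x y : V} (h : G.Adj x y) {p : V × V} (hp : p ∈ fa A x y) : G.Adj p.1 p.2 := by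
  simp only [fa, Finset.mem_insert, Finset.mem_singleton] at hp
  rcases hp with rfl | rfl | rfl
  · exact h
  · exact hT.adj1 h
  · exact (hT.adj2 h).symm

open Classical in
noncomputable def faces [Fintype V] (G : SimpleGraph V) (A : V → V → V) : Finset (Finset (V × V)) :=
  (Finset.univ.filter (fun p : V × V => G.Adj p.1 p.2)).image (fun p => fa A p.1 p.2)

open Classical in
lemma faces_card [Fintype V] (hT : Tri G A) : 3 * (faces G A).card = 2 * G.edgeSet.ncard := by
  rw [← dart_card, Finset.card_eq_sum_card_image (fun p : V × V => fa A p.1 p.2)]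
  rw [← faces, Finset.sum_const_nat (m := 3), mul_comm]
  intro f hf
  simp only [faces, Finset.mem_image, Finset.mem_filter, Finset.mem_univ, true_and] at hf
  obtain ⟨⟨x, y⟩, h, rfl⟩ := hf
  simp only at h
  have : (Finset.univ.filter (fun p : V × V => G.Adj p.1 p.2)).filter (fun p => fa A p.1 p.2 = fa A x y) = fa A x y := by
    ext p
    simp only [Finset.mem_filter, Finset.mem_univ, true_and]
    constructor
    · rintro ⟨-, h2⟩; rw [← h2]; exact fa_self _ _
    · intro hp; exact ⟨fa_adj hT h hp, fa_eq hT h hp⟩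
  rw [this, fa, Finset.card_eq_three]
  exact ⟨_, _, _, by simp [h.ne], by simp [(hT.adj2 h).ne], by simp [(hT.adj1 h).ne], rfl⟩

/-- constant propagation -/
lemma const_prop (hT : Tri G A) (hc : G.Connected) {φ : V → V → ZMod 2}
    (h1 : ∀ x y, G.Adj x y → φ x y = φ y (A x y)) (h2 : ∀ x y, G.Adj x y → φ x y = φ y x) {x y x' y' : V}
    (h : G.Adj x y) (h' : G.Adj x' y') : φ x y = φ x' y' := by
  have loc : ∀ v u u', G.Adj v u → G.Adj v u' → φ v u = φ v u' := by
    intro v u u' hu hu'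
    obtain ⟨k, rfl⟩ := hT.cyc hu hu'
    clear hu'
    have : G.Adj v ((A v)^[k] u) ∧ φ v u = φ v ((A v)^[k] u) := by
      induction k with
      | zero => exact ⟨hu, rfl⟩
      | succ k ih =>
        rw [Function.iterate_succ_apply']
        refine ⟨hT.adj2 ih.1, ?_⟩
        rw [ih.2, h1 _ _ ih.1, h1 _ _ (hT.adj1 ih.1), hT.rot ih.1, ← h2 _ _ (hT.adj2 ih.1)]
    exact this.2
  have key : ∀ w, G.Reachable x w → ∀ u, G.Adj w u → φ x y = φ w u := by
    intro w hw
    rw [SimpleGraph.reachable_iff_reflTransGen] at hw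
    induction hw with
    | refl => intro u hu; exact loc _ _ _ h hu
    | tail _ hbc ih =>
      intro u hu
      rw [ih _ hbc, h2 _ _ hbc]
      exact loc _ _ _ hbc.symm hu
  exact key x' (hc.preconnected x x') y' h'

open Classical in
noncomputable def ext0 {α : Type*} (S : Set α) (g : S → ZMod 2) (e : α) : ZMod 2 := if h : e ∈ S then g ⟨e, h⟩ else 0

lemma ext0_add {α : Type*} (S : Set α) (g g' : S → ZMod 2) (e : α) : ext0 S (g + g') e = ext0 S g e + ext0 S g' e := by
  unfold ext0; split_ifs <;> simp

lemma ext0_smul {α : Type*} (S : Set α) (c : ZMod 2) (g : S → ZMod 2) (e : α) : ext0 S (c • g) e = c * ext0 S g e := by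
  unfold ext0; split_ifs <;> simp

noncomputable def d1 [Fintype V] (G : SimpleGraph V) : (G.edgeSet → ZMod 2) →ₗ[ZMod 2] (V → ZMod 2) where
  toFun g := fun v => ∑ u, ext0 G.edgeSet g s(v, u)
  map_add' g g' := by ext v; simp [ext0_add, Finset.sum_add_distrib]
  map_smul' c g := by ext v; simp [ext0_smul, Finset.mul_sum]

noncomputable def d2 [Fintype V] (G : SimpleGraph V) (A : V → V → V) :
    (↥(faces G A : Set (Finset (V × V))) → ZMod 2) →ₗ[ZMod 2] (G.edgeSet → ZMod 2) where
  toFun ψ := fun e => Sym2.lift ⟨fun x y => ext0 (faces G A : Set (Finset (V × V))) ψ (fa A x y) + ext0 (faces G A : Set (Finset (V × V))) ψ (fa A y x), fun x y => add_comm _ _⟩ e.1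
  map_add' g g' := by
    ext ⟨e, he⟩; induction e with | h x y => exact (congrArg₂ _ (ext0_add _ g g' _) (ext0_add _ g g' _)).trans (add_add_add_comm _ _ _ _)
  map_smul' c g := by
    ext ⟨e, he⟩; induction e with | h x y => exact (congrArg₂ _ (ext0_smul _ c g _) (ext0_smul _ c g _)).trans (mul_add _ _ _).symm

lemma d1_rank [Fintype V] (hc : G.Connected) :
    Fintype.card V ≤ Module.finrank (ZMod 2) (LinearMap.range (d1 G)) + 1 := by
  classical
  obtain ⟨v0⟩ := hc.nonempty
  have hedge : ∀ u v, G.Adj u v → (Pi.single u 1 + Pi.single v 1 : V → ZMod 2) ∈ LinearMap.range (d1 G) := by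
    intro u v h
    refine ⟨Pi.single ⟨s(u, v), h⟩ 1, ?_⟩
    have key : ∀ w x, ext0 G.edgeSet (Pi.single ⟨s(u, v), h⟩ 1) s(w, x) = (if w = u then (if x = v then 1 else 0) else 0) + (if w = v then (if x = u then 1 else 0) else 0) := by
      intro w x
      have hne := h.ne
      unfold ext0
      split_ifs <;> simp_all [Pi.single_apply, Subtype.ext_iff]
      all_goals exact absurd h.symm ‹_›
    ext w
    simp only [d1, LinearMap.coe_mk, AddHom.coe_mk, key, Finset.sum_add_distrib]
    simp only [Pi.add_apply, Pi.single_apply]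
    split_ifs <;> simp
  have htop : LinearMap.range (d1 G) ⊔ Submodule.span (ZMod 2) {(Pi.single v0 1 : V → ZMod 2)} = ⊤ := by
    have hs : ∀ w, G.Reachable v0 w → (Pi.single w 1 : V → ZMod 2) ∈ LinearMap.range (d1 G) ⊔ Submodule.span (ZMod 2) {(Pi.single v0 1 : V → ZMod 2)} := by
      intro w hw
      rw [SimpleGraph.reachable_iff_reflTransGen] at hw
      induction hw with
      | refl => exact Submodule.mem_sup_right (Submodule.mem_span_singleton_self _)
      | @tail b c _ hbc ih =>
        have := Submodule.sub_mem _ (Submodule.mem_sup_left (hedge _ _ hbc)) ih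
        simpa using this
    rw [eq_top_iff]
    intro f _
    rw [← Finset.univ_sum_single f]
    refine Submodule.sum_mem _ (fun w _ => ?_)
    have := Submodule.smul_mem _ (f w) (hs w (hc.preconnected v0 w))
    rw [← Pi.single_smul] at this
    simpa using this
  have h1 := Submodule.finrank_add_le_finrank_add_finrank (LinearMap.range (d1 G)) (Submodule.span (ZMod 2) {(Pi.single v0 1 : V → ZMod 2)})
  rw [htop, finrank_top, Module.finrank_pi] at h1
  have h2 := finrank_span_le_card (R := ZMod 2) {(Pi.single v0 1 : V → ZMod 2)}
  simp only [Set.toFinset_singleton, Finset.card_singleton] at h2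
  omega

lemma fa_mem [Fintype V] {x y : V} (h : G.Adj x y) : fa A x y ∈ (faces G A : Set (Finset (V × V))) := by
  simp only [faces, Finset.coe_image, Set.mem_image]
  exact ⟨(x, y), by simpa using h, rfl⟩

lemma d2_ker [Fintype V] (hT : Tri G A) (hc : G.Connected) :
    Module.finrank (ZMod 2) (LinearMap.ker (d2 G A)) ≤ 1 := by
  classical
  have h2 := finrank_span_le_card (R := ZMod 2) {(1 : ↥(faces G A : Set (Finset (V × V))) → ZMod 2)}
  simp only [Set.toFinset_singleton, Finset.card_singleton] at h2
  refine le_trans (Submodule.finrank_mono ?_) h2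
  intro ψ hψ
  rw [LinearMap.mem_ker] at hψ
  have hf : ∀ f : ↥(faces G A : Set (Finset (V × V))), ∃ x y, G.Adj x y ∧ ψ f = ext0 (faces G A : Set (Finset (V × V))) ψ (fa A x y) := by
    rintro ⟨f, hf⟩
    have hf2 := hf
    simp only [faces, Finset.coe_image, Set.mem_image, Finset.coe_filter, Finset.mem_univ, true_and] at hf2
    obtain ⟨⟨x, y⟩, hp, rfl⟩ := hf2
    exact ⟨x, y, hp, by simp only [ext0, dif_pos hf]⟩
  have hcon : ∀ f f' : ↥(faces G A : Set (Finset (V × V))), ψ f = ψ f' := by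
    intro f f'
    obtain ⟨x, y, h, e⟩ := hf f
    obtain ⟨x', y', h', e'⟩ := hf f'
    rw [e, e']
    refine const_prop hT hc (φ := fun x y => ext0 (faces G A : Set (Finset (V × V))) ψ (fa A x y)) ?_ ?_ h h'
    · intro x y h; exact congrArg _ (fa_rot hT h).symm
    · intro x y h
      have : _ + _ = (0 : ZMod 2) := congrFun hψ ⟨s(x, y), h⟩
      exact CharTwo.add_eq_zero.1 this
  rw [Submodule.mem_span_singleton]
  by_cases hne : Nonempty ↥(faces G A : Set (Finset (V × V)))
  · obtain ⟨f⟩ := hne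
    exact ⟨ψ f, by ext f'; simp [hcon f f']⟩
  · exact ⟨0, by ext f'; exact (hne ⟨f'⟩).elim⟩

theorem exactness [Fintype V] (hT : Tri G A) (hc : G.Connected) (hn : 3 ≤ Fintype.card V) (hE : G.edgeSet.ncard = 3 * Fintype.card V - 6)
    (g : V → V → ZMod 2) (hs : ∀ x y, g x y = g y x) (h0 : ∀ x y, ¬ G.Adj x y → g x y = 0) (hz : ∀ v, ∑ u, g v u = 0) :
    ∃ φ : V → V → ZMod 2, (∀ x y, G.Adj x y → φ x y = φ y (A x y)) ∧ ∀ x y, G.Adj x y → g x y = φ x y + φ y x := by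
  classical
  have hle : LinearMap.range (d2 G A) ≤ LinearMap.ker (d1 G) := by
    rintro _ ⟨ψ, rfl⟩
    rw [LinearMap.mem_ker]
    ext v
    simp only [d1, LinearMap.coe_mk, AddHom.coe_mk, Pi.zero_apply]
    set f : V → V → ZMod 2 := fun x y => ext0 (faces G A : Set (Finset (V × V))) ψ (fa A x y) with hf
    have e1 : ∀ u, ext0 G.edgeSet (d2 G A ψ) s(v, u) = if G.Adj v u then f v u + f u v else 0 := by
      intro u
      unfold ext0
      simp only [SimpleGraph.mem_edgeSet]
      split_ifs with h
      · simp [d2, hf]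
      · rfl
    simp only [e1]
    rw [← Finset.sum_filter, Finset.sum_add_distrib]
    have : ∑ u with G.Adj v u, f u v = ∑ u with G.Adj v u, f v u := by
      apply Finset.sum_bij' (fun u _ => A u v) (fun u _ => A v u)
      · intro u hu; simp only [Finset.mem_filter, Finset.mem_univ, true_and] at hu ⊢; exact hT.adj1 hu.symm
      · intro u hu; simp only [Finset.mem_filter, Finset.mem_univ, true_and] at hu ⊢; exact hT.adj2 hu
      · intro u hu; simp only [Finset.mem_filter, Finset.mem_univ, true_and] at hu ⊢; exact hT.rot hu.symm
      · intro u hu; simp only [Finset.mem_filter, Finset.mem_univ, true_and] at hu ⊢; exact hT.rot2 hu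
      · intro u hu; simp only [Finset.mem_filter, Finset.mem_univ, true_and] at hu ⊢
        rw [hf]; simp only; rw [fa_rot hT hu.symm]
    rw [this]; exact CharTwo.add_self_eq_zero _
  have heq : LinearMap.range (d2 G A) = LinearMap.ker (d1 G) := by
    apply Submodule.eq_of_le_of_finrank_le hle
    have r1 := LinearMap.finrank_range_add_finrank_ker (d1 G)
    have r2 := LinearMap.finrank_range_add_finrank_ker (d2 G A)
    rw [Module.finrank_pi, ← Nat.card_eq_fintype_card, Nat.card_coe_set_eq] at r1
    rw [Module.finrank_pi, ← Nat.card_eq_fintype_card, Nat.card_coe_set_eq, Set.ncard_coe_finset] at r2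
    have := faces_card hT
    have := d1_rank hc
    have := d2_ker hT hc
    omega
  have hg : (fun e : G.edgeSet => Sym2.lift ⟨g, hs⟩ e.1) ∈ LinearMap.ker (d1 G) := by
    rw [LinearMap.mem_ker]
    ext v
    simp only [d1, LinearMap.coe_mk, AddHom.coe_mk, Pi.zero_apply]
    rw [← hz v]
    apply Finset.sum_congr rfl
    intro u _
    unfold ext0
    split_ifs with h
    · rfl
    · exact (h0 _ _ h).symm
  rw [← heq] at hg
  obtain ⟨ψ, hψ⟩ := hg
  refine ⟨fun x y => ext0 (faces G A : Set (Finset (V × V))) ψ (fa A x y), ?_, ?_⟩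
  · intro x y h; simp only; rw [fa_rot hT h]
  · intro x y h
    exact (congrFun hψ ⟨s(x, y), h⟩).symm

end exact
end FixTri
namespace FixTri
variable {V : Type*}

/-- `y` follows `x` in the list. -/
def Nx : List V → V → V → Prop
  | [], _, _ => False
  | [_], _, _ => False
  | a :: b :: t, x, y => (x = a ∧ y = b) ∨ Nx (b :: t) x y

lemma nx_append (z : V) (m : List V) (x y : V) : ∀ l : List V,
    Nx (l ++ z :: m) x y ↔ Nx (l ++ [z]) x y ∨ Nx (z :: m) x y
  | [] => by simp [Nx]
  | [a] => by simp [Nx]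
  | a :: b :: t => by
    have := nx_append z m x y (b :: t)
    simp only [List.cons_append, Nx] at this ⊢
    rw [this, or_assoc]

lemma Nx.mem {x y : V} : ∀ {l : List V}, Nx l x y → x ∈ l ∧ y ∈ l.tail
  | [], h => by simp [Nx] at h
  | [_], h => by simp [Nx] at h
  | a :: b :: t, h => by
    simp only [Nx] at h
    rcases h with ⟨rfl, rfl⟩ | h
    · simp
    · have := h.mem
      simp only [List.tail_cons] at this ⊢
      exact ⟨List.mem_cons_of_mem _ this.1, List.mem_cons_of_mem _ this.2⟩

lemma Nx.mem2 {x y : V} {l : List V} (h : Nx l x y) : y ∈ l := List.mem_of_mem_tail h.mem.2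

lemma nx_into {l r : List V} {p w y : V} (h : (l ++ p :: w :: r).Nodup) : Nx (l ++ p :: w :: r) y w ↔ y = p := by
  rw [nx_append]
  have h1 : ¬ Nx (l ++ [p]) y w := fun h' => by
    have := h'.mem2
    simp only [List.mem_append, List.mem_singleton] at this
    have := List.disjoint_of_nodup_append (l₁ := l ++ [p]) (l₂ := w :: r) (by simpa using h)
    exact this h'.mem2 (by simp)
  have h2 : ¬ Nx (w :: r) y w := fun h' => by
    have h3 := h'.mem.2
    have : (w :: r).Nodup := (List.nodup_cons.1 (List.nodup_append.1 h).2.1).2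
    exact (List.nodup_cons.1 this).1 h3
  simp [Nx, h1, h2]

lemma nx_from {l r : List V} {w q y : V} (h : (l ++ w :: q :: r).Nodup) : Nx (l ++ w :: q :: r) w y ↔ y = q := by
  rw [nx_append]
  have h1 : ¬ Nx (l ++ [w]) w y := fun h' => by
    have h0 : (l ++ [w]).Nodup := by
      have : (l ++ [w] ++ q :: r).Nodup := by simpa using h
      exact (List.nodup_append.1 this).1
    clear h
    induction l with
    | nil => simp [Nx] at h'
    | cons a t ih =>
      cases t with
      | nil => simp [Nx] at h'; simp [h'.1] at h0
      | cons b t =>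
        simp only [List.cons_append, Nx] at h' ih
        rcases h' with h' | h'
        · simp [h'.1] at h0
        · exact ih h' (List.nodup_cons.1 h0).2
  have h2 : ¬ Nx (q :: r) w y := fun h' => by
    have h3 := h'.mem.1
    exact (List.nodup_cons.1 (List.nodup_append.1 h).2.1).1 h3
  simp [Nx, h1, h2]

lemma nx_into_head {r : List V} {w y : V} (h : (w :: r).Nodup) : ¬ Nx (w :: r) y w := fun h' =>
  (List.nodup_cons.1 h).1 h'.mem.2

lemma nx_from_last {l : List V} {w y : V} (h : (l ++ [w]).Nodup) : ¬ Nx (l ++ [w]) w y := by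
  induction l with
  | nil => simp [Nx]
  | cons a t ih =>
    intro h'
    cases t with
    | nil => simp [Nx] at h'; simp [h'.1] at h
    | cons b t =>
      simp only [List.cons_append, Nx] at h' ih
      rcases h' with h' | h'
      · simp [h'.1] at h
      · exact ih (List.nodup_cons.1 h).2 h'

lemma orbit_list (ρ : V → V) (q : V) : ∀ (k : ℕ) (p : V), (∀ j < k, ρ^[j] p ≠ q) → ρ^[k] p = q →
    ∃ s : List V, (s ++ [q]).Nodup ∧ (s ++ [q]).head? = some p ∧ (∀ u, u ∈ s ++ [q] ↔ ∃ j ≤ k, ρ^[j] p = u) ∧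
      ∀ x y, Nx (s ++ [q]) y x ↔ y ∈ s ∧ x = ρ y
  | 0, p, _, h2 => ⟨[], by simp, by simpa using h2.symm, by intro u; simp at h2; simp [h2, eq_comm], by simp [Nx]⟩
  | k + 1, p, h1, h2 => by
    obtain ⟨s, i1, i2, i3, i4⟩ := orbit_list ρ q k (ρ p) (fun j hj => h1 (j + 1) (by omega)) h2
    refine ⟨p :: s, ?_, by simp, ?_, ?_⟩
    · rw [List.cons_append, List.nodup_cons]
      refine ⟨fun h => ?_, i1⟩
      obtain ⟨j, hj, e⟩ := (i3 p).1 h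
      apply h1 (k - j) (by omega)
      have e2 : k - j + j = k := by omega
      have e3 : ρ^[k - j] (ρ^[j] (ρ p)) = q := by
        rw [← Function.iterate_add_apply, e2]; exact h2
      rwa [e] at e3
    · intro u
      rw [List.cons_append, List.mem_cons, i3]
      constructor
      · rintro (rfl | ⟨j, hj, e⟩)
        · exact ⟨0, by omega, rfl⟩
        · exact ⟨j + 1, by omega, e⟩
      · rintro ⟨j, hj, e⟩
        cases j with
        | zero => exact Or.inl e.symm
        | succ j => exact Or.inr ⟨j, by omega, e⟩
    · intro x y
      cases hs : s ++ [q] with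
      | nil => simp at hs
      | cons b t =>
        rw [hs] at i2 i4
        simp only [List.head?_cons, Option.some.injEq] at i2
        rw [List.cons_append, hs, Nx, i4, List.mem_cons, i2]
        constructor
        · rintro (⟨rfl, rfl⟩ | h)
          · simp
          · exact ⟨Or.inr h.1, h.2⟩
        · rintro ⟨rfl | h, h'⟩
          · exact Or.inl ⟨rfl, h'⟩
          · exact Or.inr ⟨h, h'⟩

/-- Construction sequences. -/
inductive Build (G : SimpleGraph V) (a b : V) : Set V → List V → Prop
  | base : G.Adj a b → Build G a b {a, b} [a, b]
  | step (K : Set V) (l : List V) (p : V) (mid : List V) (q : V) (r : List V) (v : V) :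
      Build G a b K (l ++ p :: (mid ++ q :: r)) → v ∉ K → (∀ u ∈ K, G.Adj v u ↔ u ∈ p :: (mid ++ [q])) →
      Build G a b (insert v K) (l ++ p :: v :: q :: r)

structure St (G : SimpleGraph V) (A : V → V → V) (a b c : V) (K : Set V) (κ : V → V → Prop) (L : List V) : Prop where
  nodup : L.Nodup
  sub : ∀ x ∈ L, x ∈ K
  ends : ∃ s, L = a :: (s ++ [b])
  adj : ∀ x y, Nx L x y → G.Adj x y
  kap : ∀ x y, κ x y → G.Adj x y ∧ x ∈ K ∧ y ∈ K
  krot : ∀ x y, κ x y → κ y (A x y)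
  kD : ∀ x y, x ∈ K → y ∈ K → G.Adj x y → (κ x y ↔ ¬ ((x = a ∧ y = b) ∨ Nx L y x))
  nc : ∀ x ∈ K, x ∉ L → ∀ y, G.Adj x y → y ∈ K
  R : ∀ φ : V → V → ZMod 2, (∀ x y, G.Adj x y → φ x y = φ y (A x y)) → φ c a = 0 →
      (∀ x y, G.Adj x y → ¬ (x ∈ K ∧ y ∈ K) → φ x y = φ y x) → ∀ x y, G.Adj x y → ¬ κ x y → φ x y = 0

section
variable {G : SimpleGraph V} {A : V → V → V} {a b c : V} {K : Set V} {κ : V → V → Prop} {L : List V}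

lemma fan_ind (hT : Tri G A) (hS : St G A a b c K κ L) {v p : V} (hv : G.Adj v p) 
    (hp : ∀ u ∈ K, G.Adj v u → u ≠ p → κ v u) (P : V → Prop) (h0 : P p) (h1 : ∀ u, κ v u → P (A v u) → P u) :
    ∀ u ∈ K, G.Adj v u → P u := by
  have : ∀ k u, u ∈ K → G.Adj v u → (A v)^[k] u = p → P u := by
    intro k
    induction k with
    | zero => intro u _ _ e; simp only [Function.iterate_zero, id] at e; rw [e]; exact h0
    | succ k ih =>
      intro u hu ha e
      by_cases h : u = p
      · rw [h]; exact h0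
      · have hk := hp u hu ha h
        exact h1 u hk (ih _ (hS.kap _ _ (hS.krot _ _ hk)).2.2 (hT.adj2 ha) e)
  intro u hu ha
  obtain ⟨k, hk⟩ := hT.cyc ha hv
  exact this k u hu ha hk

/-- cyclic predecessor -/
lemma St.prev (hS : St G A a b c K κ L) (hab : G.Adj a b) {w : V} (hw : w ∈ L) :
    ∃ p ∈ K, G.Adj w p ∧ ¬ κ w p ∧ ∀ u ∈ K, G.Adj w u → u ≠ p → κ w u := by
  obtain ⟨s, hs⟩ := hS.ends
  have hbL : b ∈ L := by rw [hs]; simp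
  have haL : a ∈ L := by rw [hs]; simp
  by_cases hwa : w = a
  · subst hwa
    refine ⟨b, hS.sub b hbL, hab, ?_, ?_⟩
    · intro h; exact (hS.kD _ _ (hS.sub _ haL) (hS.sub _ hbL) hab).1 h (Or.inl ⟨rfl, rfl⟩)
    · intro u hu ha hne
      rw [hS.kD _ _ (hS.sub _ haL) hu ha]
      rintro (h | h)
      · exact hne h.2
      · rw [hs] at h
        exact nx_into_head (hs ▸ hS.nodup) h
  · obtain ⟨l, r, hl⟩ := List.append_of_mem hw
    rcases List.eq_nil_or_concat l with rfl | ⟨l', p, rfl⟩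
    · rw [hs] at hl; simp at hl; exact absurd hl.1.symm hwa
    · have hl' : L = l' ++ p :: w :: r := by simpa using hl
      have hN := hS.nodup
      have hpL : p ∈ L := by rw [hl']; simp
      have hx : ∀ y, Nx L y w ↔ y = p := by intro y; rw [hl'] at hN ⊢; exact nx_into hN
      have ha := (hS.adj _ _ ((hx p).2 rfl)).symm
      refine ⟨p, hS.sub _ hpL, ha, ?_, ?_⟩
      · intro h; exact (hS.kD _ _ (hS.sub _ hw) (hS.sub _ hpL) ha).1 h (Or.inr ((hx p).2 rfl))
      · intro u hu ha hne
        rw [hS.kD _ _ (hS.sub _ hw) hu ha]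
        rintro (h | h)
        · exact hwa h.1
        · exact hne ((hx u).1 h)

open Classical in
noncomputable def ed (x y u w : V) : ZMod 2 := if (u = x ∧ w = y) ∨ (u = y ∧ w = x) then 1 else 0

lemma ed_symm (x y u w : V) : ed x y u w = ed x y w u := by
  unfold ed; congr 1; rw [eq_iff_iff]; tauto

open Classical in
lemma ed_sum [Fintype V] {x y : V} (h : x ≠ y) (u : V) : ∑ w, ed x y u w = (if u = x then 1 else 0) + (if u = y then 1 else 0) := by
  have : ∀ w, ed x y u w = (if u = x then (if w = y then 1 else 0) else 0) + (if u = y then (if w = x then 1 else 0) else 0) := by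
    intro w; unfold ed; split_ifs <;> simp_all
  simp only [this, Finset.sum_add_distrib]
  split_ifs <;> simp

noncomputable def pathI : List V → V → V → ZMod 2
  | [], _, _ => 0
  | [_], _, _ => 0
  | a :: b :: t, u, w => ed a b u w + pathI (b :: t) u w

lemma pathI_symm (u w : V) : ∀ l : List V, pathI l u w = pathI l w u
  | [] => rfl
  | [_] => rfl
  | a :: b :: t => by rw [pathI, pathI, ed_symm, pathI_symm u w (b :: t)]

lemma pathI_zero {u w : V} : ∀ {l : List V}, ¬ Nx l u w → ¬ Nx l w u → pathI l u w = 0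
  | [], _, _ => rfl
  | [_], _, _ => rfl
  | a :: b :: t, h1, h2 => by
    simp only [Nx, not_or] at h1 h2
    rw [pathI, pathI_zero h1.2 h2.2, ed, if_neg, add_zero]
    rintro (h | h)
    · exact h1.1 h
    · exact h2.1 ⟨h.2, h.1⟩

open Classical in
lemma pathI_sum [Fintype V] (u y : V) : ∀ (x : V) (l : List V), (x :: (l ++ [y])).Nodup →
    ∑ w, pathI (x :: (l ++ [y])) u w = (if u = x then 1 else 0) + (if u = y then 1 else 0)
  | x, [], h => by
    simp only [List.nil_append, pathI, add_zero]
    exact ed_sum (by simpa using h) u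
  | x, z :: t, h => by
    have := pathI_sum u y z t (List.nodup_cons.1 h).2
    simp only [List.cons_append, pathI, Finset.sum_add_distrib]
    rw [this, ed_sum (by rintro rfl; simp at h)]
    have h2 := CharTwo.add_self_eq_zero (if u = z then (1 : ZMod 2) else 0)
    linear_combination h2

/-- noncrossing -/
lemma crossing [Fintype V] (hT : Tri G A) (hab : G.Adj a b)
    (hEx : ∀ (g : V → V → ZMod 2), (∀ x y, g x y = g y x) → (∀ x y, ¬ G.Adj x y → g x y = 0) → (∀ v, ∑ u, g v u = 0) →
    ∃ φ : V → V → ZMod 2, (∀ x y, G.Adj x y → φ x y = φ y (A x y)) ∧ ∀ x y, G.Adj x y → g x y = φ x y + φ y x)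
    (hS : St G A a b c K κ L) {l s r : List V} {x v y w : V} (hL : L = l ++ x :: v :: (s ++ y :: r))
    (hxy : G.Adj x y) (hw : w ∈ l ∨ w ∈ r) (hvw : G.Adj v w) : False := by
  classical
  have hN := hS.nodup
  rw [hL] at hN
  let C := x :: ((v :: s) ++ [y])
  have hLC : L = l ++ (C ++ r) := by simp [hL, C]
  have hNC : (C ++ r).Nodup := (List.nodup_append.1 (hLC ▸ hS.nodup)).2.1
  have hCN : C.Nodup := (List.nodup_append.1 hNC).1
  have hCL : ∀ z ∈ C, z ∈ L := fun z hz => by rw [hLC]; simp [hz]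
  have hwC : w ∉ C := by
    intro h
    rcases hw with hw | hw
    · exact List.disjoint_of_nodup_append (hLC ▸ hS.nodup) hw (by simp [h])
    · exact List.disjoint_of_nodup_append hNC h hw
  have hNxC : ∀ u z, Nx C u z → Nx L u z := by
    intro u z h
    rw [hL, nx_append]
    right
    have : x :: v :: (s ++ y :: r) = (x :: v :: s) ++ y :: r := by simp
    rw [this, nx_append]
    left; simpa [C] using h
  have hwL : w ∈ L := by rw [hLC]; simp; tauto
  have hvC : v ∈ C := by simp [C]
  have hxv : x ≠ v := by intro e; simp [C, e] at hCN
  have hyv : y ≠ v := by rintro rfl; simp [C] at hCN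
  let g : V → V → ZMod 2 := fun u z => pathI C u z + ed x y u z
  obtain ⟨φ, hφ1, hφ2⟩ := hEx g (fun u z => by simp only [g]; rw [pathI_symm, ed_symm]) (by
    intro u z h
    simp only [g]
    rw [pathI_zero, ed, if_neg, add_zero]
    · rintro (⟨rfl, rfl⟩ | ⟨rfl, rfl⟩)
      · exact h hxy
      · exact h hxy.symm
    · exact fun h' => h (hS.adj _ _ (hNxC _ _ h'))
    · exact fun h' => h (hS.adj _ _ (hNxC _ _ h')).symm) (by
    intro u
    simp only [g, Finset.sum_add_distrib]
    rw [pathI_sum u y x _ hCN, ed_sum hxy.ne]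
    exact CharTwo.add_self_eq_zero _)
  have hφ2' : ∀ u z, G.Adj u z → g u z = 0 → φ u z = φ z u := by
    intro u z h h'
    have := hφ2 u z h
    rw [h'] at this
    exact CharTwo.add_eq_zero.1 this.symm
  have hgC : ∀ u z, u ∉ C → g u z = 0 := by
    intro u z h
    simp only [g]
    rw [pathI_zero, ed, if_neg, add_zero]
    · rintro (⟨rfl, rfl⟩ | ⟨rfl, rfl⟩) <;> exact h (by simp [C])
    · exact fun h' => h h'.mem.1
    · exact fun h' => h h'.mem2
  have hoff := hS.R (fun u z => φ u z + φ c a) (fun u z h => by rw [hφ1 u z h]) (CharTwo.add_self_eq_zero _) (by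
    intro u z h h'
    rw [hφ2' u z h]
    by_cases hu : u ∈ K
    · have hz : z ∉ C := fun h2 => h' ⟨hu, hS.sub z (hCL z h2)⟩
      have := hgC z u hz
      simp only [g] at this ⊢
      rw [pathI_symm, ed_symm]; exact this
    · exact hgC u z (fun h2 => hu (hS.sub u (hCL u h2))))
  have hoff' : ∀ u z, G.Adj u z → ¬ κ u z → φ u z = φ c a := fun u z h h' => CharTwo.add_eq_zero.1 (hoff u z h h')
  -- at w
  obtain ⟨p, hpK, hwp, hkp, hfan⟩ := hS.prev hab hwL
  have e1 : ∀ u ∈ K, G.Adj w u → φ u w = φ c a := by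
    have := fan_ind hT hS hwp hfan (fun u => G.Adj w u → φ u w = φ c a) (fun h => by
      rw [← hφ2' w p h (hgC _ _ hwC)]; exact hoff' _ _ h hkp) (fun u hk hP hu => by
      rw [← hφ2' w u hu (hgC _ _ hwC), ← hP (hT.adj2 hu), hφ1 w u hu, hφ1 _ _ (hT.adj1 hu), hT.rot hu])
    exact fun u hu ha => this u hu ha ha
  -- at v
  obtain ⟨q, t, hq⟩ : ∃ q t, s ++ [y] = q :: t := by
    cases s with
    | nil => exact ⟨y, [], rfl⟩
    | cons q t => exact ⟨q, _, rfl⟩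
  have hC' : C = x :: v :: q :: t := by simp [C, ← hq]
  have hL2 : L = (l ++ [x]) ++ v :: q :: (t ++ r) := by rw [hLC, hC']; simp
  have hvL := hCL v hvC
  have hqC : q ∈ C := by rw [hC']; simp
  have hnx : ∀ u, Nx L u v ↔ u = x := fun u => by rw [hL]; exact nx_into hN
  have hnq : ∀ u, Nx L v u ↔ u = q := fun u => by
    have := hS.nodup; rw [hL2] at this ⊢; exact nx_from this
  have hva : v ≠ a := by
    rintro rfl
    obtain ⟨s', hs'⟩ := hS.ends
    exact nx_into_head (hs' ▸ hS.nodup) (hs' ▸ (hnx x).2 rfl)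
  have hvb : v ≠ b := by
    rintro rfl
    obtain ⟨s', hs'⟩ := hS.ends
    have hs2 : L = (a :: s') ++ [v] := by simpa using hs'
    exact nx_from_last (hs2 ▸ hS.nodup) (hs2 ▸ (hnq q).2 rfl)
  have hvx := (hS.adj _ _ ((hnx x).2 rfl)).symm
  have hvq := hS.adj _ _ ((hnq q).2 rfl)
  have hxq : x ≠ q := by rintro rfl; rw [hC'] at hCN; simp at hCN
  have gv : ∀ u, g v u = (if u = x then 1 else 0) + (if u = q then 1 else 0) := by
    intro u
    simp only [g]
    rw [hC', pathI, pathI, pathI_zero (l := q :: t), ed, ed, ed]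
    · simp [hxv.symm, hyv.symm]
      congr 2 
      simp; rintro rfl; exact absurd hvq.ne (by simp)
    · intro h; rw [hC'] at hCN; exact (List.nodup_cons.1 (List.nodup_cons.1 hCN).2).1 h.mem.1
    · intro h; rw [hC'] at hCN; exact (List.nodup_cons.1 (List.nodup_cons.1 hCN).2).1 h.mem2
  have e2 : ∀ u ∈ K, G.Adj v u → u ≠ q → φ u v = φ c a + 1 := by
    have := fan_ind hT hS hvx (fun u hu ha hne => by
      rw [hS.kD _ _ (hS.sub _ hvL) hu ha]
      rintro (h | h)
      · exact hva h.1
      · exact hne ((hnx u).1 h)) (fun u => G.Adj v u → u ≠ q → φ u v = φ c a + 1) (fun h h' => by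
      have h1 := hφ2 v x h
      rw [gv, if_pos rfl, if_neg hxq, hoff' v x h] at h1
      · have h2 := CharTwo.add_self_eq_zero (φ c a)
        linear_combination (-1 : ZMod 2) * h1 - h2
      · intro hk
        exact (hS.kD _ _ (hS.sub _ hvL) (hS.sub x (by rw [hL]; simp)) h).1 hk (Or.inr ((hnx x).2 rfl))) (fun u hk hP hu hne => by
      have hk2 := hS.krot _ _ (hS.krot _ _ hk)
      rw [hT.rot hu] at hk2
      have hne2 : A v u ≠ q := by
        intro e
        rw [e] at hk2
        exact (hS.kD _ _ (hS.kap _ _ hk2).2.1 (hS.sub _ hvL) hvq.symm).1 hk2 (Or.inr ((hnq q).2 rfl))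
      have hux : u ≠ x := by
        rintro rfl
        exact (hS.kD _ _ (hS.sub _ hvL) (hS.kap _ _ hk).2.2 hu).1 hk (Or.inr ((hnx u).2 rfl))
      rw [← hφ2' v u hu (by rw [gv, if_neg hux, if_neg hne, add_zero]), ← hP (hT.adj2 hu) hne2, hφ1 v u hu, hφ1 _ _ (hT.adj1 hu), hT.rot hu])
    exact fun u hu ha hne => this u hu ha ha hne
  have f1 := e1 v (hS.sub _ hvL) hvw.symm
  have f2 := e2 w (hS.sub _ hwL) hvw (by rintro rfl; exact hwC hqC)
  have f3 := hφ2' w v hvw.symm (hgC _ _ hwC)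
  rw [f3, f1] at f2
  simp at f2

end
end FixTri
namespace FixTri
variable {V : Type*} {G : SimpleGraph V} {A : V → V → V} {a b c : V} {K : Set V} {κ : V → V → Prop} {L : List V}

lemma St.inner (hS : St G A a b c K κ L) {l r : List V} {p v q : V} (hL : L = l ++ p :: v :: q :: r) :
    v ≠ a ∧ v ≠ b ∧ (∀ u, Nx L u v ↔ u = p) ∧ (∀ u, Nx L v u ↔ u = q) := by
  have hN := hS.nodup
  have hnx : ∀ u, Nx L u v ↔ u = p := fun u => by rw [hL] at hN ⊢; exact nx_into hN
  have hL2 : L = (l ++ [p]) ++ v :: q :: r := by rw [hL]; simp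
  have hnq : ∀ u, Nx L v u ↔ u = q := fun u => by rw [hL2] at hN ⊢; exact nx_from hN
  obtain ⟨s', hs'⟩ := hS.ends
  refine ⟨?_, ?_, hnx, hnq⟩
  · rintro rfl
    exact nx_into_head (hs' ▸ hS.nodup) (hs' ▸ (hnx p).2 rfl)
  · rintro rfl
    have hs2 : L = (a :: s') ++ [v] := by simpa using hs'
    exact nx_from_last (hs2 ▸ hS.nodup) (hs2 ▸ (hnq q).2 rfl)

lemma St.step (hT : Tri G A) (hS : St G A a b c K κ L) {l r : List V} {p v q : V}
    (hL : L = l ++ p :: v :: q :: r) (hch : ∀ w ∈ L, G.Adj v w → w = p ∨ w = q) :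
    ∃ mid κ', St G A a b c (K \ {v}) κ' (l ++ p :: (mid ++ q :: r)) ∧
      ∀ u ∈ K \ {v}, G.Adj v u ↔ u ∈ p :: (mid ++ [q]) := by
  classical
  obtain ⟨hva, hvb, hnx, hnq⟩ := hS.inner hL
  have hN := hS.nodup
  have hvL : v ∈ L := by rw [hL]; simp
  have hpL : p ∈ L := by rw [hL]; simp
  have hqL : q ∈ L := by rw [hL]; simp
  have hvK := hS.sub _ hvL
  have hpK := hS.sub _ hpL
  have hqK := hS.sub _ hqL
  have hvp : G.Adj v p := (hS.adj _ _ ((hnx p).2 rfl)).symm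
  have hvq : G.Adj v q := hS.adj _ _ ((hnq q).2 rfl)
  have hpq : p ≠ q := by
    rintro rfl
    rw [hL] at hN
    have := (List.nodup_append.1 hN).2.1
    simp at this
  have kv : ∀ u ∈ K, G.Adj v u → (κ v u ↔ u ≠ p) := by
    intro u hu ha
    rw [hS.kD _ _ hvK hu ha, hnx]
    simp [hva]
  have kv' : ∀ u ∈ K, G.Adj v u → (κ u v ↔ u ≠ q) := by
    intro u hu ha
    rw [hS.kD _ _ hu hvK ha.symm, hnq]
    simp [hvb]
  -- the fan list
  have hk : ∃ k, (fun u => A u v)^[k] p = q := by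
    obtain ⟨k, hk⟩ := hT.cyc hvq hvp
    refine ⟨k, ?_⟩
    have : ∀ k u, G.Adj v u → (fun u => A u v)^[k] ((A v)^[k] u) = u ∧ G.Adj v ((A v)^[k] u) := by
      intro k
      induction k with
      | zero => intro u hu; exact ⟨rfl, hu⟩
      | succ k ih =>
        intro u hu
        have h2 := ih (A v u) (hT.adj2 hu)
        rw [Function.iterate_succ_apply', Function.iterate_succ_apply, h2.1]
        exact ⟨hT.rot2 hu, h2.2⟩
    rw [← hk]; exact (this k q hvq).1
  obtain ⟨s, s1, s2, s3, s4⟩ := orbit_list (fun u => A u v) q (Nat.find hk) p (fun j hj => Nat.find_min hk hj) (Nat.find_spec hk)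
  obtain ⟨mid, rfl⟩ : ∃ mid, s = p :: mid := by
    cases s with
    | nil => simp at s2; exact absurd s2.symm hpq
    | cons z t => simp at s2; exact ⟨t, by rw [s2]⟩
  have hFe : p :: mid ++ [q] = p :: (mid ++ [q]) := rfl
  rw [hFe] at s1 s2 s3 s4
  have hq_nin : q ∉ p :: mid := by
    intro h
    exact List.disjoint_of_nodup_append (l₁ := p :: mid) (l₂ := [q]) (by simpa using s1) h (by simp)
  have hF1 : ∀ u, u ∈ p :: (mid ++ [q]) → u ∈ K ∧ G.Adj v u := by
    intro u hu
    obtain ⟨j, hj, rfl⟩ := (s3 u).1 hu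
    clear hu
    induction j with
    | zero => exact ⟨hpK, hvp⟩
    | succ j ih =>
      have h1 := ih (by omega)
      have h2 := (kv' _ h1.1 h1.2).2 (Nat.find_min hk (by omega))
      rw [Function.iterate_succ_apply']
      exact ⟨(hS.kap _ _ (hS.krot _ _ h2)).2.2, hT.adj1 h1.2.symm⟩
  have hF2 : ∀ u ∈ K, G.Adj v u → u ∈ p :: (mid ++ [q]) := by
    have := fan_ind hT hS hvp (fun u hu ha hne => (kv u hu ha).2 hne) (fun u => u ∈ p :: (mid ++ [q])) (by simp) (by
      intro u hk1 h
      obtain ⟨j, hj, e⟩ := (s3 _).1 h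
      have hu := (hS.kap _ _ hk1).1
      have hk2 := hS.krot _ _ (hS.krot _ _ hk1)
      rw [hT.rot hu] at hk2
      have hne := (kv' _ (hS.kap _ _ hk2).2.1 (hT.adj2 hu)).1 hk2
      have hj' : j ≠ Nat.find hk := by
        rintro rfl
        rw [Nat.find_spec hk] at e
        exact hne e.symm
      refine (s3 u).2 ⟨j + 1, by omega, ?_⟩
      rw [Function.iterate_succ_apply', e]
      exact hT.rot2 hu)
    exact this
  have hvF : v ∉ p :: (mid ++ [q]) := fun h => (hF1 v h).2.ne rfl
  have hNL : ∀ x y, Nx L x y ↔ Nx (l ++ [p]) x y ∨ ((x = p ∧ y = v) ∨ (x = v ∧ y = q)) ∨ Nx (q :: r) x y := by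
    intro x y
    rw [hL, nx_append]
    simp only [Nx, or_assoc]
  have hNL' : ∀ x y, Nx (l ++ p :: (mid ++ q :: r)) x y ↔ Nx (l ++ [p]) x y ∨ (x ∈ p :: mid ∧ y = A x v) ∨ Nx (q :: r) x y := by
    intro x y
    rw [nx_append, ← s4 y x]
    have := nx_append q r x y (p :: mid)
    simp only [List.cons_append] at this
    rw [this]
  have hvl : v ∉ l ++ [p] := by
    have : ((l ++ [p]) ++ v :: q :: r).Nodup := by rw [hL] at hN; simpa using hN
    exact fun h => List.disjoint_of_nodup_append this h (by simp)
  have hvr : v ∉ q :: r := by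
    rw [hL] at hN
    exact (List.nodup_cons.1 (List.nodup_cons.1 (List.nodup_append.1 hN).2.1).2).1
  have hmem : ∀ x, x ∈ l ++ p :: (mid ++ q :: r) ↔ (x ∈ L ∧ x ≠ v) ∨ x ∈ mid := by
    intro x
    have h1 : x ∈ l ++ [p] → x ≠ v := fun h e => hvl (e ▸ h)
    have h2 : x ∈ q :: r → x ≠ v := fun h e => hvr (e ▸ h)
    rw [hL]
    simp only [List.mem_append, List.mem_cons, List.not_mem_nil, or_false] at h1 h2 ⊢
    tauto
  have hmidF : ∀ x ∈ mid, x ∈ p :: (mid ++ [q]) := fun x hx => by simp [hx]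
  have hmidL : ∀ x ∈ mid, x ∉ L := by
    intro x hx hxL
    rcases hch x hxL (hF1 x (hmidF x hx)).2 with rfl | rfl
    · exact (List.nodup_cons.1 s1).1 (by simp [hx])
    · exact hq_nin (by simp [hx])
  have hFmem : ∀ x ∈ p :: (mid ++ [q]), x ∈ l ++ p :: (mid ++ q :: r) := by
    intro x hx; simp only [List.mem_append, List.mem_cons, List.not_mem_nil, or_false] at hx ⊢; tauto
  refine ⟨mid, fun x y => κ x y ∧ x ≠ v ∧ y ≠ v ∧ A x y ≠ v, ⟨?_, ?_, ?_, ?_, ?_, ?_, ?_, ?_, ?_⟩, ?_⟩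
  · -- nodup
    have p1 : (l ++ p :: (mid ++ q :: r)).Perm (mid ++ (l ++ p :: q :: r)) := by
      have : (l ++ [p] ++ (mid ++ q :: r)).Perm (mid ++ (l ++ [p] ++ q :: r)) := by
        rw [← List.append_assoc, ← List.append_assoc]
        exact List.Perm.append_right _ List.perm_append_comm
      simpa using this
    rw [p1.nodup_iff, List.nodup_append]
    refine ⟨?_, ?_, ?_⟩
    · exact (List.nodup_append.1 (List.nodup_cons.1 s1).2).1
    · rw [hL] at hN
      refine List.Nodup.sublist ?_ hN
      exact List.Sublist.append_left (List.Sublist.cons_cons _ (List.sublist_cons_self _ _)) _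
    · intro x hx y hy e
      subst e
      apply hmidL x hx
      rw [hL]; simp only [List.mem_append, List.mem_cons] at hy ⊢; tauto
  · intro x hx
    rcases (hmem x).1 hx with h | h
    · exact ⟨hS.sub _ h.1, h.2⟩
    · have := hF1 x (hmidF x h)
      exact ⟨this.1, this.2.ne'⟩
  · obtain ⟨t, ht⟩ := hS.ends
    have hl0 : ∃ l', l ++ [p] = a :: l' := by
      cases l with
      | nil => rw [hL] at ht; simp at ht; exact ⟨[], by simp [ht.1]⟩
      | cons z l' => rw [hL] at ht; simp at ht; exact ⟨l' ++ [p], by simp [ht.1]⟩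
    have hr0 : ∃ r', q :: r = r' ++ [b] := by
      have e1 := hL.symm.trans ht
      rcases List.eq_nil_or_concat r with rfl | ⟨r', z, rfl⟩
      · have e2 : l ++ p :: v :: [q] = (l ++ p :: [v]) ++ [q] := by simp
        have e3 : a :: (t ++ [b]) = (a :: t) ++ [b] := rfl
        rw [e2, e3] at e1
        have e4 := (List.append_inj' e1 rfl).2
        simp at e4
        exact ⟨[], by simp [e4]⟩
      · have e2 : l ++ p :: v :: q :: (r'.concat z) = (l ++ p :: v :: q :: r') ++ [z] := by simp
        have e3 : a :: (t ++ [b]) = (a :: t) ++ [b] := rfl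
        rw [e2, e3] at e1
        have e4 := (List.append_inj' e1 rfl).2
        simp at e4
        exact ⟨q :: r', by simp [e4]⟩
    obtain ⟨l', hl'⟩ := hl0
    obtain ⟨r', hr'⟩ := hr0
    refine ⟨l' ++ (mid ++ r'), ?_⟩
    have : l ++ p :: (mid ++ q :: r) = (l ++ [p]) ++ (mid ++ q :: r) := by simp
    rw [this, hl', hr']; simp
  · intro x y h
    rcases (hNL' x y).1 h with h | ⟨h1, rfl⟩ | h
    · exact hS.adj _ _ ((hNL x y).2 (Or.inl h))
    · exact hT.adj2 (hF1 x (by simp only [List.mem_append, List.mem_cons] at h1 ⊢; tauto)).2.symm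
    · exact hS.adj _ _ ((hNL x y).2 (Or.inr (Or.inr h)))
  · rintro x y ⟨h1, h2, h3, h4⟩
    have := hS.kap _ _ h1
    exact ⟨this.1, ⟨this.2.1, h2⟩, ⟨this.2.2, h3⟩⟩
  · rintro x y ⟨h1, h2, h3, h4⟩
    refine ⟨hS.krot _ _ h1, h3, h4, ?_⟩
    rw [hT.rot (hS.kap _ _ h1).1]; exact h2
  · rintro x y ⟨hx, hxv⟩ ⟨hy, hyv⟩ hxy
    simp only [Set.mem_singleton_iff] at hxv hyv
    have e1 : A x y = v → (x ∈ K ∧ κ x y → y ∈ p :: mid ∧ x = A y v) := by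
      rintro e ⟨-, hk1⟩
      have hk2 := hS.krot _ _ hk1
      rw [e] at hk2
      have ha := (hS.kap _ _ hk2).1.symm
      have h1 := hF2 y hy ha
      have h2 := (kv' y hy ha).1 hk2
      have h3 := hT.rot hxy
      rw [e] at h3
      refine ⟨?_, h3.symm⟩
      simp only [List.mem_append, List.mem_cons, List.not_mem_nil, or_false] at h1 ⊢; tauto
    have e2 : (y ∈ p :: mid ∧ x = A y v) → A x y = v := by
      rintro ⟨h1, rfl⟩
      exact hT.rot2 (hF1 y (by simp only [List.mem_append, List.mem_cons] at h1 ⊢; tauto)).2.symm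
    rw [hS.kD x y hx hy hxy, hNL, hNL']
    have e1' := hS.kD x y hx hy hxy
    rw [hNL] at e1'
    constructor
    · rintro ⟨h1, -, -, h2⟩ (h | h | h | h)
      · exact h1 (Or.inl h)
      · exact h1 (Or.inr (Or.inl h))
      · exact h2 (e2 h)
      · exact h1 (Or.inr (Or.inr (Or.inr h)))
    · intro h
      have h1 : κ x y := by
        rw [e1']
        rintro (h' | h' | h' | h')
        · exact h (Or.inl h')
        · exact h (Or.inr (Or.inl h'))
        · rcases h' with h' | h'
          · exact hxv h'.2
          · exact hyv h'.1
        · exact h (Or.inr (Or.inr (Or.inr h')))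
      refine ⟨e1'.1 h1, hxv, hyv, fun e => ?_⟩
      exact h (Or.inr (Or.inr (Or.inl (e1 e ⟨hx, h1⟩))))
  · rintro x ⟨hx, hxv⟩ hxL y hxy
    simp only [Set.mem_singleton_iff] at hxv
    rw [hmem, not_or, not_and_or] at hxL
    have hxL' : x ∉ L := by tauto
    refine ⟨hS.nc x hx hxL' y hxy, ?_⟩
    rintro rfl
    have := (hmem x).1 (hFmem x (hF2 x hx hxy.symm))
    tauto
  · intro φ h1 h2 h3
    have h4 := hS.R φ h1 h2 (fun x y hxy hK => h3 x y hxy (fun h => hK ⟨h.1.1, h.2.1⟩))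
    have sv : ∀ u, G.Adj v u → φ v u = φ u v := fun u hu => h3 v u hu (fun h => h.1.2 rfl)
    have hz : ∀ u ∈ K, G.Adj v u → φ u v = 0 := by
      have := fan_ind hT hS hvp (fun u hu ha hne => (kv u hu ha).2 hne) (fun u => φ u v = 0) (by
        rw [← sv p hvp]
        exact h4 _ _ hvp (fun h => (kv p hpK hvp).1 h rfl)) (by
        intro u hk1 h
        have hu := (hS.kap _ _ hk1).1
        rw [← sv u hu, h1 _ _ hu, h1 _ _ (hT.adj1 hu), hT.rot hu]; exact h)
      exact this
    intro x y hxy hk1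
    by_cases hk2 : κ x y
    · have hK := hS.kap _ _ hk2
      by_cases hx : x = v
      · subst hx; rw [sv y hxy]; exact hz y hK.2.2 hxy
      by_cases hy : y = v
      · subst hy; exact hz x hK.2.1 hxy.symm
      by_cases hA : A x y = v
      · rw [h1 _ _ hxy, hA]
        refine hz y hK.2.2 ?_
        rw [← hA]; exact (hT.adj1 hxy).symm
      · exact absurd ⟨hk2, hx, hy, hA⟩ hk1
    · exact h4 _ _ hxy hk2
  · rintro u ⟨hu, huv⟩
    exact ⟨hF2 u hu, fun h => (hF1 u h).2⟩

end FixTri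
namespace FixTri
variable {V : Type*} {G : SimpleGraph V} {A : V → V → V} {a b c : V}

lemma shell_end (hT : Tri G A) (hc : G.Connected) (hab : G.Adj a b) {K : Set V} {κ : V → V → Prop}
    (hS : St G A a b c K κ [a, b]) : K = {a, b} := by
  have haK : a ∈ K := hS.sub a (by simp)
  have hbK : b ∈ K := hS.sub b (by simp)
  have ka : ∀ u ∈ K, G.Adj a u → u = b := by
    by_contra hcon
    push Not at hcon
    obtain ⟨u, hu, ha, hne⟩ := hcon
    have h := fan_ind hT hS hab (fun u hu ha hne => by
      rw [hS.kD a u haK hu ha]; simp [Nx, hne, hab.ne]) (fun u => u = b) rfl (by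
      rintro u hk h
      have hu := (hS.kap _ _ hk).1
      have hk2 := hS.krot _ _ (hS.krot _ _ hk)
      rw [hT.rot hu, h] at hk2
      exact absurd (Or.inr (by simp [Nx])) ((hS.kD b a hbK haK hab.symm).1 hk2)) u hu ha
    exact hne h
  have kb : ∀ u ∈ K, G.Adj b u → u = a := by
    by_contra hcon
    push Not at hcon
    obtain ⟨u, hu, ha, hne⟩ := hcon
    have h := fan_ind hT hS hab.symm (fun u hu ha hne => by
      rw [hS.kD b u hbK hu ha]; simp [Nx, hne, hab.ne']) (fun u => u = a) rfl (by
      rintro u hk h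
      have hu := (hS.kap _ _ hk).1
      have hk2 := hS.krot _ _ (hS.krot _ _ hk)
      rw [hT.rot hu, h] at hk2
      exact absurd (Or.inl (by simp)) ((hS.kD a b haK hbK hab).1 hk2)) u hu ha
    exact hne h
  ext x
  simp only [Set.mem_insert_iff, Set.mem_singleton_iff]
  constructor
  · intro hx
    by_contra hne
    push Not at hne
    have : ∀ w, G.Reachable x w → w ∈ K ∧ w ≠ a ∧ w ≠ b := by
      intro w hw
      rw [SimpleGraph.reachable_iff_reflTransGen] at hw
      induction hw with
      | refl => exact ⟨hx, hne⟩
      | @tail y z _ hyz ih =>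
        have hz := hS.nc y ih.1 (by simp [ih.2]) z hyz
        refine ⟨hz, ?_, ?_⟩
        · rintro rfl; exact ih.2.2 (ka y ih.1 hyz.symm)
        · rintro rfl; exact ih.2.1 (kb y ih.1 hyz.symm)
    exact (this a (hc.preconnected x a)).2.1 rfl
  · rintro (rfl | rfl) <;> assumption

theorem shelling [Fintype V] (hT : Tri G A) (hc : G.Connected) (hab : G.Adj a b)
    (hEx : ∀ (g : V → V → ZMod 2), (∀ x y, g x y = g y x) → (∀ x y, ¬ G.Adj x y → g x y = 0) → (∀ v, ∑ u, g v u = 0) →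
    ∃ φ : V → V → ZMod 2, (∀ x y, G.Adj x y → φ x y = φ y (A x y)) ∧ ∀ x y, G.Adj x y → g x y = φ x y + φ y x) :
    ∀ (n : ℕ) (K : Set V) (κ : V → V → Prop) (L : List V), K.ncard = n → St G A a b c K κ L → Build G a b K L := by
  classical
  intro n
  induction n using Nat.strong_induction_on with
  | _ n ih =>
  intro K κ L hn hS
  obtain ⟨s0, hs0⟩ := hS.ends
  cases s0 with
  | nil =>
    simp only [List.nil_append] at hs0
    subst hs0
    rw [shell_end hT hc hab hS]
    exact Build.base hab
  | cons v0 s0 =>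
    have hex : ∃ k, ∃ l x v s y r, L = l ++ x :: v :: (s ++ y :: r) ∧ G.Adj x y ∧ s.length = k :=
      ⟨_, [], a, v0, s0, b, [], by simpa using hs0, hab, rfl⟩
    obtain ⟨l, x, v, s, y, r, hL, hxy, hlen⟩ := Nat.find_spec hex
    obtain ⟨q, t, hq⟩ : ∃ q t, s ++ [y] = q :: t := by
      cases s with
      | nil => exact ⟨y, [], rfl⟩
      | cons q t => exact ⟨q, _, rfl⟩
    have hL2 : L = l ++ x :: v :: q :: (t ++ r) := by
      have : s ++ y :: r = (s ++ [y]) ++ r := by simp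
      rw [hL, this, hq]; simp
    obtain ⟨mid, κ', hS', hnb⟩ := hS.step hT hL2 (by
      intro w hw hvw
      have hw' : w ∈ l ∨ w = x ∨ w = v ∨ w ∈ s ++ [y] ∨ w ∈ r := by
        rw [hL] at hw; simp at hw ⊢; tauto
      rcases hw' with h | h | h | h | h
      · exact (crossing hT hab hEx hS hL hxy (Or.inl h) hvw).elim
      · exact Or.inl h
      · exact absurd h hvw.ne'
      · rw [hq, List.mem_cons] at h
        rcases h with h | h
        · exact Or.inr h
        · exfalso
          obtain ⟨t1, t2, rfl⟩ := List.append_of_mem h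
          have hl := congrArg List.length hq
          simp at hl
          refine Nat.find_min hex (m := t1.length) (by omega) ⟨l ++ [x], v, q, t1, w, t2 ++ r, ?_, hvw, rfl⟩
          rw [hL2]; simp
      · exact (crossing hT hab hEx hS hL hxy (Or.inr h) hvw).elim)
    have hvK : v ∈ K := hS.sub v (by rw [hL]; simp)
    have hb := ih (K \ {v}).ncard (by
      rw [← hn]; exact Set.ncard_sdiff_singleton_lt_of_mem hvK (Set.toFinite K)) _ _ _ rfl hS'
    have := Build.step _ l x mid q (t ++ r) v hb (by simp) hnb
    rw [hL2]
    have e : insert v (K \ {v}) = K := by ext z; by_cases h : z = v <;> simp [h, hvK]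
    rwa [e] at this

theorem build_main [Fintype V] (hT : Tri G A) (hc : G.Connected) (hn : 3 ≤ Fintype.card V)
    (hE : G.edgeSet.ncard = 3 * Fintype.card V - 6) (c a : V) (hca : G.Adj c a) :
    ∃ b, Build G a b Set.univ [a, c, b] := by
  have h1 := hT.adj1 hca
  have h2 := hT.adj2 hca
  refine ⟨A c a, shelling (c := c) hT hc h1 (fun g => exactness hT hc hn hE g) _ _
    (fun x y => G.Adj x y ∧ ¬ (x = c ∧ y = a) ∧ ¬ (x = a ∧ y = A c a) ∧ ¬ (x = A c a ∧ y = c)) _ rfl ?_⟩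
  refine ⟨?_, by simp, ⟨[c], rfl⟩, ?_, ?_, ?_, ?_, by simp, ?_⟩
  · simp [hca.ne', h1.ne, h2.ne]
  · simp only [Nx]
    rintro x y (⟨rfl, rfl⟩ | ⟨rfl, rfl⟩ | h)
    · exact hca.symm
    · exact h2
    · exact h.elim
  · rintro x y ⟨h, -⟩; simp [h]
  · rintro x y ⟨h, n1, n2, n3⟩
    have r1 := hT.rot h
    have r2 := hT.rot2 h
    refine ⟨hT.adj1 h, ?_, ?_, ?_⟩
    · rintro ⟨rfl, e⟩; rw [e] at r1; exact n3 ⟨r1.symm, rfl⟩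
    · rintro ⟨rfl, e⟩; rw [e, hT.rot hca] at r1; exact n1 ⟨r1.symm, rfl⟩
    · rintro ⟨rfl, e⟩; rw [e, hT.rot2 hca] at r1; exact n2 ⟨r1.symm, rfl⟩
  · intro x y _ _ h
    simp only [Nx]
    tauto
  · intro φ g1 g2 _ x y h hk
    have g3 := g1 c a hca
    have g4 := g1 _ _ h1
    rw [hT.rot hca] at g4
    have : (x = c ∧ y = a) ∨ (x = a ∧ y = A c a) ∨ (x = A c a ∧ y = c) := by tauto
    rcases this with ⟨rfl, rfl⟩ | ⟨rfl, rfl⟩ | ⟨rfl, rfl⟩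
    · exact g2
    · rw [← g3]; exact g2
    · rw [← g4, ← g3]; exact g2

end FixTri
namespace FixTri
section vec
variable {V : Type*} {M : Type*} [AddCommGroup M] [PartialOrder M] [IsOrderedAddMonoid M]

lemma le1 {a b c d : M} (h : c ≤ d) (e : b - a = d - c) : a ≤ b := by
  rw [← sub_nonneg] at h ⊢; rwa [e]
lemma le2 {a b c d c' d' : M} (h : c ≤ d) (h' : c' ≤ d') (e : b - a = (d - c) + (d' - c')) : a ≤ b := by
  rw [← sub_nonneg] at h h' ⊢; rw [e]; exact add_nonneg h h'
lemma le3 {a b c d c' d' c'' d'' : M} (h : c ≤ d) (h' : c' ≤ d') (h'' : c'' ≤ d'')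
    (e : b - a = (d - c) + (d' - c') + (d'' - c'')) : a ≤ b := by
  rw [← sub_nonneg] at h h' h'' ⊢; rw [e]; exact add_nonneg (add_nonneg h h') h''
lemma lt1 {a b c d : M} (h : c < d) (e : b - a = d - c) : a < b := by
  rw [← sub_pos] at h ⊢; rwa [e]
lemma lt2 {a b c d c' d' : M} (h : c ≤ d) (h' : c' < d') (e : b - a = (d - c) + (d' - c')) : a < b := by
  rw [← sub_nonneg] at h; rw [← sub_pos] at h' ⊢; rw [e]; exact add_pos_of_nonneg_of_pos h h'

def Dn (G : SimpleGraph V) (K : Set V) (x2 x3 : V → M) (u w : V) : Prop :=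
  u ∈ K ∧ w ∈ K ∧ G.Adj u w ∧ x2 w < x2 u ∧ x3 w < x3 u

def Dm (x2 x3 : V → M) (x y z : V) : Prop :=
  (x2 x < x2 z ∧ x2 y < x2 z) ∨ (x3 x < x3 z ∧ x3 y < x3 z) ∨ (x2 z + x3 z < x2 x + x3 x ∧ x2 z + x3 z < x2 y + x3 y)

def IC (g x2 x3 : V → M) (x y P Q : V) : Prop :=
  (x3 x ≤ x3 P ∧ x3 y ≤ x3 P) ∨ (x2 x ≤ x2 Q ∧ x2 y ≤ x2 Q) ∨
    (x2 Q + x3 P + g Q - g P ≤ x2 x + x3 x ∧ x2 Q + x3 P + g Q - g P ≤ x2 y + x3 y)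

lemma Dm.swap {x2 x3 : V → M} {x y z : V} (h : Dm x2 x3 x y z) : Dm x2 x3 y x z := by
  unfold Dm at *; tauto
lemma IC.swap {g x2 x3 : V → M} {x y P Q : V} (h : IC g x2 x3 x y P Q) : IC g x2 x3 y x P Q := by
  unfold IC at *; tauto

structure Good (G : SimpleGraph V) (a b : V) (K S : Set V) (B : M) (g x2 x3 : V → M) : Prop where
  sub : S ⊆ K
  nn : ∀ x ∈ K, 0 ≤ x2 x ∧ 0 ≤ x3 x ∧ x2 x + x3 x ≤ B
  P : ∀ P ∈ S, ∀ Q ∈ S, g P ≤ g Q → x2 Q + g Q ≤ x2 P + g P ∧ x3 P - g P ≤ x3 Q - g Q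
  J : ∀ z ∈ K, ∃ w ∈ S, (w = a ∨ w = b → z = w) ∧ Relation.ReflTransGen (Dn G K x2 x3) z w
  I : ∀ x ∈ K, ∀ y ∈ K, G.Adj x y → ∀ P ∈ S, ∀ Q ∈ S, g P < g Q → IC g x2 x3 x y P Q
  D : ∀ x ∈ K, ∀ y ∈ K, G.Adj x y → ∀ z ∈ K, z ≠ x → z ≠ y → Dm x2 x3 x y z

lemma chain_strict {G : SimpleGraph V} {K : Set V} {x2 x3 : V → M} {z w : V}
    (h : Relation.ReflTransGen (Dn G K x2 x3) z w) : z = w ∨ (x2 w < x2 z ∧ x3 w < x3 z) := by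
  induction h with
  | refl => exact Or.inl rfl
  | tail _ hbc ih =>
    right
    rcases ih with rfl | ih
    · exact hbc.2.2.2
    · exact ⟨hbc.2.2.2.1.trans ih.1, hbc.2.2.2.2.trans ih.2⟩

lemma Good.congr {G : SimpleGraph V} {a b : V} {K S : Set V} {B : M} {g x2 x3 X2 X3 : V → M}
    (h : Good G a b K S B g x2 x3) (h2 : ∀ x ∈ K, X2 x = x2 x) (h3 : ∀ x ∈ K, X3 x = x3 x) :
    Good G a b K S B g X2 X3 where
  sub := h.sub
  nn x hx := by rw [h2 x hx, h3 x hx]; exact h.nn x hx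
  P P hP Q hQ := by rw [h2 _ (h.sub hP), h2 _ (h.sub hQ), h3 _ (h.sub hP), h3 _ (h.sub hQ)]; exact h.P P hP Q hQ
  J z hz := by
    obtain ⟨w, hw, h4, h5⟩ := h.J z hz
    refine ⟨w, hw, h4, Relation.ReflTransGen.mono (r := Dn G K x2 x3) ?_ _ _ h5⟩
    rintro x y ⟨a1, a2, a3, a4, a5⟩
    refine ⟨a1, a2, a3, ?_, ?_⟩
    · rw [h2 _ a1, h2 _ a2]; exact a4
    · rw [h3 _ a1, h3 _ a2]; exact a5
  I x hx y hy hxy P hP Q hQ hPQ := by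
    have := h.I x hx y hy hxy P hP Q hQ hPQ
    unfold IC at *
    rw [h2 _ hx, h2 _ hy, h3 _ hx, h3 _ hy, h2 _ (h.sub hQ), h3 _ (h.sub hP)]; exact this
  D x hx y hy hxy z hz hzx hzy := by
    have := h.D x hx y hy hxy z hz hzx hzy
    unfold Dm at *
    rw [h2 _ hx, h2 _ hy, h3 _ hx, h3 _ hy, h2 _ hz, h3 _ hz]; exact this

lemma step_vec {G : SimpleGraph V} {a b : V} {K Lo Mi Hi : Set V} {B T : M} {g g' E x2 x3 : V → M} {v p q : V}
    (hG : Good G a b K (Lo ∪ Mi ∪ Hi) B g x2 x3) (hv : v ∉ K) (ha : a ∈ K) (hb : b ∈ K)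
    (hpL : p ∈ Lo) (hqH : q ∈ Hi)
    (hN : ∀ u ∈ K, G.Adj v u ↔ u = p ∨ u ∈ Mi ∨ u = q)
    (hLo : ∀ x ∈ Lo, g x = g' x ∧ g' x ≤ g' p) (hHi : ∀ x ∈ Hi, g x = g' x + T ∧ g' q ≤ g' x)
    (hMi : ∀ x ∈ Mi, g x = g' v + E x ∧ 0 < E x ∧ E x < T) (hT : 0 < T) (gpv : g' p < g' v) (gvq : g' v < g' q)
    (htot : ∀ x ∈ Lo ∪ Mi ∪ Hi, ∀ y ∈ Lo ∪ Mi ∪ Hi, g x < g y ∨ x = y ∨ g y < g x)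
    (hx2 : x2 v = x2 q + g' q - g' v) (hx3 : x3 v = x3 p + g' v - g' p) :
    Good G a b (insert v K) (Lo ∪ {v} ∪ Hi) B g' x2 x3 := by
  have sLo : ∀ x ∈ Lo, x ∈ Lo ∪ Mi ∪ Hi := fun x h => Or.inl (Or.inl h)
  have sMi : ∀ x ∈ Mi, x ∈ Lo ∪ Mi ∪ Hi := fun x h => Or.inl (Or.inr h)
  have sHi : ∀ x ∈ Hi, x ∈ Lo ∪ Mi ∪ Hi := fun x h => Or.inr h
  have hp := sLo p hpL
  have hq := sHi q hqH
  have gp := (hLo p hpL).1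
  have gq := (hHi q hqH).1
  have hA : ∀ w ∈ Lo ∪ Mi, g w < g' v + T := by
    rintro w (h | h)
    · rw [(hLo w h).1]
      exact lt2 hT.le ((hLo w h).2.trans_lt gpv) (by abel)
    · rw [(hMi w h).1]
      exact lt1 (hMi w h).2.2 (by abel)
  have hA' : ∀ w ∈ Lo ∪ Mi, g w < g q := fun w h => (hA w h).trans (by rw [gq]; exact lt1 gvq (by abel))
  have hB : ∀ w ∈ Mi ∪ Hi, g' v < g w := by
    rintro w (h | h)
    · rw [(hMi w h).1]; exact lt1 (hMi w h).2.1 (by abel)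
    · rw [(hHi w h).1]; exact lt2 hT.le (gvq.trans_le (hHi w h).2) (by abel)
  have hB' : ∀ w ∈ Mi ∪ Hi, g p < g w := fun w h => by rw [gp]; exact gpv.trans (hB w h)
  have hHq : ∀ w ∈ Hi, g q ≤ g w := fun w h => by rw [gq, (hHi w h).1]; exact le1 (hHi w h).2 (by abel)
  have hLp : ∀ w ∈ Lo, g w ≤ g p := fun w h => by rw [gp, (hLo w h).1]; exact (hLo w h).2
  have F1 : ∀ w ∈ Lo ∪ Mi, x2 v < x2 w := fun w h => by
    have h1 := (hG.P w (Or.inl h) q hq (hA' w h).le).1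
    rw [gq] at h1; rw [hx2]
    exact lt2 h1 (hA w h) (by abel)
  have F2 : ∀ w ∈ Mi ∪ Hi, x3 v < x3 w := fun w h => by
    have h1 := (hG.P p hp w (by rcases h with h | h; exacts [sMi w h, sHi w h]) (hB' w h).le).2
    rw [gp] at h1; rw [hx3]
    exact lt2 h1 (hB w h) (by abel)
  have F1q : x2 q < x2 v := by rw [hx2]; exact lt1 gvq (by abel)
  have F2p : x3 p < x3 v := by rw [hx3]; exact lt1 gpv (by abel)
  have cLv : ∀ P ∈ Lo, g' P < g' v := fun P h => (hLo P h).2.trans_lt gpv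
  have cvH : ∀ Q ∈ Hi, g' v < g' Q := fun Q h => gvq.trans_le (hHi Q h).2
  have cLH : ∀ P ∈ Lo, ∀ Q ∈ Hi, g' P < g' Q := fun P h Q h' => (cLv P h).trans (cvH Q h')
  have cLH' : ∀ P ∈ Lo, ∀ Q ∈ Hi, g P < g Q := fun P h Q h' => (hA' P (Or.inl h)).trans_le (hHq Q h')
  -- neighbours
  have nb : ∀ u ∈ K, G.Adj v u → u ∈ Lo ∪ Mi ∪ Hi ∧ g p ≤ g u ∧ g u ≤ g q := by
    intro u hu ha
    rcases (hN u hu).1 ha with rfl | h | rfl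
    · exact ⟨hp, le_rfl, (hA' u (Or.inl hpL)).le⟩
    · exact ⟨sMi u h, (hB' u (Or.inl h)).le, (hA' u (Or.inr h)).le⟩
    · exact ⟨hq, (hA' p (Or.inl hpL)).le, le_rfl⟩
  -- sums of neighbours
  have nsum : ∀ u ∈ K, G.Adj v u → ∀ P ∈ Lo, ∀ Q ∈ Hi, x2 Q + x3 P + g Q - g P ≤ x2 u + x3 u := by
    intro u hu ha P hP Q hQ
    obtain ⟨h1, h2, h3⟩ := nb u hu ha
    have e1 := (hG.P u h1 Q (sHi Q hQ) (h3.trans (hHq Q hQ))).1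
    have e2 := (hG.P P (sLo P hP) u h1 ((hLp P hP).trans h2)).2
    exact le2 e1 e2 (by abel)
  have vsum : ∀ P ∈ Lo, ∀ Q ∈ Hi, x2 Q + x3 P + g' Q - g' P ≤ x2 v + x3 v := by
    intro P hP Q hQ
    have e1 := (hG.P q hq Q (sHi Q hQ) (hHq Q hQ)).1
    have e2 := (hG.P P (sLo P hP) p hp (hLp P hP)).2
    rw [gq, (hHi Q hQ).1] at e1
    rw [gp, (hLo P hP).1] at e2
    rw [hx2, hx3]
    exact le2 e1 e2 (by abel)
  have gmono : ∀ P ∈ Lo, ∀ Q ∈ Hi, ∀ s t, s + g Q - g P ≤ t → s + g' Q - g' P ≤ t := by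
    intro P hP Q hQ s t h
    rw [(hLo P hP).1, (hHi Q hQ).1] at h
    exact le2 h hT.le (by abel)
  have pv : ∀ P ∈ Lo, x2 v + x3 P + g' v - g' P = x2 q + x3 P + g' q - g' P := by
    intro P hP; rw [hx2]; abel
  have vp : ∀ Q ∈ Hi, x2 Q + x3 v + g' Q - g' v = x2 Q + x3 p + g' Q - g' p := by
    intro P hP; rw [hx3]; abel
  -- domination of z over a new edge
  have newD : ∀ u ∈ K, G.Adj v u → ∀ z ∈ K, z ≠ u → Dm x2 x3 v u z := by
    intro u hu hvu z hz hzu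
    obtain ⟨h1, h2, h3⟩ := nb u hu hvu
    obtain ⟨w, hw, -, hch⟩ := hG.J z hz
    have hst := chain_strict hch
    have hle : x2 w ≤ x2 z ∧ x3 w ≤ x3 z := by
      rcases hst with rfl | h
      · exact ⟨le_rfl, le_rfl⟩
      · exact ⟨h.1.le, h.2.le⟩
    rcases htot w hw u h1 with h | rfl | h
    · left
      have hwL : w ∈ Lo ∪ Mi := by
        rcases hw with hw | hw
        · exact hw
        · exact absurd (h.trans_le h3) (hHq w hw).not_gt
      exact ⟨(F1 w hwL).trans_le hle.1, (lt2 (hG.P w hw u h1 h.le).1 h (by abel)).trans_le hle.1⟩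
    · have hst' : x2 w < x2 z ∧ x3 w < x3 z := by
        rcases hst with h | h
        · exact absurd h hzu
        · exact h
      rcases (hN w hu).1 hvu with rfl | h | rfl
      · exact Or.inl ⟨(F1 w (Or.inl hpL)).trans hst'.1, hst'.1⟩
      · exact Or.inl ⟨(F1 w (Or.inr h)).trans hst'.1, hst'.1⟩
      · exact Or.inr (Or.inl ⟨(F2 w (Or.inr hqH)).trans hst'.2, hst'.2⟩)
    · right; left
      have hwL : w ∈ Mi ∪ Hi := by
        rcases hw with (hw | hw) | hw
        · exact absurd (h2.trans_lt h) (hLp w hw).not_gt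
        · exact Or.inl hw
        · exact Or.inr hw
      exact ⟨(F2 w hwL).trans_le hle.2, (lt2 (hG.P u h1 w hw h.le).2 h (by abel)).trans_le hle.2⟩
  -- new edge I
  have newI : ∀ u ∈ K, G.Adj v u → ∀ P ∈ Lo ∪ {v} ∪ Hi, ∀ Q ∈ Lo ∪ {v} ∪ Hi, g' P < g' Q → IC g' x2 x3 v u P Q := by
    intro u hu hvu P hP Q hQ hPQ
    obtain ⟨h1, h2, h3⟩ := nb u hu hvu
    rcases hP with (hP | hP) | hP <;> rcases hQ with (hQ | hQ) | hQ
    · right; left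
      refine ⟨(F1 Q (Or.inl hQ)).le, ?_⟩
      have e0 := (hLp Q hQ).trans h2
      exact le2 (hG.P Q (sLo Q hQ) u h1 e0).1 e0 (by abel)
    · rw [Set.mem_singleton_iff] at hQ; subst hQ
      right; right
      rw [pv P hP]
      exact ⟨vsum P hP q hqH, gmono P hP q hqH _ _ (nsum u hu hvu P hP q hqH)⟩
    · right; right
      exact ⟨vsum P hP Q hQ, gmono P hP Q hQ _ _ (nsum u hu hvu P hP Q hQ)⟩
    · rw [Set.mem_singleton_iff] at hP; subst hP
      exact absurd hPQ (cLv Q hQ).not_gt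
    · rw [Set.mem_singleton_iff] at hP hQ; subst hP; subst hQ
      exact absurd hPQ (lt_irrefl _)
    · rw [Set.mem_singleton_iff] at hP; subst hP
      right; right
      rw [vp Q hQ]
      exact ⟨vsum p hpL Q hQ, gmono p hpL Q hQ _ _ (nsum u hu hvu p hpL Q hQ)⟩
    · exact absurd hPQ (cLH Q hQ P hP).not_gt
    · rw [Set.mem_singleton_iff] at hQ; subst hQ
      exact absurd hPQ (cvH P hP).not_gt
    · left
      refine ⟨(F2 P (Or.inr hP)).le, ?_⟩
      have e0 := h3.trans (hHq P hP)
      exact le2 (hG.P u h1 P (sHi P hP) e0).2 e0 (by abel)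
  have nv : ∀ {z}, z ∈ K → z ≠ v := fun hz e => hv (e ▸ hz)
  refine ⟨?_, ?_, ?_, ?_, ?_, ?_⟩
  · rintro x ((h | h) | h)
    · exact Or.inr (hG.sub (sLo x h))
    · exact Or.inl h
    · exact Or.inr (hG.sub (sHi x h))
  · rintro x (rfl | hx)
    · have n1 := hG.nn p (hG.sub hp)
      have n2 := hG.nn q (hG.sub hq)
      refine ⟨n2.1.trans F1q.le, n1.2.1.trans F2p.le, ?_⟩
      have e := (hG.P p hp q hq (hA' p (Or.inl hpL)).le).1
      rw [gq, gp] at e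
      rw [hx2, hx3]
      exact le3 e n1.2.2 hT.le (by abel)
    · exact hG.nn x hx
  · intro P hP Q hQ hPQ
    rcases hP with (hP | hP) | hP <;> rcases hQ with (hQ | hQ) | hQ
    · have := hG.P P (sLo P hP) Q (sLo Q hQ)
      rw [(hLo P hP).1, (hLo Q hQ).1] at this
      exact this hPQ
    · rw [Set.mem_singleton_iff] at hQ; subst hQ
      have e1 := (hG.P P (sLo P hP) q hq (cLH' P hP q hqH).le).1
      have e2 := (hG.P P (sLo P hP) p hp (hLp P hP)).2
      rw [(hLo P hP).1, gq] at e1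
      rw [(hLo P hP).1, gp] at e2
      rw [hx2, hx3]
      exact ⟨le2 e1 hT.le (by abel), le1 e2 (by abel)⟩
    · have := hG.P P (sLo P hP) Q (sHi Q hQ) (cLH' P hP Q hQ).le
      rw [(hLo P hP).1, (hHi Q hQ).1] at this
      exact ⟨le2 this.1 hT.le (by abel), le2 this.2 hT.le (by abel)⟩
    · rw [Set.mem_singleton_iff] at hP; subst hP
      exact absurd hPQ (cLv Q hQ).not_ge
    · rw [Set.mem_singleton_iff] at hP hQ; subst hP; subst hQ
      exact ⟨le_rfl, le_rfl⟩
    · rw [Set.mem_singleton_iff] at hP; subst hP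
      have e1 := (hG.P q hq Q (sHi Q hQ) (hHq Q hQ)).1
      have e2 := (hG.P p hp Q (sHi Q hQ) (cLH' p hpL Q hQ).le).2
      rw [(hHi Q hQ).1, gq] at e1
      rw [(hHi Q hQ).1, gp] at e2
      rw [hx2, hx3]
      exact ⟨le1 e1 (by abel), le2 e2 hT.le (by abel)⟩
    · exact absurd hPQ (cLH Q hQ P hP).not_ge
    · rw [Set.mem_singleton_iff] at hQ; subst hQ
      exact absurd hPQ (cvH P hP).not_ge
    · have := hG.P P (sHi P hP) Q (sHi Q hQ)
      rw [(hHi P hP).1, (hHi Q hQ).1] at this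
      have := this (le1 hPQ (by abel))
      exact ⟨le1 this.1 (by abel), le1 this.2 (by abel)⟩
  · rintro z (rfl | hz)
    · exact ⟨z, Or.inl (Or.inr rfl), fun _ => rfl, Relation.ReflTransGen.refl⟩
    · obtain ⟨w, hw, h1, h2⟩ := hG.J z hz
      have h3 : Relation.ReflTransGen (Dn G (insert v K) x2 x3) z w :=
        Relation.ReflTransGen.mono (fun x y h => ⟨Or.inr h.1, Or.inr h.2.1, h.2.2⟩) _ _ h2
      rcases hw with (hw | hw) | hw
      · exact ⟨w, Or.inl (Or.inl hw), h1, h3⟩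
      · refine ⟨v, Or.inl (Or.inr rfl), ?_, h3.tail ⟨Or.inr (hG.sub (sMi w hw)), Or.inl rfl, ?_, F1 w (Or.inr hw), F2 w (Or.inl hw)⟩⟩
        · rintro (rfl | rfl)
          · exact absurd ha hv
          · exact absurd hb hv
        · exact ((hN w (hG.sub (sMi w hw))).2 (Or.inr (Or.inl hw))).symm
      · exact ⟨w, Or.inr hw, h1, h3⟩
  · rintro x (rfl | hx) y (rfl | hy) hxy P hP Q hQ hPQ
    · exact absurd rfl hxy.ne
    · exact newI y hy hxy P hP Q hQ hPQ
    · exact (newI x hx hxy.symm P hP Q hQ hPQ).swap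
    · rcases hP with (hP | hP) | hP <;> rcases hQ with (hQ | hQ) | hQ
      · have := hG.I x hx y hy hxy P (sLo P hP) Q (sLo Q hQ)
        unfold IC at *
        rw [(hLo P hP).1, (hLo Q hQ).1] at this
        exact this hPQ
      · rw [Set.mem_singleton_iff] at hQ; subst hQ
        unfold IC
        rw [pv P hP]
        rcases hG.I x hx y hy hxy P (sLo P hP) q hq (cLH' P hP q hqH) with h | h | h
        · exact Or.inl h
        · exact Or.inr (Or.inl ⟨h.1.trans F1q.le, h.2.trans F1q.le⟩)
        · exact Or.inr (Or.inr ⟨gmono P hP q hqH _ _ h.1, gmono P hP q hqH _ _ h.2⟩)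
      · rcases hG.I x hx y hy hxy P (sLo P hP) Q (sHi Q hQ) (cLH' P hP Q hQ) with h | h | h
        · exact Or.inl h
        · exact Or.inr (Or.inl h)
        · exact Or.inr (Or.inr ⟨gmono P hP Q hQ _ _ h.1, gmono P hP Q hQ _ _ h.2⟩)
      · rw [Set.mem_singleton_iff] at hP; subst hP
        exact absurd hPQ (cLv Q hQ).not_gt
      · rw [Set.mem_singleton_iff] at hP hQ; subst hP; subst hQ
        exact absurd hPQ (lt_irrefl _)
      · rw [Set.mem_singleton_iff] at hP; subst hP
        unfold IC
        rw [vp Q hQ]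
        rcases hG.I x hx y hy hxy p hp Q (sHi Q hQ) (cLH' p hpL Q hQ) with h | h | h
        · exact Or.inl ⟨h.1.trans F2p.le, h.2.trans F2p.le⟩
        · exact Or.inr (Or.inl h)
        · exact Or.inr (Or.inr ⟨gmono p hpL Q hQ _ _ h.1, gmono p hpL Q hQ _ _ h.2⟩)
      · exact absurd hPQ (cLH Q hQ P hP).not_gt
      · rw [Set.mem_singleton_iff] at hQ; subst hQ
        exact absurd hPQ (cvH P hP).not_gt
      · have := hG.I x hx y hy hxy P (sHi P hP) Q (sHi Q hQ)
        unfold IC at *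
        rw [(hHi P hP).1, (hHi Q hQ).1] at this
        have e : x2 Q + x3 P + (g' Q + T) - (g' P + T) = x2 Q + x3 P + g' Q - g' P := by abel
        rw [e] at this
        exact this (lt1 hPQ (by abel))
  · rintro x (rfl | hx) y (rfl | hy) hxy z (rfl | hz) hzx hzy
    · exact absurd rfl hxy.ne
    · exact absurd rfl hxy.ne
    · exact absurd rfl hzx
    · exact newD y hy hxy z hz hzy
    · exact absurd rfl hzy
    · exact (newD x hx hxy.symm z hz hzx).swap
    · rcases hG.I x hx y hy hxy p hp q hq (hA' p (Or.inl hpL)) with h | h | h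
      · exact Or.inr (Or.inl ⟨h.1.trans_lt F2p, h.2.trans_lt F2p⟩)
      · exact Or.inl ⟨h.1.trans_lt F1q, h.2.trans_lt F1q⟩
      · right; right
        rw [gq, gp] at h
        rw [hx2, hx3]
        exact ⟨lt2 h.1 hT (by abel), lt2 h.2 hT (by abel)⟩
    · exact hG.D x hx y hy hxy z hz hzx hzy

end vec
end FixTri
namespace FixTri
section lab
variable {V : Type*}

abbrev Lab (V : Type*) := (V × V) ⊕ Bool

lemma build_inv {G : SimpleGraph V} {a b : V} {K : Set V} {L : List V} (h : Build G a b K L) :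
    L.head? = some a ∧ L.getLast? = some b ∧ L.Nodup ∧ ∀ x ∈ L, x ∈ K := by
  induction h with
  | base hab => simp [hab.ne]
  | step K l p mid q r v hB hv hN ih =>
    obtain ⟨h1, h2, h3, h4⟩ := ih
    refine ⟨?_, ?_, ?_, ?_⟩
    · cases l <;> simpa using h1
    · rw [List.getLast?_append, List.getLast?_cons_cons, List.getLast?_cons_cons]
      rw [List.getLast?_append, show p :: (mid ++ q :: r) = (p :: mid) ++ q :: r from rfl, List.getLast?_append] at h2
      simpa [List.getLast?_cons] using h2
    · have hvn : v ∉ l ++ p :: (mid ++ q :: r) := fun h => hv (h4 v h)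
      have hsub : (l ++ p :: (q :: r)).Sublist (l ++ p :: (mid ++ q :: r)) :=
        List.Sublist.append_left (List.Sublist.cons_cons p (List.sublist_append_right _ _)) l
      have hnd := h3.sublist hsub
      have e : (l ++ p :: v :: q :: r).Perm (v :: (l ++ p :: (q :: r))) := by
        have : (l ++ p :: v :: q :: r) = (l ++ [p]) ++ v :: (q :: r) := by simp
        rw [this]
        refine List.perm_middle.trans ?_
        simp
      rw [e.nodup_iff, List.nodup_cons]
      exact ⟨fun h => hvn (hsub.subset h), hnd⟩
    · intro x hx
      simp only [List.mem_append, List.mem_cons] at hx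
      have h4' : ∀ x, (x ∈ l ∨ x = p ∨ x ∈ mid ∨ x = q ∨ x ∈ r) → x ∈ K := by
        intro x hx; apply h4; simpa using hx
      rcases hx with h | h | h | h | h
      · exact Or.inr (h4' x (by tauto))
      · exact Or.inr (h4' x (by tauto))
      · exact Or.inl h
      · exact Or.inr (h4' x (by tauto))
      · exact Or.inr (h4' x (by tauto))

lemma idx_pairwise [DecidableEq V] (l : List V) (h : l.Nodup) :
    l.Pairwise (fun x y => l.idxOf x < l.idxOf y) := by
  rw [List.pairwise_iff_getElem]
  intro i j hi hj hij
  rw [h.idxOf_getElem, h.idxOf_getElem]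
  exact hij

lemma base_good {G : SimpleGraph V} {a b : V} (hab : G.Adj a b) (g : V → Lab V → ℤ)
    (hg : g a < g b) (hb : g b - g a ≤ 1) : ∃ x2 x3, Good G a b {a, b} {x | x ∈ [a, b]} (1 : Lab V → ℤ) g x2 x3 := by
  classical
  have hne := hab.ne
  have h0 : 0 ≤ g b - g a := sub_nonneg.2 hg.le
  refine ⟨fun x => if x = a then g b - g a else 0, fun x => if x = b then g b - g a else 0, ?_⟩
  have hK : ∀ x, x ∈ ({a, b} : Set V) → x = a ∨ x = b := fun x h => h
  have hS : ∀ x, x ∈ {x | x ∈ [a, b]} → x = a ∨ x = b := fun x h => by simpa using h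
  refine ⟨?_, ?_, ?_, ?_, ?_, ?_⟩
  · intro x hx; simpa using hx
  · intro x hx
    rcases hK x hx with rfl | rfl
    · simp [hne, hb, hg.le]
    · simp [hne.symm, hb, hg.le]
  · intro P hP Q hQ hPQ
    rcases hS P hP with rfl | rfl <;> rcases hS Q hQ with rfl | rfl
    · exact ⟨le_rfl, le_rfl⟩
    · simp [hne, hne.symm]
    · exact absurd hg hPQ.not_gt
    · exact ⟨le_rfl, le_rfl⟩
  · intro z hz
    exact ⟨z, by simpa using hz, fun _ => rfl, Relation.ReflTransGen.refl⟩
  · intro x hx y hy hxy P hP Q hQ hPQ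
    rcases hS P hP with rfl | rfl <;> rcases hS Q hQ with rfl | rfl
    · exact absurd hPQ (lt_irrefl _)
    · right; right
      rcases hK x hx with rfl | rfl <;> rcases hK y hy with rfl | rfl <;> simp [hne, hne.symm]
    · exact absurd hg hPQ.not_gt
    · exact absurd hPQ (lt_irrefl _)
  · intro x hx y hy hxy z hz h1 h2
    exfalso
    rcases hK x hx with rfl | rfl <;> rcases hK y hy with rfl | rfl <;> rcases hK z hz with rfl | rfl <;> simp_all

lemma build_good {G : SimpleGraph V} {a b : V} {K : Set V} {L : List V} (h : Build G a b K L) :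
    ∀ g : V → Lab V → ℤ, L.Pairwise (fun x y => g x < g y) → g b - g a ≤ 1 →
      (∀ x, ∀ u ∈ K, ∀ w, g x (Sum.inl (u, w)) = 0) →
      ∃ x2 x3, Good G a b K {x | x ∈ L} (1 : Lab V → ℤ) g x2 x3 := by
  classical
  induction h with
  | base hab =>
    intro g hg hb _
    exact base_good hab g (by simpa using hg) hb
  | step K l p mid q r v hB hv hN ih =>
    intro g' hg' hb' h0'
    obtain ⟨i1, i2, i3, i4⟩ := build_inv hB
    have haL : a ∈ l ++ [p] := by
      cases l with
      | nil => simp at i1; simp [i1]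
      | cons y l => simp at i1; simp [i1]
    have hbH : b ∈ q :: r := by
      have : (q :: r).getLast? = some b := by
        rw [List.getLast?_append, show p :: (mid ++ q :: r) = (p :: mid) ++ q :: r from rfl, List.getLast?_append] at i2
        simpa [List.getLast?_cons] using i2
      exact List.mem_of_getLast? this
    have haK : a ∈ K := i4 a (List.mem_of_head? i1)
    have hbK : b ∈ K := i4 b (List.mem_of_getLast? i2)
    have esp : l ++ p :: (mid ++ q :: r) = (l ++ [p]) ++ (mid ++ (q :: r)) := by simp
    have esp' : l ++ p :: v :: q :: r = (l ++ [p]) ++ (v :: (q :: r)) := by simp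
    rw [esp, List.nodup_append, List.nodup_append (l₁ := mid)] at i3
    obtain ⟨nL, ⟨nM, nH, dMH⟩, dL⟩ := i3
    have hv0 : ∀ x w, g' x (Sum.inl (v, w)) = 0 := fun x w => h0' x v (Or.inl rfl) w
    let E : V → Lab V → ℤ := fun x => Sum.elim
      (fun st => if st.1 = v ∧ st.2 ∈ mid ∧ mid.idxOf st.2 ≤ mid.idxOf x then 1 else 0) (fun _ => 0)
    let T : Lab V → ℤ := Sum.elim
      (fun st => if st.1 = v ∧ (st.2 ∈ mid ∨ st.2 = q) then 1 else 0) (fun _ => 0)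
    let g : V → Lab V → ℤ := fun x => if x ∈ mid then g' v + E x else if x ∈ q :: r then g' x + T else g' x
    have gM : ∀ x ∈ mid, g x = g' v + E x := fun x hx => by simp only [g, if_pos hx]
    have gH : ∀ x ∈ q :: r, g x = g' x + T := fun x hx => by
      simp only [g, if_neg (show x ∉ mid from fun h => dMH x h x hx rfl), if_pos hx]
    have gL : ∀ x ∈ l ++ [p], g x = g' x := fun x hx => by
      simp only [g, if_neg (show x ∉ mid from fun h => dL x hx x (List.mem_append_left _ h) rfl),
        if_neg (show x ∉ q :: r from fun h => dL x hx x (List.mem_append_right _ h) rfl)]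
    have qm : q ∉ mid := fun h => dMH q h q (by simp) rfl
    have E0 : ∀ x ∈ mid, 0 < E x := by
      intro x hx
      rw [Pi.lt_def]
      refine ⟨?_, Sum.inl (v, x), ?_⟩
      · rintro (st | s)
        · simp only [E, Sum.elim_inl, Pi.zero_apply]; split_ifs <;> simp
        · simp [E]
      · simp [E, hx]
    have ET : ∀ x ∈ mid, E x < T := by
      intro x hx
      rw [Pi.lt_def]
      refine ⟨?_, Sum.inl (v, q), ?_⟩
      · rintro (st | s)
        · simp only [E, T, Sum.elim_inl]; split_ifs <;> first | (simp; done) | (exfalso; tauto)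
        · simp [E, T]
      · simp [E, T, qm]
    have T0 : 0 < T := by
      rw [Pi.lt_def]
      refine ⟨?_, Sum.inl (v, q), ?_⟩
      · rintro (st | s)
        · simp only [T, Sum.elim_inl, Pi.zero_apply]; split_ifs <;> simp
        · simp [T]
      · simp [T]
    have EE : ∀ x ∈ mid, ∀ y ∈ mid, mid.idxOf x < mid.idxOf y → E x < E y := by
      intro x hx y hy hxy
      rw [Pi.lt_def]
      refine ⟨?_, Sum.inl (v, y), ?_⟩
      · rintro (st | s)
        · simp only [E, Sum.elim_inl]
          split_ifs with h1 h2
          · simp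
          · exact absurd ⟨h1.1, h1.2.1, h1.2.2.trans hxy.le⟩ h2
          · simp
          · simp
        · simp [E]
      · have n1 : ¬ (mid.idxOf y ≤ mid.idxOf x) := hxy.not_ge
        simp only [E, Sum.elim_inl, hy, n1, le_refl, true_and, and_false, and_true, if_true, if_false]; exact one_pos
    rw [esp', List.pairwise_append, List.pairwise_cons] at hg'
    obtain ⟨pL, ⟨pv, pH⟩, pLH⟩ := hg'
    have pLv : ∀ x ∈ l ++ [p], g' x < g' v := fun x hx => pLH x hx v (by simp)
    have hpw : (l ++ p :: (mid ++ q :: r)).Pairwise (fun x y => g x < g y) := by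
      rw [esp, List.pairwise_append, List.pairwise_append (l₁ := mid)]
      refine ⟨?_, ⟨?_, ?_, ?_⟩, ?_⟩
      · exact pL.imp_of_mem fun hx hy h => by rw [gL _ hx, gL _ hy]; exact h
      · exact (idx_pairwise mid nM).imp_of_mem fun hx hy h => by
          rw [gM _ hx, gM _ hy]; exact lt1 (EE _ hx _ hy h) (by abel)
      · exact pH.imp_of_mem fun hx hy h => by rw [gH _ hx, gH _ hy]; exact lt1 h (by abel)
      · intro x hx y hy
        rw [gM x hx, gH y hy]
        exact lt2 (pv y hy).le (ET x hx) (by abel)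
      · intro x hx y hy
        rw [gL x hx]
        rcases List.mem_append.1 hy with hy | hy
        · rw [gM y hy]; exact lt2 (pLv x hx).le (E0 y hy) (by abel)
        · rw [gH y hy]; exact lt2 T0.le (pLH x hx y (List.mem_cons_of_mem _ hy)) (by abel)
    have hb2 : g b - g a ≤ 1 := by
      rw [gH b hbH, gL a haL]
      rintro (⟨s, t⟩ | s)
      · have := hb' (Sum.inl (s, t))
        simp only [Pi.sub_apply, Pi.add_apply, Pi.one_apply, T, Sum.elim_inl] at this ⊢
        split_ifs with hs
        · rw [hs.1, hv0, hv0]; simp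
        · simpa using this
      · have := hb' (Sum.inr s)
        simpa [T] using this
    have hz : ∀ x, ∀ u ∈ K, ∀ w, g x (Sum.inl (u, w)) = 0 := by
      intro x u hu w
      have huv : u ≠ v := fun e => hv (e ▸ hu)
      have h1 : ∀ y, g' y (Sum.inl (u, w)) = 0 := fun y => h0' y u (Or.inr hu) w
      simp only [g]
      split_ifs
      · simp [E, huv, h1]
      · simp [T, huv, h1]
      · exact h1 x
    obtain ⟨x2, x3, hgood⟩ := ih g hpw hb2 hz
    have hpp : p ∈ l ++ [p] := by simp
    have hqq : q ∈ q :: r := by simp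
    refine ⟨Function.update x2 v (x2 q + g' q - g' v), Function.update x3 v (x3 p + g' v - g' p), ?_⟩
    have e1 : {x | x ∈ l ++ p :: (mid ++ q :: r)} = {x | x ∈ l ++ [p]} ∪ {x | x ∈ mid} ∪ {x | x ∈ q :: r} := by
      ext x; simp; tauto
    have e2 : {x | x ∈ l ++ p :: v :: q :: r} = {x | x ∈ l ++ [p]} ∪ {v} ∪ {x | x ∈ q :: r} := by
      ext x; simp; tauto
    have hpv : p ≠ v := fun e => hv (e ▸ i4 p (by simp))
    have hqv : q ≠ v := fun e => hv (e ▸ i4 q (by simp))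
    rw [e2]
    have hgood' := Good.congr (X2 := Function.update x2 v (x2 q + g' q - g' v)) (X3 := Function.update x3 v (x3 p + g' v - g' p)) hgood
      (fun x hx => Function.update_of_ne (show x ≠ v from fun e => hv (e ▸ hx)) _ _) (fun x hx => Function.update_of_ne (show x ≠ v from fun e => hv (e ▸ hx)) _ _)
    rw [e1] at hgood'
    refine step_vec (T := T) (E := E) (p := p) (q := q) hgood' hv haK hbK hpp hqq ?_ ?_ ?_ ?_ T0 (pLv p hpp) (pv q hqq) ?_ ?_ ?_
    · intro u hu
      rw [hN u hu]; simp
    · intro x hx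
      refine ⟨gL x hx, ?_⟩
      rcases List.mem_append.1 hx with h | h
      · exact ((List.pairwise_append.1 pL).2.2 x h p (by simp)).le
      · simp at h; rw [h]
    · intro x hx
      refine ⟨gH x hx, ?_⟩
      rcases List.mem_cons.1 hx with rfl | h
      · exact le_rfl
      · exact ((List.pairwise_cons.1 pH).1 x h).le
    · exact fun x hx => ⟨gM x hx, E0 x hx, ET x hx⟩
    · rw [← e1]
      have := hpw.imp (S := fun x y => g x < g y ∨ x = y ∨ g y < g x) (fun h => Or.inl h)
      exact fun x hx y hy => @List.Pairwise.forall_of_forall _ (fun x y => g x < g y ∨ x = y ∨ g y < g x) _ ⟨fun x y h => h.elim (fun h => Or.inr (Or.inr h)) fun h => h.elim (fun h => Or.inr (Or.inl h.symm)) Or.inl⟩ (fun x _ => Or.inr (Or.inl rfl)) this x hx y hy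
    · rw [Function.update_self, Function.update_of_ne hqv]
    · rw [Function.update_self, Function.update_of_ne hpv]

lemma top_good {G : SimpleGraph V} {a b c : V} (h : Build G a b Set.univ [a, c, b]) :
    ∃ g x2 x3 : V → Lab V → ℤ, Good G a b Set.univ {x | x ∈ [a, c, b]} (1 : Lab V → ℤ) g x2 x3 := by
  classical
  obtain ⟨-, -, hnd, -⟩ := build_inv h
  have hac : a ≠ c := by rintro rfl; simp at hnd
  have hab : a ≠ b := by rintro rfl; simp at hnd
  have hcb : c ≠ b := by rintro rfl; simp at hnd
  let g : V → Lab V → ℤ := fun x => if x = a then 0 else if x = c then Sum.elim (fun _ => 0) (fun s => if s then 1 else 0) else Sum.elim (fun _ => 0) (fun _ => 1)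
  have ga : g a = 0 := by simp [g]
  have gc : g c = Sum.elim (fun _ => 0) (fun s => if s then 1 else 0) := by simp [g, hac.symm]
  have gb : g b = Sum.elim (fun _ => 0) (fun _ => 1) := by simp [g, hab.symm, hcb.symm]
  have h1 : g a < g c := by
    rw [ga, gc, Pi.lt_def]
    refine ⟨?_, Sum.inr true, by simp⟩
    rintro (_ | _ | _) <;> simp
  have h2 : g c < g b := by
    rw [gb, gc, Pi.lt_def]
    refine ⟨?_, Sum.inr false, by simp⟩
    rintro (_ | _ | _) <;> simp
  refine ⟨g, build_good h g ?_ ?_ ?_⟩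
  · simp [h1, h2, h1.trans h2]
  · rw [ga, gb]
    rintro (_ | _ | _) <;> simp
  · intro x u _ w
    simp only [g]; split_ifs <;> simp
end lab
end FixTri
namespace FixTri

section plane
variable {V : Type*}

lemma seg_ub (F : ℝ × ℝ →ₗ[ℝ] ℝ) {x y p : ℝ × ℝ} (hp : p ∈ segment ℝ x y) {c : ℝ} (hx : F x < c) (hy : F y < c) :
    F p < c := by
  obtain ⟨a, b, ha, hb, hab, rfl⟩ := hp
  simp only [map_add, map_smul, smul_eq_mul]
  have e : c = a * c + b * c := by rw [← add_mul, hab, one_mul]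
  rw [e]
  rcases ha.eq_or_lt with rfl | ha
  · have : b = 1 := by linarith
    subst this; linarith
  · have := mul_lt_mul_of_pos_left hx ha
    have := mul_le_mul_of_nonneg_left hy.le hb
    linarith

lemma seg_lb (F : ℝ × ℝ →ₗ[ℝ] ℝ) {x y p : ℝ × ℝ} (hp : p ∈ segment ℝ x y) {c : ℝ} (hx : c < F x) (hy : c < F y) :
    c < F p := by
  have := seg_ub (-F) hp (c := -c) (by simpa using hx) (by simpa using hy)
  simpa using this

lemma share_aux (F : Fin 3 → (ℝ × ℝ →ₗ[ℝ] ℝ)) {x y z p : ℝ × ℝ}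
    (h1 : ∃ i, F i x < F i z ∧ F i y < F i z) (h2 : ∃ i, F i x < F i y ∧ F i z < F i y)
    (hp : p ∈ segment ℝ x y) (hq : p ∈ segment ℝ x z) : p = x := by
  obtain ⟨i, i1, i2⟩ := h1
  obtain ⟨j, j1, j2⟩ := h2
  rw [segment_eq_image'] at hp hq
  obtain ⟨s, ⟨s0, s1⟩, rfl⟩ := hp
  obtain ⟨t, ⟨t0, t1⟩, ht⟩ := hq
  simp only at ht ⊢
  have e : t • (z - x) = s • (y - x) := by simpa using ht
  have ei := congrArg (F i) e
  have ej := congrArg (F j) e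
  simp only [map_smul, map_sub, smul_eq_mul] at ei ej
  rcases s0.eq_or_lt with rfl | s0
  · simp
  exfalso
  have tp : 0 < t := by
    rcases t0.eq_or_lt with rfl | t0
    · rw [zero_mul] at ej
      have := mul_pos s0 (sub_pos.2 j1)
      linarith
    · exact t0
  have a1 : t < s := by
    by_contra hc
    push Not at hc
    have : s * (F i y - F i x) < t * (F i z - F i x) := by
      calc s * (F i y - F i x) < s * (F i z - F i x) := mul_lt_mul_of_pos_left (by linarith) s0
        _ ≤ t * (F i z - F i x) := mul_le_mul_of_nonneg_right hc (by linarith)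
    linarith
  have a2 : t * (F j z - F j x) < s * (F j y - F j x) := by
    calc t * (F j z - F j x) < t * (F j y - F j x) := mul_lt_mul_of_pos_left (by linarith) tp
      _ ≤ s * (F j y - F j x) := mul_le_mul_of_nonneg_right a1.le (by linarith)
  linarith

lemma fin3_pig (i j k l : Fin 3) (h1 : i ≠ j) (h2 : k ≠ l) : i = k ∨ i = l ∨ j = k ∨ j = l := by
  revert i j k l; decide

lemma schnyder [Fintype V] {G : SimpleGraph V} (hc : G.Connected) (hn : 3 ≤ Fintype.card V) (δ : V → ℝ × ℝ)
    (F : Fin 3 → (ℝ × ℝ →ₗ[ℝ] ℝ))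
    (hD : ∀ x y z, G.Adj x y → z ≠ x → z ≠ y → ∃ i, F i (δ x) < F i (δ z) ∧ F i (δ y) < F i (δ z)) :
    IsPlaneDrawing G δ := by
  classical
  refine ⟨?_, ?_, ?_⟩
  · intro u v huv
    by_contra hne
    obtain ⟨z, hz⟩ : ∃ z, z ∉ ({u, v} : Finset V) := by
      by_contra hcon
      push Not at hcon
      have h1 := Finset.card_le_card (fun x _ => hcon x : (Finset.univ : Finset V) ⊆ {u, v})
      have h2 := Finset.card_le_two (a := u) (b := v)
      rw [Finset.card_univ] at h1
      omega
    obtain ⟨w⟩ := hc.preconnected u z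
    obtain ⟨d, -, d1, d2⟩ := w.exists_boundary_dart {x | x = u ∨ x = v} (Or.inl rfl) (by simpa using hz)
    have d2' : ¬ (d.snd = u ∨ d.snd = v) := d2
    push Not at d2'
    rcases d1 with h | h
    · have hadj := d.adj
      rw [h] at hadj
      obtain ⟨i, i1, -⟩ := hD _ _ v hadj (fun e => hne e.symm) (fun e => d2'.2 e.symm)
      rw [huv] at i1; exact lt_irrefl _ i1
    · have hadj := d.adj
      rw [h] at hadj
      obtain ⟨i, i1, -⟩ := hD _ _ u hadj hne (fun e => d2'.1 e.symm)
      rw [huv] at i1; exact lt_irrefl _ i1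
  · intro u v w huv hw
    by_contra hcon
    push Not at hcon
    obtain ⟨i, i1, i2⟩ := hD u v w huv hcon.1 hcon.2
    exact lt_irrefl _ (seg_ub (F i) hw i1 i2)
  · intro u v a b huv hab hne p hp hq
    have hsh : ∀ x y z, G.Adj x y → G.Adj x z → y ≠ z → p ∈ segment ℝ (δ x) (δ y) → p ∈ segment ℝ (δ x) (δ z) → p = δ x := by
      intro x y z hxy hxz hyz h1 h2
      exact share_aux F (hD x y z hxy hxz.ne.symm hyz.symm) (hD x z y hxz hxy.ne.symm hyz) h1 h2
    by_cases h1 : u = a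
    · subst h1
      exact ⟨u, Or.inl rfl, Or.inl rfl, hsh u v b huv hab (fun e => hne (by rw [e])) hp hq⟩
    by_cases h2 : u = b
    · subst h2
      rw [segment_symm ℝ (δ a)] at hq
      exact ⟨u, Or.inl rfl, Or.inr rfl, hsh u v a huv hab.symm (fun e => hne (by rw [e, Set.pair_comm])) hp hq⟩
    by_cases h3 : v = a
    · subst h3
      rw [segment_symm ℝ (δ u)] at hp
      exact ⟨v, Or.inr rfl, Or.inl rfl, hsh v u b huv.symm hab (fun e => hne (by rw [e, Set.pair_comm])) hp hq⟩
    by_cases h4 : v = b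
    · subst h4
      rw [segment_symm ℝ (δ u)] at hp
      rw [segment_symm ℝ (δ a)] at hq
      exact ⟨v, Or.inr rfl, Or.inr rfl, hsh v u a huv.symm hab.symm (fun e => hne (by rw [e])) hp hq⟩
    exfalso
    obtain ⟨i, i1, i2⟩ := hD u v a huv (Ne.symm h1) (Ne.symm h3)
    obtain ⟨j, j1, j2⟩ := hD u v b huv (Ne.symm h2) (Ne.symm h4)
    obtain ⟨k, k1, k2⟩ := hD a b u hab h1 h2
    obtain ⟨l, l1, l2⟩ := hD a b v hab h3 h4
    have hij : i ≠ j := by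
      rintro rfl
      have A1 := seg_ub (F i) hp i1 i2
      have A2 := seg_ub (F i) hp j1 j2
      exact lt_irrefl _ (seg_lb (F i) hq A1 A2)
    have hkl : k ≠ l := by
      rintro rfl
      have A1 := seg_ub (F k) hq k1 k2
      have A2 := seg_ub (F k) hq l1 l2
      exact lt_irrefl _ (seg_lb (F k) hp A1 A2)
    rcases fin3_pig i j k l hij hkl with rfl | rfl | rfl | rfl
    · exact lt_asymm i1 k1
    · exact lt_asymm i2 l1
    · exact lt_asymm j1 k2
    · exact lt_asymm j2 l2
end plane

section es
variable {V : Type*}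

lemma es_aux (R : V → V → Prop) (hR : ∀ x y z, R x y → R y z → R x z) (L : List V) (hL : L.Nodup) :
    ∃ A : V → ℕ, (∀ v ∈ L, ∃ s, (v :: s).Sublist L ∧ (v :: s).Pairwise R ∧ (v :: s).length = A v) ∧
      L.Pairwise (fun v w => R v w → A w < A v) := by
  classical
  induction L with
  | nil => exact ⟨fun _ => 0, by simp, List.Pairwise.nil⟩
  | cons v L ih =>
    rw [List.nodup_cons] at hL
    obtain ⟨A, h1, h2⟩ := ih hL.2
    have key : ∃ n, (∃ s, (v :: s).Sublist (v :: L) ∧ (v :: s).Pairwise R ∧ (v :: s).length = n) ∧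
        ∀ w ∈ L, R v w → A w < n := by
      by_cases hex : ∃ w ∈ L, R v w
      · obtain ⟨w0, hw0, hr0⟩ := hex
        obtain ⟨w, hw, hmax⟩ := Finset.exists_max_image (L.toFinset.filter (fun w => R v w)) A ⟨w0, by simp [hw0, hr0]⟩
        simp only [Finset.mem_filter, List.mem_toFinset] at hw hmax
        obtain ⟨s, s1, s2, s3⟩ := h1 w hw.1
        refine ⟨A w + 1, ⟨w :: s, s1.cons_cons v, ?_, by rw [List.length_cons, s3]⟩, ?_⟩
        · rw [List.pairwise_cons]
          refine ⟨?_, s2⟩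
          intro y hy
          rcases List.mem_cons.1 hy with rfl | hy
          · exact hw.2
          · exact hR _ _ _ hw.2 ((List.pairwise_cons.1 s2).1 y hy)
        · intro y hy hr
          exact Nat.lt_succ_of_le (hmax y ⟨hy, hr⟩)
      · refine ⟨1, ⟨[], by simp, by simp, by simp⟩, fun w hw hr => absurd ⟨w, hw, hr⟩ hex⟩
    obtain ⟨n, ⟨s, s1, s2, s3⟩, hn⟩ := key
    have hup : ∀ w ∈ L, Function.update A v n w = A w := fun w hw =>
      Function.update_of_ne (show w ≠ v from fun e => hL.1 (e ▸ hw)) _ _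
    refine ⟨Function.update A v n, ?_, ?_⟩
    · intro w hw
      rcases List.mem_cons.1 hw with rfl | hw
      · exact ⟨s, s1, s2, by rw [Function.update_self, s3]⟩
      · obtain ⟨s, s1, s2, s3⟩ := h1 w hw
        exact ⟨s, s1.trans (List.sublist_cons_self _ _), s2, by rw [hup w hw, s3]⟩
    · rw [List.pairwise_cons]
      refine ⟨?_, ?_⟩
      · intro w hw hr
        rw [Function.update_self, hup w hw]; exact hn w hw hr
      · exact h2.imp_of_mem fun hx hy h hr => by rw [hup _ hx, hup _ hy]; exact h hr

lemma es (f : V → ℝ) (hf : Function.Injective f) (L : List V) (hL : L.Nodup) :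
    ∃ s : List V, s.Sublist L ∧ L.length ≤ s.length ^ 2 ∧
      (s.Pairwise (fun x y => f x < f y) ∨ s.Pairwise (fun x y => f y < f x)) := by
  classical
  by_contra hcon
  push Not at hcon
  obtain ⟨A, A1, A2⟩ := es_aux (fun x y => f x < f y) (fun x y z => lt_trans) L hL
  obtain ⟨B, B1, B2⟩ := es_aux (fun x y => f y < f x) (fun x y z h h' => lt_trans h' h) L hL
  have hN : 0 < L.length := by
    by_contra h0
    have := hcon [] (by simp) (by omega)
    simp at this
  set k := Nat.sqrt (L.length - 1) with hk
  have hkk : k ^ 2 ≤ L.length - 1 := Nat.sqrt_le' _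
  have hs : ∀ s : List V, s.Sublist L → (s.Pairwise (fun x y => f x < f y) ∨ s.Pairwise (fun x y => f y < f x)) → s.length ≤ k := by
    intro s h1 h2
    rw [hk, Nat.le_sqrt']
    by_contra h3
    have := hcon s h1 (by omega)
    tauto
  have hA : ∀ v ∈ L, A v ∈ Finset.Icc 1 k := by
    intro v hv
    obtain ⟨s, s1, s2, s3⟩ := A1 v hv
    rw [← s3, Finset.mem_Icc]
    exact ⟨by simp, hs _ s1 (Or.inl s2)⟩
  have hB : ∀ v ∈ L, B v ∈ Finset.Icc 1 k := by
    intro v hv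
    obtain ⟨s, s1, s2, s3⟩ := B1 v hv
    rw [← s3, Finset.mem_Icc]
    exact ⟨by simp, hs _ s1 (Or.inr s2)⟩
  have hnd : (L.map (fun v => (A v, B v))).Nodup := by
    rw [List.Nodup, List.pairwise_map]
    refine ((A2.and B2).and hL).imp ?_
    rintro x y ⟨⟨h1, h2⟩, h3⟩ e
    rw [Prod.mk.injEq] at e
    rcases lt_trichotomy (f x) (f y) with h | h | h
    · have := h1 h; omega
    · exact h3 (hf h)
    · have := h2 h; omega
  have hcard := List.toFinset_card_of_nodup hnd
  have hle : (L.map (fun v => (A v, B v))).toFinset ⊆ Finset.Icc 1 k ×ˢ Finset.Icc 1 k := by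
    intro x hx
    simp only [List.mem_toFinset, List.mem_map] at hx
    obtain ⟨v, hv, rfl⟩ := hx
    exact Finset.mem_product.2 ⟨hA v hv, hB v hv⟩
  have := Finset.card_le_card hle
  rw [hcard, List.length_map, Finset.card_product, Nat.card_Icc] at this
  have e : (k + 1 - 1) * (k + 1 - 1) = k ^ 2 := by rw [Nat.add_sub_cancel, sq]
  omega
end es

section wt
variable {V Λ : Type*} [Fintype Λ]

noncomputable def W (ω : Λ → ℝ) (x : Λ → ℤ) : ℝ := ∑ i, ω i * (x i : ℝ)

lemma W_add (ω : Λ → ℝ) (x y : Λ → ℤ) : W ω (x + y) = W ω x + W ω y := by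
  simp [W, mul_add, Finset.sum_add_distrib]

lemma W_lt {ω : Λ → ℝ} (hω : ∀ i, 0 < ω i) {x y : Λ → ℤ} (h : x < y) : W ω x < W ω y := by
  rw [Pi.lt_def] at h
  obtain ⟨h1, i, hi⟩ := h
  refine Finset.sum_lt_sum (fun j _ => ?_) ⟨i, Finset.mem_univ _, ?_⟩
  · exact mul_le_mul_of_nonneg_left (by exact_mod_cast h1 j) (hω j).le
  · exact mul_lt_mul_of_pos_left (by exact_mod_cast hi) (hω i)

lemma wt (x : V → Λ → ℤ) (P : V → ℝ) (h0 : ∀ v, 0 ≤ x v) (h1 : ∀ v, x v ≤ 1) (L : List V)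
    (hL : L.Pairwise (fun u w => x w < x u ∧ P w < P u)) :
    ∃ (ω : Λ → ℝ) (C : ℝ), (∀ i, 0 < ω i) ∧ ∀ w ∈ L, W ω (x w) = P w + C := by
  classical
  induction L with
  | nil => exact ⟨fun _ => 1, 0, fun _ => one_pos, by simp⟩
  | cons w L ih =>
    rw [List.pairwise_cons] at hL
    obtain ⟨ω, C, hω, hC⟩ := ih hL.2
    cases L with
    | nil => exact ⟨fun _ => 1, W (fun _ => 1) (x w) - P w, fun _ => one_pos, by simp⟩
    | cons u L =>
      obtain ⟨hxu, hPu⟩ := hL.1 u (by simp)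
      have hle : ∀ s ∈ u :: L, x s ≤ x u := by
        intro s hs
        rcases List.mem_cons.1 hs with rfl | hs
        · exact le_rfl
        · exact ((List.pairwise_cons.1 hL.2).1 s hs).1.le
      rw [Pi.lt_def] at hxu
      obtain ⟨hxu, i0, hi0⟩ := hxu
      set N := Finset.univ.filter (fun i => x u i < x w i) with hN
      have hNpos : 0 < (N.card : ℝ) := by
        exact_mod_cast Finset.card_pos.2 ⟨i0, by simp [hN, hi0]⟩
      set ω' : Λ → ℝ := fun i => if x u i < x w i then (P w - P u) / N.card else ω i with hω'
      have hz : ∀ i, x u i < x w i → x u i = 0 ∧ x w i = 1 := by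
        intro i hi
        have a1 : 0 ≤ x u i := h0 u i
        have a2 : x w i ≤ 1 := h1 w i
        omega
      have hsame : ∀ s ∈ u :: L, W ω' (x s) = W ω (x s) := by
        intro s hs
        refine Finset.sum_congr rfl fun i _ => ?_
        simp only [hω']
        split_ifs with h
        · have a1 : x s i ≤ x u i := hle s hs i
          have a2 : 0 ≤ x s i := h0 s i
          have a3 := (hz i h).1
          have : x s i = 0 := by omega
          rw [this]; simp
        · rfl
      refine ⟨ω', C, ?_, ?_⟩
      · intro i
        simp only [hω']
        split_ifs
        · exact div_pos (by linarith) hNpos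
        · exact hω i
      · intro s hs
        rcases List.mem_cons.1 hs with rfl | hs
        · have hu := hC u (by simp)
          rw [← hsame u (by simp)] at hu
          have hd : W ω' (x s) = W ω' (x u) + ∑ i ∈ N, (P s - P u) / N.card := by
            rw [hN, Finset.sum_filter, W, W, ← Finset.sum_add_distrib]
            refine Finset.sum_congr rfl fun i _ => ?_
            split_ifs with h
            · rw [(hz i h).1, (hz i h).2]
              simp only [hω', if_pos h, hN]; simp
            · have a1 : x u i ≤ x s i := hxu i
              have : x s i = x u i := by omega
              rw [this, add_zero]
          rw [hd, hu, Finset.sum_const, nsmul_eq_mul]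
          field_simp
          ring
        · rw [hsame s hs]; exact hC s hs

lemma wt2 (x2 x3 : V → Λ → ℤ) (P Q : V → ℝ) (h2 : ∀ v, 0 ≤ x2 v) (h3 : ∀ v, 0 ≤ x3 v) (h1 : ∀ v, x2 v + x3 v ≤ 1)
    (L : List V) (hL2 : L.Pairwise (fun u w => x2 w < x2 u ∧ P w < P u)) (hL3 : L.Pairwise (fun u w => x3 w < x3 u ∧ Q w < Q u)) :
    ∃ (ω : Λ → ℝ) (C D : ℝ), (∀ i, 0 < ω i) ∧ ∀ w ∈ L, W ω (x2 w) = P w + C ∧ W ω (x3 w) = Q w + D := by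
  classical
  obtain ⟨ω2, C, a1, a2⟩ := wt x2 P h2 (fun v => (le_add_of_nonneg_right (h3 v)).trans (h1 v)) L hL2
  obtain ⟨ω3, D, b1, b2⟩ := wt x3 Q h3 (fun v => (le_add_of_nonneg_left (h2 v)).trans (h1 v)) L hL3
  cases L with
  | nil => exact ⟨ω2, C, D, a1, by simp⟩
  | cons u L =>
    have hle : ∀ s ∈ u :: L, x2 s ≤ x2 u ∧ x3 s ≤ x3 u := by
      intro s hs
      rcases List.mem_cons.1 hs with rfl | hs
      · exact ⟨le_rfl, le_rfl⟩
      · exact ⟨((List.pairwise_cons.1 hL2).1 s hs).1.le, ((List.pairwise_cons.1 hL3).1 s hs).1.le⟩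
    refine ⟨fun i => if x2 u i = 0 then ω3 i else ω2 i, C, D, ?_, ?_⟩
    · intro i
      simp only
      split_ifs
      · exact b1 i
      · exact a1 i
    · intro s hs
      rw [← a2 s hs, ← b2 s hs]
      have l2 := (hle s hs).1
      have l3 := (hle s hs).2
      constructor
      · refine Finset.sum_congr rfl fun i _ => ?_
        simp only
        split_ifs with h
        · have c1 : x2 s i ≤ x2 u i := l2 i
          have c2 : 0 ≤ x2 s i := h2 s i
          have : x2 s i = 0 := by omega
          rw [this]; simp
        · rfl
      · refine Finset.sum_congr rfl fun i _ => ?_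
        simp only
        split_ifs with h
        · rfl
        · have c1 : x3 s i ≤ x3 u i := l3 i
          have c2 : 0 ≤ x3 s i := h3 s i
          have c3 : 0 ≤ x2 u i := h2 u i
          have c4 : x2 u i + x3 u i ≤ 1 := h1 u i
          have : x3 s i = 0 := by omega
          rw [this]; simp
end wt
end FixTri
namespace FixTri
section fin
variable {V : Type*}

lemma chain_list {G : SimpleGraph V} (hc : G.Connected) {M : Type*} [PartialOrder M] {K : Set V} {x2 x3 : V → M} {z w : V}
    (h : Relation.ReflTransGen (Dn G K x2 x3) z w) :
    ∃ L : List V, (z :: L).Pairwise (fun u s => x2 s < x2 u ∧ x3 s < x3 u) ∧ G.dist z w ≤ L.length := by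
  induction h using Relation.ReflTransGen.head_induction_on with
  | refl => exact ⟨[], by simp, by simp⟩
  | head h1 hrest ih =>
    rename_i z z0
    obtain ⟨L, l1, l2⟩ := ih
    refine ⟨z0 :: L, ?_, ?_⟩
    · rw [List.pairwise_cons]
      refine ⟨?_, l1⟩
      intro y hy
      rcases List.mem_cons.1 hy with rfl | hy
      · exact h1.2.2.2
      · have := (List.pairwise_cons.1 l1).1 y hy
        exact ⟨this.1.trans h1.2.2.2.1, this.2.trans h1.2.2.2.2⟩
    · have e1 := hc.dist_triangle (u := z) (v := z0) (w := w)
      have e2 : G.dist z z0 = 1 := SimpleGraph.dist_eq_one_iff_adj.2 h1.2.2.1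
      rw [List.length_cons]
      omega

lemma build_last {G : SimpleGraph V} {a b : V} {K : Set V} {L : List V} (h : Build G a b K L) (x y z : V) (hL : L = [x, y, z]) :
    G.Adj y z := by
  cases h with
  | base hab => simp at hL
  | step K l p mid q r v hB hv hN =>
    have hq : q ∈ K := (build_inv hB).2.2.2 q (by simp)
    have : G.Adj v q := (hN q hq).2 (by simp)
    cases l with
    | nil =>
      simp at hL
      rw [← hL.2.1, ← hL.2.2.1]; exact this
    | cons _ l =>
      have := congrArg List.length hL
      simp at this
      omega

lemma exists_slope [Finite V] (f x : V → ℝ) (hf : Function.Injective f) :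
    ∃ m : ℝ, 0 < m ∧ ∀ u w, u ≠ w → |x u - x w| < m * |f u - f w| := by
  obtain ⟨B, hB⟩ := (Set.finite_range (fun p : V × V => |x p.1 - x p.2| / |f p.1 - f p.2|)).bddAbove
  refine ⟨max B 0 + 1, by positivity, fun u w huw => ?_⟩
  have hp : 0 < |f u - f w| := abs_pos.2 (sub_ne_zero.2 fun e => huw (hf e))
  have := hB ⟨(u, w), rfl⟩
  simp only at this
  rw [← div_lt_iff₀ hp]
  have := le_max_left B 0
  linarith

lemma finish [Fintype V] {G : SimpleGraph V} (hc : G.Connected) (hn : 3 ≤ Fintype.card V)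
    (δ : V → ℝ × ℝ) (hδ : Function.Injective δ) (x2 x3 : V → Lab V → ℤ)
    (h2 : ∀ v, 0 ≤ x2 v) (h3 : ∀ v, 0 ≤ x3 v) (h1 : ∀ v, x2 v + x3 v ≤ 1)
    (hD : ∀ x y z, G.Adj x y → z ≠ x → z ≠ y → Dm x2 x3 x y z)
    (L : List V) (hL : L.Pairwise (fun u s => x2 s < x2 u ∧ x3 s < x3 u)) :
    ∃ δ' : V → ℝ × ℝ, IsPlaneDrawing G δ' ∧ L.length ≤ {v : V | δ' v = δ v}.ncard ^ 2 := by
  classical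
  obtain ⟨t, ht⟩ := exists_generic hδ
  set f : V → ℝ := fun v => FixTri.ht t 1 (δ v) with hf
  have hfe : ∀ v, f v = t * (δ v).1 + (δ v).2 := fun v => by simp [hf, FixTri.ht]
  have hLn : L.Nodup := hL.imp fun h e => by rw [e] at h; exact lt_irrefl _ h.1
  obtain ⟨s, s1, s2, s3⟩ := es f ht L hLn
  obtain ⟨m, m0, hm⟩ := exists_slope f (fun v => (δ v).1) ht
  have hsn := hLn.sublist s1
  obtain ⟨κ, κ0, hκ⟩ : ∃ κ : ℝ, κ ≠ 0 ∧ s.Pairwise (fun u w => |(δ u).1 - (δ w).1| < κ * (f u - f w)) := by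
    rcases s3 with s3 | s3
    · refine ⟨-m, by simpa using m0.ne.symm, (s3.and hsn).imp ?_⟩
      rintro u w ⟨h, hne⟩
      have := hm u w hne
      rw [abs_of_neg (show f u - f w < 0 by linarith)] at this
      linarith
    · refine ⟨m, m0.ne.symm, (s3.and hsn).imp ?_⟩
      rintro u w ⟨h, hne⟩
      have := hm u w hne
      rw [abs_of_pos (show 0 < f u - f w by linarith)] at this
      linarith
  have hLs := hL.sublist s1
  obtain ⟨ω, C, D, hω, hw⟩ := wt2 x2 x3 (fun v => κ * f v + (δ v).1) (fun v => κ * f v - (δ v).1) h2 h3 h1 s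
    ((hLs.and hκ).imp fun {u w} h => ⟨h.1.1, by have := (abs_lt.1 h.2).1; linarith⟩)
    ((hLs.and hκ).imp fun {u w} h => ⟨h.1.2, by have := (abs_lt.1 h.2).2; linarith⟩)
  let X2 : V → ℝ := fun v => W ω (x2 v) - C
  let X3 : V → ℝ := fun v => W ω (x3 v) - D
  let δ' : V → ℝ × ℝ := fun v => ((X2 v - X3 v) / 2, (X2 v + X3 v) / (2 * κ) - t * ((X2 v - X3 v) / 2))
  let f1 : ℝ × ℝ →ₗ[ℝ] ℝ := LinearMap.fst ℝ ℝ ℝ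
  let f2 : ℝ × ℝ →ₗ[ℝ] ℝ := LinearMap.snd ℝ ℝ ℝ
  let ξ : ℝ × ℝ →ₗ[ℝ] ℝ := κ • (t • f1 + f2) + f1
  let η : ℝ × ℝ →ₗ[ℝ] ℝ := κ • (t • f1 + f2) - f1
  have hξ : ∀ v, ξ (δ' v) = X2 v := by
    intro v; simp [ξ, f1, f2, δ']; field_simp; ring
  have hη : ∀ v, η (δ' v) = X3 v := by
    intro v; simp [η, f1, f2, δ']; field_simp; ring
  refine ⟨δ', ?_, ?_⟩
  · refine schnyder hc hn δ' ![ξ, η, -ξ - η] ?_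
    intro x y z hxy hzx hzy
    rcases hD x y z hxy hzx hzy with h | h | h
    · refine ⟨0, ?_⟩
      have e1 := W_lt hω h.1
      have e2 := W_lt hω h.2
      simp only [Matrix.cons_val_zero, hξ, X2]
      constructor <;> linarith
    · refine ⟨1, ?_⟩
      have e1 := W_lt hω h.1
      have e2 := W_lt hω h.2
      simp only [Matrix.cons_val_one, Matrix.cons_val_zero, hη, X3]
      constructor <;> linarith
    · refine ⟨2, ?_⟩
      have e1 := W_lt hω h.1
      have e2 := W_lt hω h.2
      simp only [W_add] at e1 e2
      simp only [Matrix.cons_val, LinearMap.sub_apply, LinearMap.neg_apply, hξ, hη, X2, X3]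
      constructor <;> linarith
  · have hsub : (s.toFinset : Set V) ⊆ {v : V | δ' v = δ v} := by
      intro v hv
      have hv' : v ∈ s := by simpa using hv
      obtain ⟨w1, w2⟩ := hw v hv'
      have e2 : X2 v = κ * f v + (δ v).1 := by simp only [X2, w1]; ring
      have e3 : X3 v = κ * f v - (δ v).1 := by simp only [X3, w2]; ring
      have e4 : (X2 v - X3 v) / 2 = (δ v).1 := by rw [e2, e3]; ring
      have e5 : (X2 v + X3 v) / (2 * κ) = f v := by rw [e2, e3]; field_simp; ring
      show δ' v = δ v
      simp only [δ', e4, e5, hfe]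
      ext <;> simp
    have := Set.ncard_le_ncard hsub (Set.toFinite _)
    rw [Set.ncard_coe_finset, List.toFinset_card_of_nodup hsn] at this
    exact s2.trans (Nat.pow_le_pow_left this 2)

end fin
end FixTri

/-- Let `G` be a connected triangulated planar graph (planar, `n ≥ 3` vertices,
`3n - 6` edges) of graph-theoretic diameter `d`.  Then `fix(G) ≥ √d`: for every
straight-line drawing `δ` of `G` there is a plane straight-line drawing `δ'` fixing
at least `√d` vertices of `δ`. -/
theorem fix_ge_sqrt_diameter {V : Type*} [Fintype V] (G : SimpleGraph V)
    (hplanar : ∃ δ : V → ℝ × ℝ, IsPlaneDrawing G δ)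
    (hn : 3 ≤ Fintype.card V)
    (hedges : G.edgeSet.ncard = 3 * Fintype.card V - 6)
    (hconn : G.Connected) (d : ℕ)
    (hd_ub : ∀ u v : V, G.dist u v ≤ d)
    (hd_max : ∃ u v : V, G.dist u v = d)
    (δ : V → ℝ × ℝ) (hδ : Function.Injective δ) :
    ∃ δ' : V → ℝ × ℝ, IsPlaneDrawing G δ' ∧
      Real.sqrt (d : ℝ) ≤ ({v : V | δ' v = δ v}.ncard : ℝ) := by
  obtain ⟨δ₀, hδ₀⟩ := hplanar
  obtain ⟨A, hT⟩ := FixTri.tri_main hδ₀ hn hedges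
  obtain ⟨w0, c, hw0⟩ := hd_max
  haveI : Nontrivial V := Fintype.one_lt_card_iff_nontrivial.1 (by omega)
  obtain ⟨a, hca⟩ := hconn.preconnected.exists_adj_of_nontrivial c
  obtain ⟨b, hB⟩ := FixTri.build_main hT hconn hn hedges c a hca
  obtain ⟨g, x2, x3, hg⟩ := FixTri.top_good hB
  obtain ⟨L, hL, hLd⟩ : ∃ L : List V, L.Pairwise (fun u s => x2 s < x2 u ∧ x3 s < x3 u) ∧ d ≤ L.length := by
    by_cases hd : d ≤ 1
    · exact ⟨[c], by simp, by simpa using hd⟩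
    obtain ⟨w, hw, h1, h2⟩ := hg.J w0 (Set.mem_univ _)
    have hcb := FixTri.build_last hB a c b rfl
    have hwc : w = c := by
      by_contra hne
      have hw' : w = a ∨ w = b := by
        have : w = a ∨ w = c ∨ w = b := by simpa using hw
        tauto
      have hadj : G.Adj w c := by
        rcases hw' with rfl | rfl
        · exact hca.symm
        · exact hcb.symm
      rw [h1 hw', SimpleGraph.dist_eq_one_iff_adj.2 hadj] at hw0
      omega
    subst hwc
    obtain ⟨L, l1, l2⟩ := FixTri.chain_list hconn h2
    exact ⟨w0 :: L, l1, by rw [List.length_cons]; omega⟩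
  obtain ⟨δ', h1, h2⟩ := FixTri.finish hconn hn δ hδ x2 x3 (fun v => (hg.nn v (Set.mem_univ _)).1)
    (fun v => (hg.nn v (Set.mem_univ _)).2.1) (fun v => (hg.nn v (Set.mem_univ _)).2.2)
    (fun x y z hxy hzx hzy => hg.D x (Set.mem_univ _) y (Set.mem_univ _) hxy z (Set.mem_univ _) hzx hzy) L hL
  refine ⟨δ', h1, ?_⟩
  rw [Real.sqrt_le_left (by positivity)]
  exact_mod_cast hLd.trans h2
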